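/- There exists β₀ > 0 such that for all β < β₀ the following holds. Let k₁ ≥ 4 and k₂,…,k_n be even numbers, let S_l⁼ = Σ_{i≤N−2} t_i σ̄_i^l, and set R₂₁ = C(k₁−1, 2)·σ̄_N^1 (σ̄_{N−1}^1)² (S₁⁼)^{k₁−3} ∏_{l=2}^n (S_l⁼)^{k_l} and R̄₂₁ = C(k₁−2, 2)·σ̄_N^0 (σ̄_{N−1}^1)² S₀⁼ (S₁⁼)^{k₁−4} ∏_{l=2}^n (S_l⁼)^{k_l}, where C(a,2) denotes the binomial coefficient. Then |ν(R₂₁) − (k₁ − 1)·ν(R̄₂₁)| ≤ K/N, where K depends only on β₀, n and k₁+⋯+k_n, not on N. -/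

import Mathlib

open MeasureTheory ProbabilityTheory Finset

noncomputable section

/-- A spin configuration on `N` sites. -/
abbrev Cfg (N : ℕ) := Fin N → Bool

/-- The spin value `±1` of a Boolean. -/
def spin (b : Bool) : ℝ := if b then 1 else -1

/-- Minus the SK Hamiltonian. -/
def negH (N : ℕ) (β h : ℝ) (g : Fin N → Fin N → ℝ) (σ : Cfg N) : ℝ :=
  (β / Real.sqrt N) *
      ∑ i : Fin N, ∑ j : Fin N, (if i < j then g i j * spin (σ i) * spin (σ j) else 0) +
    h * ∑ i : Fin N, spin (σ i)

/-- Gibbs average `⟨f⟩` of a function of `ι`-indexed replicas. -/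
def gibbs (N : ℕ) (β h : ℝ) (g : Fin N → Fin N → ℝ) {ι : Type} [DecidableEq ι] [Fintype ι]
    (f : (ι → Cfg N) → ℝ) : ℝ :=
  (∑ σs : ι → Cfg N, f σs * ∏ l, Real.exp (negH N β h g (σs l))) /
    (∑ σ : Cfg N, Real.exp (negH N β h g σ)) ^ (Fintype.card ι)

/-- The law of the disorder: i.i.d. standard Gaussians. -/
def gaussN (N : ℕ) : Measure (Fin N → Fin N → ℝ) :=
  Measure.pi fun _ => Measure.pi fun _ => gaussianReal 0 1

/-- `ν(f) = E⟨f⟩`. -/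
def nu (N : ℕ) (β h : ℝ) {ι : Type} [DecidableEq ι] [Fintype ι]
    (f : (ι → Cfg N) → ℝ) : ℝ :=
  ∫ g, gibbs N β h g f ∂ gaussN N

/-- `S_l = Σ_i t_i (σ_i^{1(l)} - σ_i^{2(l)})`, replica pairs indexed by `Fin m × Fin 2`. -/
def Sbar (N m : ℕ) (t : Fin N → ℝ) (σs : Fin m × Fin 2 → Cfg N) (l : Fin m) : ℝ :=
  ∑ i, t i * (spin (σs (l, 0) i) - spin (σs (l, 1) i))

/-- `a(k)`: the `k`-th moment of a standard Gaussian. -/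
def gaussMoment (k : ℕ) : ℝ := ∫ x, x ^ k ∂ (gaussianReal 0 1 : Measure ℝ)

/-- The overlap `R_{l,l'}` of two configurations. -/
def overlap (N : ℕ) (σ τ : Cfg N) : ℝ := (∑ i, spin (σ i) * spin (τ i)) / N

/-- `S_l⁼ = Σ_{i ≤ N−2} t_i (σ_i^{1(l)} − σ_i^{2(l)})` (here `N = M+2`). -/
def SbarEq (M m : ℕ) (t : Fin (M + 2) → ℝ) (σs : Fin m × Fin 2 → Cfg (M + 2)) (l : Fin m) : ℝ :=
  ∑ i : Fin M, t i.castSucc.castSucc *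
    (spin (σs (l, 0) i.castSucc.castSucc) - spin (σs (l, 1) i.castSucc.castSucc))

/-- `σ̄_c^l = σ_c^{1(l)} − σ_c^{2(l)}` at a coordinate `c`. -/
def sbarAt (M m : ℕ) (σs : Fin m × Fin 2 → Cfg (M + 2)) (l : Fin m) (c : Fin (M + 2)) : ℝ :=
  spin (σs (l, 0) c) - spin (σs (l, 1) c)

set_option linter.unusedSectionVars false

/-- Gibbs weight of one configuration for the energy `E`. -/
def gibbsWeight {C : Type} [Fintype C] (E : C → ℝ) (σ : C) : ℝ :=
  Real.exp (E σ) / ∑ τ, Real.exp (E τ)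

/-- Average of a function of `ι`-indexed independent replicas for the energy `E`. -/
def replicaAvg {C ι : Type} [Fintype C] [Fintype ι] [DecidableEq ι] (E : C → ℝ)
    (f : (ι → C) → ℝ) : ℝ :=
  ∑ s : ι → C, f s * ∏ l, gibbsWeight E (s l)

section Replica

variable {C ι : Type} [Fintype C] [Nonempty C] [Fintype ι] [DecidableEq ι]

lemma sum_exp_pos (E : C → ℝ) : 0 < ∑ τ, Real.exp (E τ) :=
  Finset.sum_pos (fun _ _ => Real.exp_pos _) Finset.univ_nonempty

lemma gibbsWeight_nonneg (E : C → ℝ) (σ : C) : 0 ≤ gibbsWeight E σ :=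
  div_nonneg (Real.exp_pos _).le (sum_exp_pos E).le

lemma sum_gibbsWeight (E : C → ℝ) : ∑ σ, gibbsWeight E σ = 1 := by
  simp only [gibbsWeight]
  rw [← Finset.sum_div, div_self (sum_exp_pos E).ne']

lemma replicaAvg_add (E : C → ℝ) (f g : (ι → C) → ℝ) :
    replicaAvg E (fun s => f s + g s) = replicaAvg E f + replicaAvg E g := by
  simp [replicaAvg, add_mul, Finset.sum_add_distrib]

lemma replicaAvg_sub (E : C → ℝ) (f g : (ι → C) → ℝ) :
    replicaAvg E (fun s => f s - g s) = replicaAvg E f - replicaAvg E g := by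
  simp [replicaAvg, sub_mul, Finset.sum_sub_distrib]

lemma replicaAvg_const_mul (E : C → ℝ) (c : ℝ) (f : (ι → C) → ℝ) :
    replicaAvg E (fun s => c * f s) = c * replicaAvg E f := by
  simp [replicaAvg, mul_assoc, Finset.mul_sum]

lemma replicaAvg_sum {κ : Type} (E : C → ℝ) (t : Finset κ) (f : κ → (ι → C) → ℝ) :
    replicaAvg E (fun s => ∑ k ∈ t, f k s) = ∑ k ∈ t, replicaAvg E (f k) := by
  simp only [replicaAvg, Finset.sum_mul]
  exact Finset.sum_comm

lemma sum_prod_gibbsWeight (E : C → ℝ) : ∑ s : ι → C, ∏ l, gibbsWeight E (s l) = 1 := by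
  rw [← Fintype.prod_sum (fun (_ : ι) σ => gibbsWeight E σ)]
  simp [sum_gibbsWeight]

lemma replicaAvg_const (E : C → ℝ) (c : ℝ) : replicaAvg E (fun _ : ι → C => c) = c := by
  rw [replicaAvg, ← Finset.mul_sum, sum_prod_gibbsWeight, mul_one]

lemma replicaAvg_mono (E : C → ℝ) {f g : (ι → C) → ℝ} (h : ∀ s, f s ≤ g s) :
    replicaAvg E f ≤ replicaAvg E g :=
  Finset.sum_le_sum fun s _ =>
    mul_le_mul_of_nonneg_right (h s) (Finset.prod_nonneg fun _ _ => gibbsWeight_nonneg _ _)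

lemma abs_replicaAvg_le (E : C → ℝ) (f : (ι → C) → ℝ) {K : ℝ} (h : ∀ s, |f s| ≤ K) :
    |replicaAvg E f| ≤ K := by
  rw [abs_le]
  constructor
  · rw [← replicaAvg_const (ι := ι) E (-K)]
    exact replicaAvg_mono E fun s => (abs_le.1 (h s)).1
  · rw [← replicaAvg_const (ι := ι) E K]
    exact replicaAvg_mono E fun s => (abs_le.1 (h s)).2

lemma replicaAvg_perm (E : C → ℝ) (π : Equiv.Perm ι) (f : (ι → C) → ℝ) :
    replicaAvg E (fun s => f (fun l => s (π l))) = replicaAvg E f := by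
  simp only [replicaAvg]
  refine Fintype.sum_equiv (Equiv.arrowCongr π.symm (Equiv.refl C)) _ _ fun s => ?_
  have h : ∏ l, gibbsWeight E (s l) = ∏ l, gibbsWeight E (s (π l)) :=
    (Equiv.prod_comp π fun l => gibbsWeight E (s l)).symm
  rw [h]
  rfl

/-- A replica on which the rest of the function does not depend averages independently. -/
lemma replicaAvg_mul_fresh (E : C → ℝ) (f : (ι → C) → ℝ) (L : C → ℝ) (a : ι)
    (hf : ∀ s x, f (Function.update s a x) = f s) :
    replicaAvg E (fun s => f s * L (s a)) =
      replicaAvg E f * ∑ σ, gibbsWeight E σ * L σ := by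
  have hsplit : ∀ s : ι → C, ∏ l, gibbsWeight E (s l) =
      gibbsWeight E (s a) * ∏ l ∈ Finset.univ.erase a, gibbsWeight E (s l) := fun s =>
    (Finset.mul_prod_erase _ _ (Finset.mem_univ a)).symm
  have h1 : replicaAvg E (fun s => f s * L (s a)) =
      ∑ p : (ι → C) × C, f p.1 * L (p.1 a) * (∏ l, gibbsWeight E (p.1 l)) *
        gibbsWeight E p.2 := by
    rw [Fintype.sum_prod_type]
    simp_rw [← Finset.mul_sum, sum_gibbsWeight, mul_one]
    rfl
  have h2 : replicaAvg E f * ∑ σ, gibbsWeight E σ * L σ =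
      ∑ p : (ι → C) × C, f p.1 * L p.2 * (∏ l, gibbsWeight E (p.1 l)) *
        gibbsWeight E p.2 := by
    rw [Fintype.sum_prod_type, replicaAvg, Finset.sum_mul_sum]
    refine Finset.sum_congr rfl fun s _ => Finset.sum_congr rfl fun y _ => by ring
  rw [h1, h2]
  let e : (ι → C) × C → (ι → C) × C := fun p => (Function.update p.1 a p.2, p.1 a)
  have he : Function.Involutive e := fun p => by
    simp [e]
  refine Fintype.sum_equiv he.toPerm _ _ fun p => ?_
  simp only [Function.Involutive.coe_toPerm, e, hf]
  rw [hsplit, hsplit]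
  have : ∏ l ∈ Finset.univ.erase a, gibbsWeight E (Function.update p.1 a p.2 l) =
      ∏ l ∈ Finset.univ.erase a, gibbsWeight E (p.1 l) :=
    Finset.prod_congr rfl fun l hl => by
      rw [Function.update_of_ne (Finset.ne_of_mem_erase hl)]
  rw [this, Function.update_self]
  ring

lemma hasDerivAt_gibbsWeight {E : ℝ → C → ℝ} {E' : C → ℝ} {θ : ℝ}
    (hE : ∀ σ, HasDerivAt (fun u => E u σ) (E' σ) θ) (σ : C) :
    HasDerivAt (fun u => gibbsWeight (E u) σ)
      (gibbsWeight (E θ) σ * (E' σ - ∑ τ, gibbsWeight (E θ) τ * E' τ)) θ := by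
  have hZ := (sum_exp_pos (E θ)).ne'
  have h1 : HasDerivAt (fun u => Real.exp (E u σ)) (Real.exp (E θ σ) * E' σ) θ := (hE σ).exp
  have h2 : HasDerivAt (fun u => ∑ τ, Real.exp (E u τ)) (∑ τ, Real.exp (E θ τ) * E' τ) θ :=
    HasDerivAt.fun_sum fun τ _ => (hE τ).exp
  convert! h1.fun_div h2 hZ using 1
  have h3 : ∑ τ, gibbsWeight (E θ) τ * E' τ =
      (∑ τ, Real.exp (E θ τ) * E' τ) / ∑ τ, Real.exp (E θ τ) := by
    rw [Finset.sum_div]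
    exact Finset.sum_congr rfl fun τ _ => by rw [gibbsWeight]; ring
  rw [h3, gibbsWeight]
  field_simp

lemma dependsOn_update {I : Finset ι} {f : (ι → C) → ℝ} (hf : DependsOn f (I : Set ι)) {a : ι}
    (ha : a ∉ I) (s : ι → C) (x : C) : f (Function.update s a x) = f s :=
  hf fun i hi => Function.update_of_ne (fun h => ha (by rw [← h]; exact Finset.mem_coe.1 hi)) _ _

/-- Derivative of a replica average along a path of energies. -/
lemma hasDerivAt_replicaAvg {E : ℝ → C → ℝ} {E' : C → ℝ} {θ : ℝ}
    (hE : ∀ σ, HasDerivAt (fun u => E u σ) (E' σ) θ) {f : ℝ → (ι → C) → ℝ} {f' : (ι → C) → ℝ}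
    (hf : ∀ s, HasDerivAt (fun u => f u s) (f' s) θ) {I : Finset ι}
    (hI : DependsOn (f θ) (I : Set ι)) {a : ι} (ha : a ∉ I) :
    HasDerivAt (fun u => replicaAvg (E u) (f u))
      (replicaAvg (E θ) f' +
        ∑ l ∈ I, replicaAvg (E θ) (fun s => f θ s * (E' (s l) - E' (s a)))) θ := by
  set m := ∑ τ, gibbsWeight (E θ) τ * E' τ with hm
  have hfresh : ∀ l ∉ I, replicaAvg (E θ) (fun s => f θ s * E' (s l)) =
      replicaAvg (E θ) (f θ) * m := fun l hl =>
    replicaAvg_mul_fresh _ _ _ l fun s x => dependsOn_update hI hl s x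
  have hprod : ∀ s : ι → C, HasDerivAt (fun u => ∏ l, gibbsWeight (E u) (s l))
      ((∏ l, gibbsWeight (E θ) (s l)) * ∑ l, (E' (s l) - m)) θ := fun s => by
    convert! HasDerivAt.fun_finsetProd (u := Finset.univ)
      (fun l _ => hasDerivAt_gibbsWeight hE (s l)) using 1
    rw [Finset.mul_sum]
    refine Finset.sum_congr rfl fun l hl => ?_
    rw [← Finset.mul_prod_erase _ _ hl, smul_eq_mul]
    ring
  have hmain : HasDerivAt (fun u => replicaAvg (E u) (f u))
      (∑ s : ι → C, (f' s * (∏ l, gibbsWeight (E θ) (s l)) +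
        f θ s * ((∏ l, gibbsWeight (E θ) (s l)) * ∑ l, (E' (s l) - m)))) θ :=
    HasDerivAt.fun_sum fun s _ => (hf s).mul (hprod s)
  convert! hmain using 1
  rw [Finset.sum_add_distrib]
  congr 1
  have h1 : ∑ s : ι → C, f θ s * ((∏ l, gibbsWeight (E θ) (s l)) * ∑ l, (E' (s l) - m)) =
      ∑ l, (replicaAvg (E θ) (fun s => f θ s * E' (s l)) - replicaAvg (E θ) (f θ) * m) := by
    simp only [replicaAvg, Finset.sum_mul, ← Finset.sum_sub_distrib, Finset.mul_sum]
    rw [Finset.sum_comm]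
    exact Finset.sum_congr rfl fun l _ => Finset.sum_congr rfl fun s _ => by ring
  rw [h1, ← Finset.sum_subset (Finset.subset_univ I) fun l _ hl => by
    rw [hfresh l hl, sub_self]]
  refine Finset.sum_congr rfl fun l _ => ?_
  rw [← hfresh a ha, ← replicaAvg_sub]
  congr 1
  ext s
  ring

end Replica

lemma hasDerivAt_gaussianPDFReal (y : ℝ) :
    HasDerivAt (gaussianPDFReal 0 1) (-y * gaussianPDFReal 0 1 y) y := by
  have h : HasDerivAt (fun x : ℝ => (√(2 * Real.pi * (1 : NNReal)))⁻¹ *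
      Real.exp (-(x - 0) ^ 2 / (2 * (1 : NNReal))))
      ((√(2 * Real.pi * (1 : NNReal)))⁻¹ * (Real.exp (-(y - 0) ^ 2 / (2 * (1 : NNReal))) *
        (-y))) y := by
    refine HasDerivAt.const_mul _ (HasDerivAt.exp ?_)
    have := (((hasDerivAt_id y).sub_const 0).pow 2).neg.div_const (2 * ((1 : NNReal) : ℝ))
    convert! this using 1
    simp
    ring
  rw [gaussianPDFReal_def]
  convert! h using 1
  ring

lemma integrable_gaussianReal_iff {f : ℝ → ℝ} :
    Integrable f (gaussianReal 0 1) ↔ Integrable (fun y => gaussianPDFReal 0 1 y * f y) := by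
  rw [gaussianReal_of_var_ne_zero _ one_ne_zero,
    integrable_withDensity_iff_integrable_smul' (measurable_gaussianPDF _ _)
      (Filter.Eventually.of_forall fun _ => gaussianPDF_lt_top)]
  simp [toReal_gaussianPDF]

/-- Gaussian integration by parts on the line. -/
lemma integral_id_mul_gaussianReal {u u' : ℝ → ℝ} (hu : ∀ y, HasDerivAt u (u' y) y)
    (h1 : Integrable u (gaussianReal 0 1)) (h2 : Integrable u' (gaussianReal 0 1))
    (h3 : Integrable (fun y => y * u y) (gaussianReal 0 1)) :
    ∫ y, y * u y ∂gaussianReal 0 1 = ∫ y, u' y ∂gaussianReal 0 1 := by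
  rw [integral_gaussianReal_eq_integral_smul one_ne_zero,
    integral_gaussianReal_eq_integral_smul one_ne_zero]
  rw [integrable_gaussianReal_iff] at h1 h2 h3
  have := integral_mul_deriv_eq_deriv_mul_of_integrable (u := u) (v := gaussianPDFReal 0 1)
    (fun y _ => hu y) (fun y _ => hasDerivAt_gaussianPDFReal y)
    (h3.neg.congr (Filter.Eventually.of_forall fun y => by simp; ring))
    (h2.congr (Filter.Eventually.of_forall fun y => by simp; ring))
    (h1.congr (Filter.Eventually.of_forall fun y => by simp; ring))
  have e1 : ∫ y, gaussianPDFReal 0 1 y • (y * u y) =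
      - ∫ y, u y * (-y * gaussianPDFReal 0 1 y) := by
    rw [← integral_neg]
    congr 1; ext y; simp; ring
  rw [e1, this, neg_neg]
  congr 1; ext y; simp; ring

/-- The law of a finite family of independent standard Gaussians. -/
def gaussPi (A : Type) [Fintype A] : Measure (A → ℝ) :=
  Measure.pi fun _ => gaussianReal 0 1

section Gaussian

variable {A : Type} [Fintype A] [DecidableEq A]

instance : IsProbabilityMeasure (gaussPi A) := by
  unfold gaussPi; infer_instance

/-- Resampling one coordinate preserves the Gaussian law. -/
lemma measurePreserving_update (α : A) :
    MeasurePreserving (fun p : (A → ℝ) × ℝ => Function.update p.1 α p.2)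
      ((gaussPi A).prod (gaussianReal 0 1)) (gaussPi A) := by
  have hm : Measurable (fun p : (A → ℝ) × ℝ => Function.update p.1 α p.2) := by
    refine measurable_pi_iff.2 fun β => ?_
    by_cases h : β = α
    · subst h; simpa using measurable_snd
    · simpa [Function.update_of_ne h] using (measurable_pi_apply β).fun_comp measurable_fst
  refine ⟨hm, ?_⟩
  symm
  refine Measure.pi_eq fun s hs => ?_
  rw [Measure.map_apply hm (MeasurableSet.univ_pi hs)]
  have : (fun p : (A → ℝ) × ℝ => Function.update p.1 α p.2) ⁻¹' Set.univ.pi s =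
      (Set.univ.pi (Function.update s α Set.univ)) ×ˢ s α := by
    ext p
    simp only [Set.mem_preimage, Set.mem_univ_pi, Set.mem_prod]
    constructor
    · intro h
      refine ⟨fun β => ?_, by simpa using h α⟩
      by_cases hb : β = α
      · subst hb; simp
      · simpa [hb] using h β
    · rintro ⟨h, h'⟩ β
      by_cases hb : β = α
      · subst hb; simpa using h'
      · simpa [hb] using h β
  rw [this, Measure.prod_prod, gaussPi, Measure.pi_pi,
    ← Finset.mul_prod_erase _ _ (Finset.mem_univ α),
    ← Finset.mul_prod_erase _ (fun i => gaussianReal 0 1 (s i)) (Finset.mem_univ α)]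
  have h2 : ∏ x ∈ Finset.univ.erase α, gaussianReal 0 1 (Function.update s α Set.univ x) =
      ∏ x ∈ Finset.univ.erase α, gaussianReal 0 1 (s x) :=
    Finset.prod_congr rfl fun x hx => by
      rw [Function.update_of_ne (Finset.ne_of_mem_erase hx)]
  rw [h2]
  simp [mul_comm]

lemma integral_gaussPi_update (α : A) {F : (A → ℝ) → ℝ}
    (hF : Integrable F (gaussPi A)) :
    ∫ x, F x ∂gaussPi A =
      ∫ x, ∫ y, F (Function.update x α y) ∂gaussianReal 0 1 ∂gaussPi A := by
  have mp := measurePreserving_update α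
  rw [← mp.map_eq] at hF
  rw [← mp.map_eq, integral_map mp.measurable.aemeasurable hF.1, mp.map_eq]
  exact integral_prod _ (hF.comp_measurable mp.measurable)

lemma integrable_eval_mul {α : A} {u : (A → ℝ) → ℝ} (hu : Continuous u) {K : ℝ}
    (hK : ∀ x, |u x| ≤ K) : Integrable (fun x => x α * u x) (gaussPi A) := by
  refine Integrable.mul_bdd (c := K) ?_ hu.aestronglyMeasurable
    (Filter.Eventually.of_forall hK)
  have h : Integrable (fun y : ℝ => y) (gaussianReal 0 1) :=
    (memLp_id_gaussianReal' 1 (by simp)).integrable le_rfl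
  exact (measurePreserving_eval (fun _ : A => gaussianReal 0 1) α).integrable_comp_of_integrable h

lemma integrable_of_continuous_bounded {X : Type} [TopologicalSpace X] [MeasurableSpace X]
    [OpensMeasurableSpace X] [SecondCountableTopology X] {μ : Measure X} [IsFiniteMeasure μ]
    {u : X → ℝ} (hu : Continuous u) {K : ℝ} (hK : ∀ x, |u x| ≤ K) : Integrable u μ :=
  Integrable.of_bound hu.aestronglyMeasurable K (Filter.Eventually.of_forall hK)

/-- Gaussian integration by parts in one coordinate. -/
lemma integral_eval_mul_gaussPi (α : A) {u u' : (A → ℝ) → ℝ} (hu : Continuous u)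
    (hu' : Continuous u') {K : ℝ} (hK : ∀ x, |u x| ≤ K) (hK' : ∀ x, |u' x| ≤ K)
    (hd : ∀ x y, HasDerivAt (fun t => u (Function.update x α t))
      (u' (Function.update x α y)) y) :
    ∫ x, x α * u x ∂gaussPi A = ∫ x, u' x ∂gaussPi A := by
  rw [integral_gaussPi_update α (integrable_eval_mul hu hK),
    integral_gaussPi_update α (integrable_of_continuous_bounded hu' hK')]
  refine integral_congr_ae (Filter.Eventually.of_forall fun x => ?_)
  have hc : Continuous fun y : ℝ => Function.update x α y := continuous_const.update α continuous_id
  simp only [Function.update_self]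
  have h : Integrable (fun y : ℝ => y) (gaussianReal 0 1) :=
    (memLp_id_gaussianReal' 1 (by simp)).integrable le_rfl
  refine integral_id_mul_gaussianReal (fun y => hd x y)
    (integrable_of_continuous_bounded (hu.comp hc) fun y => hK _)
    (integrable_of_continuous_bounded (hu'.comp hc) fun y => hK' _)
    (h.mul_bdd (c := K) (hu.comp hc).aestronglyMeasurable
      (Filter.Eventually.of_forall fun y => hK _))

end Gaussian

/-- The linear Gaussian energy with coefficients `c` and base field `h`. -/
def energy {A C : Type} [Fintype A] (c : A → C → ℝ) (h : C → ℝ) (x : A → ℝ) (σ : C) : ℝ :=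
  ∑ α, x α * c α σ + h σ

/-- Replica average for the energy `energy c h x`, averaged over the Gaussian disorder `x`. -/
def avg {A C ι : Type} [Fintype A] [Fintype C] [Fintype ι] [DecidableEq ι] (c : A → C → ℝ)
    (h : C → ℝ) (f : (ι → C) → ℝ) : ℝ :=
  ∫ x, replicaAvg (energy c h x) f ∂gaussPi A

/-- The combination of two-replica terms which appears in Gaussian derivatives of `avg` applied to
a function of the replicas in `I`; `a` and `b` are fresh replicas. -/
def freshSum {ι : Type} [DecidableEq ι] (I : Finset ι) (a b : ι) (T : ι → ι → ℝ) : ℝ :=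
  ∑ l ∈ I, ∑ l' ∈ I.erase l, T l l' - 2 * (#I : ℝ) * ∑ l ∈ I, T l a +
    (#I : ℝ) * (#I + 1) * T a b

section Avg

variable {A C ι : Type} [Fintype A] [DecidableEq A] [Fintype C] [Nonempty C] [Fintype ι]
  [DecidableEq ι]

lemma continuous_replicaAvg_energy (c : A → C → ℝ) (h : C → ℝ) (f : (ι → C) → ℝ) :
    Continuous fun x => replicaAvg (energy c h x) f := by
  have hE : ∀ σ, Continuous fun x : A → ℝ => Real.exp (energy c h x σ) := fun σ => by
    unfold energy
    fun_prop
  refine continuous_finsetSum _ fun s _ => continuous_const.mul ?_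
  refine continuous_finsetProd _ fun l _ => ?_
  exact (hE _).div (continuous_finsetSum _ fun τ _ => hE τ) fun x =>
    ne_of_gt (sum_exp_pos _)

/-- A uniform bound for a function on a finite type. -/
lemma exists_bound {S : Type} [Finite S] (f : S → ℝ) : ∃ K, ∀ s, |f s| ≤ K := by
  obtain ⟨K, hK⟩ := (Set.finite_range fun s => |f s|).bddAbove
  exact ⟨K, fun s => hK ⟨s, rfl⟩⟩

lemma integrable_replicaAvg (c : A → C → ℝ) (h : C → ℝ) (f : (ι → C) → ℝ) :
    Integrable (fun x => replicaAvg (energy c h x) f) (gaussPi A) := by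
  obtain ⟨K, hK⟩ := exists_bound f
  exact integrable_of_continuous_bounded (continuous_replicaAvg_energy c h f)
    fun x => abs_replicaAvg_le _ f hK

lemma avg_add (c : A → C → ℝ) (h : C → ℝ) (f g : (ι → C) → ℝ) :
    avg c h (fun s => f s + g s) = avg c h f + avg c h g := by
  simp only [avg, replicaAvg_add]
  exact integral_add (integrable_replicaAvg c h f) (integrable_replicaAvg c h g)

lemma avg_sub (c : A → C → ℝ) (h : C → ℝ) (f g : (ι → C) → ℝ) :
    avg c h (fun s => f s - g s) = avg c h f - avg c h g := by
  simp only [avg, replicaAvg_sub]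
  exact integral_sub (integrable_replicaAvg c h f) (integrable_replicaAvg c h g)

lemma avg_const_mul (c : A → C → ℝ) (h : C → ℝ) (r : ℝ) (f : (ι → C) → ℝ) :
    avg c h (fun s => r * f s) = r * avg c h f := by
  simp only [avg, replicaAvg_const_mul]
  exact integral_const_mul _ _

lemma avg_sum {κ : Type} (c : A → C → ℝ) (h : C → ℝ) (t : Finset κ) (f : κ → (ι → C) → ℝ) :
    avg c h (fun s => ∑ k ∈ t, f k s) = ∑ k ∈ t, avg c h (f k) := by
  simp only [avg, replicaAvg_sum]
  exact integral_finsetSum _ fun k _ => integrable_replicaAvg c h (f k)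

lemma avg_const (c : A → C → ℝ) (h : C → ℝ) (r : ℝ) : avg c h (fun _ : ι → C => r) = r := by
  simp [avg, replicaAvg_const]

lemma avg_mono (c : A → C → ℝ) (h : C → ℝ) {f g : (ι → C) → ℝ} (hfg : ∀ s, f s ≤ g s) :
    avg c h f ≤ avg c h g :=
  integral_mono (integrable_replicaAvg c h f) (integrable_replicaAvg c h g)
    fun _ => replicaAvg_mono _ hfg

lemma abs_avg_le_avg (c : A → C → ℝ) (h : C → ℝ) {f g : (ι → C) → ℝ}
    (hfg : ∀ s, |f s| ≤ g s) : |avg c h f| ≤ avg c h g := by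
  rw [abs_le]
  constructor
  · rw [neg_le, ← neg_one_mul, ← avg_const_mul]
    exact avg_mono c h fun s => by linarith [(abs_le.1 (hfg s)).1]
  · exact avg_mono c h fun s => (abs_le.1 (hfg s)).2

lemma avg_nonneg (c : A → C → ℝ) (h : C → ℝ) {f : (ι → C) → ℝ} (hf : ∀ s, 0 ≤ f s) :
    0 ≤ avg c h f := by
  rw [← avg_const (ι := ι) c h 0]
  exact avg_mono c h hf

lemma avg_perm (c : A → C → ℝ) (h : C → ℝ) (π : Equiv.Perm ι) (f : (ι → C) → ℝ) :
    avg c h (fun s => f (fun l => s (π l))) = avg c h f := by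
  simp only [avg, replicaAvg_perm]

lemma hasDerivAt_energy_update (c : A → C → ℝ) (h : C → ℝ) (x : A → ℝ) (α : A) (y : ℝ) (σ : C) :
    HasDerivAt (fun t => energy c h (Function.update x α t) σ) (c α σ) y := by
  have : ∀ t, energy c h (Function.update x α t) σ =
      t * c α σ + (∑ β ∈ Finset.univ.erase α, x β * c β σ + h σ) := fun t => by
    rw [energy, ← Finset.add_sum_erase _ _ (Finset.mem_univ α), Function.update_self, add_assoc]
    congr 2
    exact Finset.sum_congr rfl fun β hβ => by
      rw [Function.update_of_ne (Finset.ne_of_mem_erase hβ)]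
  simp only [this]
  exact (hasDerivAt_mul_const (c α σ)).add_const _

/-- Gaussian integration by parts for replica averages. -/
lemma integral_eval_mul_replicaAvg (c : A → C → ℝ) (h : C → ℝ) (α : A) {f : (ι → C) → ℝ}
    {I : Finset ι} (hI : DependsOn f (I : Set ι)) {b : ι} (hb : b ∉ I) :
    ∫ x, x α * replicaAvg (energy c h x) f ∂gaussPi A =
      ∑ l ∈ I, avg c h (fun s => f s * (c α (s l) - c α (s b))) := by
  obtain ⟨K, hK⟩ := exists_bound f
  obtain ⟨K', hK'⟩ := exists_bound (fun s : ι → C => ∑ l ∈ I, f s * (c α (s l) - c α (s b)))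
  simp only [← avg_sum]
  refine integral_eval_mul_gaussPi α (K := max K K') (continuous_replicaAvg_energy c h f)
    (continuous_replicaAvg_energy c h _) (fun x => abs_replicaAvg_le _ _ fun s =>
      (hK s).trans (le_max_left _ _)) (fun x => abs_replicaAvg_le _ _ fun s =>
      (hK' s).trans (le_max_right _ _)) fun x y => ?_
  have := hasDerivAt_replicaAvg (fun σ => hasDerivAt_energy_update c h x α y σ)
    (f := fun _ => f) (f' := fun _ => 0) (fun s => hasDerivAt_const _ _) hI hb
  rwa [replicaAvg_const, zero_add, ← replicaAvg_sum] at this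

lemma freshSum_eq {I : Finset ι} {a b : ι} (T : ι → ι → ℝ) (d : ℝ) (hd : ∀ l, T l l = d)
    (ha : a ∉ I) (hT : ∀ l ∈ I, T l b = T l a) (hsym : ∀ l l', T l l' = T l' l) :
    ∑ l ∈ I, ∑ l' ∈ insert a I, (T l l' - T a l' - T l b + T a b) = freshSum I a b T := by
  have h1 : ∀ l ∈ I, ∑ l' ∈ I, T l l' = d + ∑ l' ∈ I.erase l, T l l' := fun l hl => by
    rw [← Finset.add_sum_erase _ _ hl, hd]
  simp only [Finset.sum_insert ha, Finset.sum_add_distrib, Finset.sum_sub_distrib,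
    Finset.sum_const, nsmul_eq_mul, hd]
  rw [Finset.sum_congr rfl hT, Finset.sum_congr rfl h1, Finset.sum_add_distrib, freshSum]
  simp only [Finset.sum_const, nsmul_eq_mul, ← Finset.mul_sum, hsym a,
    Finset.sum_congr rfl hT]
  ring

/-- Derivative of `avg` along a path of Gaussian coefficients. -/
lemma hasDerivAt_avg {c c' : ℝ → A → C → ℝ} {h : C → ℝ} {f f' : ℝ → (ι → C) → ℝ} {K : ℝ}
    (hc : ∀ θ α σ, HasDerivAt (fun u => c u α σ) (c' θ α σ) θ)
    (hcK : ∀ θ α σ, |c' θ α σ| ≤ K)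
    (hf : ∀ θ s, HasDerivAt (fun u => f u s) (f' θ s) θ)
    (hfK : ∀ θ s, |f θ s| ≤ K) (hfK' : ∀ θ s, |f' θ s| ≤ K)
    {I : Finset ι} (hI : ∀ θ, DependsOn (f θ) (I : Set ι)) {a b : ι} (ha : a ∉ I) (hb : b ∉ I)
    (hab : a ≠ b) {T : C → C → ℝ} {w v d θ : ℝ}
    (hB : ∀ σ τ, ∑ α, c' θ α σ * c θ α τ = w * T σ τ + v)
    (hT : ∀ σ τ, T σ τ = T τ σ) (hd : ∀ σ, T σ σ = d) :
    HasDerivAt (fun u => avg (c u) h (f u))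
      (avg (c θ) h (f' θ) +
        w * freshSum I a b (fun l l' => avg (c θ) h (fun s => f θ s * T (s l) (s l')))) θ := by
  have hE : ∀ (x : A → ℝ) u σ, HasDerivAt (fun u => energy (c u) h x σ)
      (∑ α, x α * c' u α σ) u := fun x u σ => by
    unfold energy
    exact (HasDerivAt.fun_sum fun α _ => (hc u α σ).const_mul (x α)).add_const _
  have hbd : ∀ (x : A → ℝ) u (s : ι → C) l, |f u s * (∑ α, x α * c' u α (s l) -
      ∑ α, x α * c' u α (s a))| ≤ K * (2 * ∑ α, |x α| * K) := fun x u s l => by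
    have h1 : ∀ σ, |∑ α, x α * c' u α σ| ≤ ∑ α, |x α| * K := fun σ =>
      (Finset.abs_sum_le_sum_abs _ _).trans <| Finset.sum_le_sum fun α _ => by
        rw [abs_mul]
        exact mul_le_mul_of_nonneg_left (hcK _ _ _) (abs_nonneg _)
    rw [abs_mul]
    refine mul_le_mul (hfK _ _) ?_ (abs_nonneg _) ((abs_nonneg _).trans (hfK u s))
    refine (abs_sub _ _).trans ?_
    linarith [h1 (s l), h1 (s a)]
  have habs : ∀ α, Integrable (fun x : A → ℝ => |x α| * K) (gaussPi A) := fun α => by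
    have := (integrable_eval_mul (α := α) (u := fun _ => 1) continuous_const (K := 1)
      (by simp)).abs
    simp only [mul_one] at this
    exact this.mul_const K
  have hrepr : ∀ (x : A → ℝ) l, replicaAvg (energy (c θ) h x)
      (fun s => f θ s * (∑ α, x α * c' θ α (s l) - ∑ α, x α * c' θ α (s a))) =
      ∑ α, x α * replicaAvg (energy (c θ) h x)
        (fun s => f θ s * (c' θ α (s l) - c' θ α (s a))) := fun x l => by
    simp only [← replicaAvg_const_mul, ← replicaAvg_sum, ← Finset.sum_sub_distrib, Finset.mul_sum]
    congr 1
    ext s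
    exact Finset.sum_congr rfl fun α _ => by ring
  have hinteg : ∀ l α, Integrable (fun x => x α * replicaAvg (energy (c θ) h x)
        (fun s => f θ s * (c' θ α (s l) - c' θ α (s a)))) (gaussPi A) := fun l α => by
    obtain ⟨M, hM⟩ := exists_bound (fun s : ι → C => f θ s * (c' θ α (s l) - c' θ α (s a)))
    exact integrable_eval_mul (continuous_replicaAvg_energy _ _ _)
      fun x => abs_replicaAvg_le _ _ hM
  have key := (hasDerivAt_integral_of_dominated_loc_of_deriv_le (μ := gaussPi A) (x₀ := θ)
    (F := fun u x => replicaAvg (energy (c u) h x) (f u))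
    (F' := fun u x => replicaAvg (energy (c u) h x) (f' u) +
        ∑ l ∈ I, replicaAvg (energy (c u) h x) (fun s => f u s *
          (∑ α, x α * c' u α (s l) - ∑ α, x α * c' u α (s a))))
    (bound := fun x => K + ∑ _l ∈ I, K * (2 * ∑ α, |x α| * K)) Filter.univ_mem
    (Filter.Eventually.of_forall fun u =>
      (continuous_replicaAvg_energy _ _ _).aestronglyMeasurable)
    (integrable_replicaAvg _ _ _) ?_ ?_ ?_ ?_).2
  · convert! key using 1
    rw [integral_add (integrable_replicaAvg _ _ _) ?_, integral_finsetSum]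
    · rw [avg]
      congr 1
      simp only [hrepr]
      have hdep : ∀ l ∈ I, ∀ α, DependsOn (fun s : ι → C => f θ s * (c' θ α (s l) - c' θ α (s a)))
          ((insert a I : Finset ι) : Set ι) := fun l hl α s s' hs => by
        have h1 : f θ s = f θ s' := hI θ fun i hi => hs i (by
          simp only [Finset.coe_insert]; exact Set.mem_insert_of_mem _ hi)
        simp only [h1, hs l (by simp [hl]), hs a (by simp)]
      have hb' : b ∉ insert a I := by simp [hb, hab.symm]
      have h2 : ∀ l ∈ I, ∫ x, ∑ α, x α * replicaAvg (energy (c θ) h x)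
          (fun s => f θ s * (c' θ α (s l) - c' θ α (s a))) ∂gaussPi A =
          ∑ l' ∈ insert a I, avg (c θ) h (fun s => f θ s * (w * (T (s l) (s l') - T (s a) (s l') -
            T (s l) (s b) + T (s a) (s b)))) := fun l hl => by
        rw [integral_finsetSum _ fun α _ => hinteg l α]
        rw [Finset.sum_congr rfl fun α _ =>
          integral_eval_mul_replicaAvg (c θ) h α (hdep l hl α) hb', Finset.sum_comm]
        refine Finset.sum_congr rfl fun l' _ => ?_
        rw [← avg_sum]
        congr 1
        ext s
        have : w * (T (s l) (s l') - T (s a) (s l') - T (s l) (s b) + T (s a) (s b)) =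
            ∑ α, (c' θ α (s l) - c' θ α (s a)) * (c θ α (s l') - c θ α (s b)) := by
          simp only [sub_mul, mul_sub, Finset.sum_sub_distrib, hB]
          ring
        rw [this, Finset.mul_sum]
        exact Finset.sum_congr rfl fun α _ => by ring
      rw [Finset.sum_congr rfl h2, ← freshSum_eq (a := a) _ (avg (c θ) h (fun s => f θ s * d))
        (fun l => by simp only [hd]) ha ?_ fun l l' => by simp only [hT]]
      · rw [Finset.mul_sum]
        refine Finset.sum_congr rfl fun l _ => ?_
        rw [Finset.mul_sum]
        refine Finset.sum_congr rfl fun l' _ => ?_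
        rw [← avg_sub, ← avg_sub, ← avg_add, ← avg_const_mul]
        congr 1
        ext s
        ring
      · intro l hl
        rw [← avg_perm _ _ (Equiv.swap a b)]
        congr 1
        ext s
        have e1 : f θ (fun i => s (Equiv.swap a b i)) = f θ s := hI θ fun i hi => by
          rw [Equiv.swap_apply_of_ne_of_ne]
          · rintro rfl; exact ha hi
          · rintro rfl; exact hb hi
        simp only [e1, Equiv.swap_apply_right]
        rw [Equiv.swap_apply_of_ne_of_ne]
        · rintro rfl; exact ha hl
        · rintro rfl; exact hb hl
    · intro l _
      simp only [hrepr]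
      exact integrable_finsetSum _ fun α _ => hinteg l α
    · refine integrable_finsetSum _ fun l _ => ?_
      simp only [hrepr]
      exact integrable_finsetSum _ fun α _ => hinteg l α
  · refine ((continuous_replicaAvg_energy _ _ _).add (continuous_finsetSum _ fun l _ => ?_)
      ).aestronglyMeasurable
    simp only [hrepr]
    exact continuous_finsetSum _ fun α _ => (continuous_apply α).mul
      (continuous_replicaAvg_energy _ _ _)
  · refine Filter.Eventually.of_forall fun x u _ => ?_
    rw [Real.norm_eq_abs]
    refine (abs_add_le _ _).trans (add_le_add (abs_replicaAvg_le _ _ (hfK' u)) ?_)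
    refine (Finset.abs_sum_le_sum_abs _ _).trans (Finset.sum_le_sum fun l _ => ?_)
    exact abs_replicaAvg_le _ _ fun s => hbd x u s l
  · refine (integrable_const _).add (integrable_finsetSum _ fun l _ => ?_)
    exact ((integrable_finsetSum _ fun α _ => habs α).const_mul 2).const_mul K
  · exact Filter.Eventually.of_forall fun x u _ =>
      hasDerivAt_replicaAvg (hE x u) (hf u) (hI u) ha

end Avg

section Sites

variable {ι V : Type} [Fintype ι] [DecidableEq ι] [Fintype V] [DecidableEq V]

/-- The function `f` of finitely many replicas does not depend on the spins at the site `k`. -/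
def SiteFree (k : V) (f : (ι → V → Bool) → ℝ) : Prop :=
  ∀ s s', (∀ l, ∀ j ≠ k, s l j = s' l j) → f s = f s'

lemma SiteFree.update {k : V} {f : (ι → V → Bool) → ℝ} (hf : SiteFree k f) (s : ι → V → Bool)
    (e : ι → Bool) : f (fun l => Function.update (s l) k (e l)) = f s :=
  hf _ _ fun _ _ hj => Function.update_of_ne hj _ _

lemma sum_exp_site {k : V} {E E' E₂ : (V → Bool) → ℝ} {E₁ E₁' : Bool → ℝ}
    (hE : ∀ σ, E σ = E₁ (σ k) + E₂ σ) (hE' : ∀ σ, E' σ = E₁' (σ k) + E₂ σ)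
    (hE₂ : ∀ σ b, E₂ (Function.update σ k b) = E₂ σ) :
    (∑ σ, Real.exp (E σ)) * ∑ b, Real.exp (E₁' b) =
      (∑ σ, Real.exp (E' σ)) * ∑ b, Real.exp (E₁ b) := by
  rw [Finset.sum_mul_sum, Finset.sum_mul_sum, ← Fintype.sum_prod_type', ← Fintype.sum_prod_type']
  let e : (V → Bool) × Bool → (V → Bool) × Bool := fun p => (Function.update p.1 k p.2, p.1 k)
  have he : Function.Involutive e := fun p => by simp [e]
  refine Fintype.sum_equiv he.toPerm _ _ fun p => ?_
  simp only [Function.Involutive.coe_toPerm, e, hE, hE', hE₂, Function.update_self, Real.exp_add]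
  ring

/-- A site which does not interact with the rest of the system averages independently. -/
lemma replicaAvg_site {k : V} {E E' E₂ : (V → Bool) → ℝ} {E₁ E₁' : Bool → ℝ}
    (hE : ∀ σ, E σ = E₁ (σ k) + E₂ σ) (hE' : ∀ σ, E' σ = E₁' (σ k) + E₂ σ)
    (hE₂ : ∀ σ b, E₂ (Function.update σ k b) = E₂ σ) (p : (ι → Bool) → ℝ)
    {f : (ι → V → Bool) → ℝ} (hf : SiteFree k f) :
    replicaAvg E (fun s => p (fun l => s l k) * f s) = replicaAvg E₁ p * replicaAvg E' f := by
  set Y := (∑ b, Real.exp (E₁ b)) / ∑ σ, Real.exp (E σ) with hY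
  have hY' : Y = (∑ b, Real.exp (E₁' b)) / ∑ σ, Real.exp (E' σ) := by
    rw [hY, div_eq_div_iff (sum_exp_pos E).ne' (sum_exp_pos E').ne', mul_comm,
      ← sum_exp_site hE hE' hE₂, mul_comm]
  have hW : ∀ σ, gibbsWeight E σ = gibbsWeight E₁ (σ k) * (Real.exp (E₂ σ) * Y) := fun σ => by
    have := (sum_exp_pos E₁).ne'
    rw [gibbsWeight, gibbsWeight, hE, Real.exp_add, hY]
    field_simp
  have hW' : ∀ σ, gibbsWeight E' σ = gibbsWeight E₁' (σ k) * (Real.exp (E₂ σ) * Y) := fun σ => by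
    have := (sum_exp_pos E₁').ne'
    rw [gibbsWeight, gibbsWeight, hE', Real.exp_add, hY']
    field_simp
  have h1 : replicaAvg E (fun s => p (fun l => s l k) * f s) =
      ∑ u : (ι → V → Bool) × (ι → Bool), p (fun l => u.1 l k) * f u.1 *
        (∏ l, gibbsWeight E (u.1 l)) * ∏ l, gibbsWeight E₁' (u.2 l) := by
    rw [Fintype.sum_prod_type]
    simp_rw [← Finset.mul_sum, sum_prod_gibbsWeight, mul_one]
    rfl
  have h2 : replicaAvg E₁ p * replicaAvg E' f =
      ∑ u : (ι → V → Bool) × (ι → Bool), p u.2 * f u.1 *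
        (∏ l, gibbsWeight E' (u.1 l)) * ∏ l, gibbsWeight E₁ (u.2 l) := by
    rw [Fintype.sum_prod_type, replicaAvg, replicaAvg, mul_comm, Finset.sum_mul_sum]
    exact Finset.sum_congr rfl fun s _ => Finset.sum_congr rfl fun y _ => by ring
  rw [h1, h2]
  let e : (ι → V → Bool) × (ι → Bool) → (ι → V → Bool) × (ι → Bool) := fun u =>
    (fun l => Function.update (u.1 l) k (u.2 l), fun l => u.1 l k)
  have he : Function.Involutive e := fun u => by simp [e]
  refine Fintype.sum_equiv he.toPerm _ _ fun u => ?_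
  simp only [Function.Involutive.coe_toPerm, e, hf.update, hW, hW', hE₂, Function.update_self,
    Finset.prod_mul_distrib]
  ring

/-- Average over one site with the Gaussian field `h + v z`. -/
def siteAvg (v h : ℝ) (p : (ι → Bool) → ℝ) : ℝ :=
  avg (A := Unit) (fun _ b => v * spin b) (fun b => h * spin b) p

lemma siteAvg_eq (v h : ℝ) (p : (ι → Bool) → ℝ) :
    siteAvg v h p = ∫ y, replicaAvg (fun b => y * (v * spin b) + h * spin b) p
      ∂gaussianReal 0 1 := by
  rw [siteAvg, avg, gaussPi]
  have := (measurePreserving_eval (fun _ : Unit => gaussianReal 0 1) ()).integral_comp'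
    (f := MeasurableEquiv.funUnique Unit ℝ)
    (fun y => replicaAvg (fun b => y * (v * spin b) + h * spin b) p)
  rw [← this]
  congr 1
  ext x
  congr 1
  ext b
  simp [energy]

lemma avg_site {A : Type} [Fintype A] [DecidableEq A] {k : V} {α : A} {c : A → (V → Bool) → ℝ}
    {h h₂ : (V → Bool) → ℝ} {v h₁ : ℝ} (hc : ∀ σ, c α σ = v * spin (σ k))
    (hc' : ∀ β ≠ α, ∀ σ b, c β (Function.update σ k b) = c β σ)
    (hh : ∀ σ, h σ = h₁ * spin (σ k) + h₂ σ) (hh₂ : ∀ σ b, h₂ (Function.update σ k b) = h₂ σ)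
    (p : (ι → Bool) → ℝ) {f : (ι → V → Bool) → ℝ} (hf : SiteFree k f) :
    avg c h (fun s => p (fun l => s l k) * f s) = siteAvg v h₁ p * avg c h f := by
  rw [avg, integral_gaussPi_update α (integrable_replicaAvg _ _ _), siteAvg_eq]
  have hen : ∀ (x : A → ℝ) σ, energy c h x σ = (x α * (v * spin (σ k)) + h₁ * spin (σ k)) +
      (∑ β ∈ Finset.univ.erase α, x β * c β σ + h₂ σ) := fun x σ => by
    rw [energy, ← Finset.add_sum_erase _ _ (Finset.mem_univ α), hc, hh]
    ring
  have key : ∀ (x : A → ℝ) y, replicaAvg (energy c h (Function.update x α y))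
      (fun s => p (fun l => s l k) * f s) =
      replicaAvg (fun b => y * (v * spin b) + h₁ * spin b) p * replicaAvg (energy c h x) f := by
    intro x y
    refine replicaAvg_site (E₁ := fun b => y * (v * spin b) + h₁ * spin b)
      (E₁' := fun b => x α * (v * spin b) + h₁ * spin b)
      (E₂ := fun σ => ∑ β ∈ Finset.univ.erase α, x β * c β σ + h₂ σ)
      (fun σ => ?_) (hen x) (fun σ b => ?_) p hf
    · rw [hen, Function.update_self]
      congr 2
      exact Finset.sum_congr rfl fun β hβ => by
        rw [Function.update_of_ne (Finset.ne_of_mem_erase hβ)]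
    · simp only [hh₂]
      congr 1
      exact Finset.sum_congr rfl fun β hβ => by rw [hc' β (Finset.ne_of_mem_erase hβ)]
  simp only [key, integral_mul_const]
  rw [integral_const_mul]
  rfl

end Sites

lemma replicaAvg_comp_inl {C ι κ : Type} [Fintype C] [Nonempty C] [Fintype ι] [DecidableEq ι]
    [Fintype κ] [DecidableEq κ] (E : C → ℝ) (f : (ι → C) → ℝ) :
    replicaAvg (ι := ι ⊕ κ) E (fun s => f (fun l => s (Sum.inl l))) = replicaAvg E f := by
  rw [replicaAvg, ← (Equiv.sumArrowEquivProdArrow ι κ C).symm.sum_comp, Fintype.sum_prod_type]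
  simp only [Fintype.prod_sum_type]
  rw [replicaAvg]
  refine Finset.sum_congr rfl fun s _ => ?_
  simp only [Equiv.sumArrowEquivProdArrow, Equiv.coe_fn_symm_mk, Sum.elim_inl, Sum.elim_inr]
  rw [← Finset.mul_sum, ← Finset.mul_sum, sum_prod_gibbsWeight, mul_one]

/-- Coefficient of the disorder variable `α` in minus the Hamiltonian (above the diagonal), and of
an auxiliary field of variance `q` (on the diagonal). -/
def skCoef (N : ℕ) (β q : ℝ) (α : Fin N × Fin N) (σ : Cfg N) : ℝ :=
  if α.1 < α.2 then β / Real.sqrt N * spin (σ α.1) * spin (σ α.2)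
  else if α.1 = α.2 then β * Real.sqrt q * spin (σ α.1) else 0

/-- The external field term. -/
def skField (N : ℕ) (h : ℝ) (σ : Cfg N) : ℝ := h * ∑ i, spin (σ i)

/-- Average for the model in which the coefficients of the disorder are weighted by `w`. -/
def wAvg {ι : Type} [Fintype ι] [DecidableEq ι] (N : ℕ) (β q h : ℝ) (w : Fin N × Fin N → ℝ)
    (f : (ι → Cfg N) → ℝ) : ℝ :=
  avg (fun α σ => w α * skCoef N β q α σ) (skField N h) f

lemma gibbs_eq_replicaAvg {ι : Type} [Fintype ι] [DecidableEq ι] (N : ℕ) (β h : ℝ)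
    (g : Fin N → Fin N → ℝ) (f : (ι → Cfg N) → ℝ) :
    gibbs N β h g f = replicaAvg (negH N β h g) f := by
  simp only [gibbs, replicaAvg, gibbsWeight, Finset.prod_div_distrib, Finset.prod_const,
    Finset.sum_div, Finset.card_univ, mul_div_assoc]

lemma measurePreserving_curry (N : ℕ) :
    MeasurePreserving (MeasurableEquiv.curry (Fin N) (Fin N) ℝ) (gaussPi (Fin N × Fin N))
      (gaussN N) := by
  refine ⟨(MeasurableEquiv.curry (Fin N) (Fin N) ℝ).measurable, ?_⟩
  rw [gaussPi, gaussN]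
  have := Measure.infinitePi_map_curry (fun _ : Fin N => fun _ : Fin N => gaussianReal 0 1)
  simpa only [Measure.infinitePi_eq_pi] using this

lemma nu_eq_wAvg {ι : Type} [Fintype ι] [DecidableEq ι] (N : ℕ) (β q h : ℝ)
    {w : Fin N × Fin N → ℝ} (hw : ∀ α, w α = if α.1 < α.2 then 1 else 0) (f : (ι → Cfg N) → ℝ) :
    nu N β h f = wAvg N β q h w f := by
  rw [nu, ← (measurePreserving_curry N).integral_comp', wAvg, avg]
  congr 1
  ext x
  rw [gibbs_eq_replicaAvg]
  congr 1
  ext σ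
  rw [negH, energy, skField, Fintype.sum_prod_type]
  congr 1
  simp only [Finset.mul_sum]
  refine Finset.sum_congr rfl fun i _ => Finset.sum_congr rfl fun j _ => ?_
  simp only [hw, skCoef]
  split_ifs
  · simp; ring
  all_goals simp

lemma spin_mul_self (b : Bool) : spin b * spin b = 1 := by
  cases b <;> simp [spin]

lemma abs_spin (b : Bool) : |spin b| = 1 := by
  cases b <;> simp [spin]

section WAvg

variable {ι : Type} [Fintype ι] [DecidableEq ι] {N : ℕ} {β q h : ℝ}

lemma skCoef_mul (hq : 0 ≤ q) (α : Fin N × Fin N) (σ τ : Cfg N) :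
    skCoef N β q α σ * skCoef N β q α τ =
      if α.1 < α.2 then β ^ 2 / N * (spin (σ α.1) * spin (τ α.1)) * (spin (σ α.2) * spin (τ α.2))
      else if α.1 = α.2 then β ^ 2 * q * (spin (σ α.1) * spin (τ α.1)) else 0 := by
  have h1 : (β / √(N : ℝ)) * (β / √(N : ℝ)) = β ^ 2 / N := by
    rw [div_mul_div_comm, Real.mul_self_sqrt (Nat.cast_nonneg N)]; ring
  have h2 := Real.mul_self_sqrt hq
  unfold skCoef
  split_ifs
  · rw [← h1]; ring
  · linear_combination β ^ 2 * (spin (σ α.1) * spin (τ α.1)) * h2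
  · ring

/-- Derivative of `wAvg` along a path of weights. -/
lemma hasDerivAt_wAvg {W W' : ℝ → Fin N × Fin N → ℝ}
    (hW : ∀ θ α, HasDerivAt (fun u => W u α) (W' θ α) θ) (hW' : ∀ θ α, |W' θ α| ≤ 1)
    {f f' : ℝ → (ι → Cfg N) → ℝ} {K : ℝ}
    (hf : ∀ θ s, HasDerivAt (fun u => f u s) (f' θ s) θ)
    (hfK : ∀ θ s, |f θ s| ≤ K) (hfK' : ∀ θ s, |f' θ s| ≤ K)
    {I : Finset ι} (hI : ∀ θ, DependsOn (f θ) (I : Set ι)) {a b : ι} (ha : a ∉ I) (hb : b ∉ I)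
    (hab : a ≠ b) {T : Cfg N → Cfg N → ℝ} {w v d θ : ℝ}
    (hB : ∀ σ τ, ∑ α, W' θ α * W θ α * (skCoef N β q α σ * skCoef N β q α τ) = w * T σ τ + v)
    (hT : ∀ σ τ, T σ τ = T τ σ) (hd : ∀ σ, T σ σ = d) :
    HasDerivAt (fun u => wAvg N β q h (W u) (f u))
      (wAvg N β q h (W θ) (f' θ) + w * freshSum I a b
        (fun l l' => wAvg N β q h (W θ) (fun s => f θ s * T (s l) (s l')))) θ := by
  obtain ⟨K', hK'⟩ := exists_bound fun p : (Fin N × Fin N) × Cfg N => skCoef N β q p.1 p.2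
  refine hasDerivAt_avg (K := max K K') (c := fun u α σ => W u α * skCoef N β q α σ)
    (c' := fun u α σ => W' u α * skCoef N β q α σ)
    (fun θ α σ => (hW θ α).mul_const _) (fun θ α σ => ?_) hf
    (fun θ s => (hfK θ s).trans (le_max_left _ _))
    (fun θ s => (hfK' θ s).trans (le_max_left _ _)) hI ha hb hab (v := v) (fun σ τ => ?_) hT hd
  · rw [abs_mul]
    have h1 := hK' (α, σ)
    calc |W' θ α| * |skCoef N β q α σ| ≤ 1 * |skCoef N β q α σ| :=
          mul_le_mul_of_nonneg_right (hW' θ α) (abs_nonneg _)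
      _ ≤ max K K' := by rw [one_mul]; exact h1.trans (le_max_right _ _)
  · rw [← hB]
    exact Finset.sum_congr rfl fun α _ => by ring

/-- Weights interpolating between independent sites (`θ = 0`) and the full model (`θ = π / 2`). -/
def guerraW (N : ℕ) (θ : ℝ) (α : Fin N × Fin N) : ℝ :=
  if α.1 < α.2 then Real.sin θ else Real.cos θ

/-- Weights interpolating between a model in which the site `k` is isolated (`θ = 0`) and the full
model (`θ = π / 2`). -/
def cavW (N : ℕ) (k : Fin N) (θ : ℝ) (α : Fin N × Fin N) : ℝ :=
  if α.1 < α.2 then (if α.1 = k ∨ α.2 = k then Real.sin θ else 1)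
  else (if α.1 = k then Real.cos θ else 0)

/-- `N (R - q) ^ 2` for the overlap `R`. -/
def overlapSq (N : ℕ) (q : ℝ) (σ τ : Cfg N) : ℝ :=
  (∑ i, (spin (σ i) * spin (τ i) - q)) ^ 2 / N

/-- Centered overlap with the site `k` removed. -/
def cavOverlap (N : ℕ) (q : ℝ) (k : Fin N) (σ τ : Cfg N) : ℝ :=
  (∑ j ∈ Finset.univ.erase k, spin (σ j) * spin (τ j)) / N - q

lemma nu_eq_guerra (f : (ι → Cfg N) → ℝ) (q : ℝ) :
    nu N β h f = wAvg N β q h (guerraW N (Real.pi / 2)) f :=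
  nu_eq_wAvg N β q h (fun α => by simp [guerraW]) f

lemma nu_eq_cav (f : (ι → Cfg N) → ℝ) (k : Fin N) (q : ℝ) :
    nu N β h f = wAvg N β q h (cavW N k (Real.pi / 2)) f :=
  nu_eq_wAvg N β q h (fun α => by simp [cavW]) f

lemma sum_pairs (o : Fin N → ℝ) (ho : ∀ i, o i * o i = 1) :
    ∑ i, ∑ j, (if i < j then o i * o j else 0) = ((∑ i, o i) ^ 2 - N) / 2 := by
  have h1 : (∑ i, o i) ^ 2 = ∑ i, ∑ j, ((if i < j then o i * o j else 0) +
      (if j < i then o j * o i else 0) + if i = j then 1 else 0) := by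
    rw [sq, Finset.sum_mul_sum]
    refine Finset.sum_congr rfl fun i _ => Finset.sum_congr rfl fun j _ => ?_
    rcases lt_trichotomy i j with hij | hij | hij
    · simp [hij, hij.ne, hij.not_gt]
    · subst hij; simp [ho]
    · simp [hij, hij.ne', hij.not_gt, mul_comm]
  simp only [Finset.sum_add_distrib] at h1
  rw [Finset.sum_comm (f := fun i j => if j < i then o j * o i else 0)] at h1
  simp only [Finset.sum_ite_eq, Finset.mem_univ, if_true, Finset.sum_const, Finset.card_univ,
    Fintype.card_fin, nsmul_eq_mul, mul_one] at h1
  linarith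

lemma hasDerivAt_guerra (hN : 0 < N) (hq : 0 ≤ q) {f f' : ℝ → (ι → Cfg N) → ℝ} {K : ℝ}
    (hf : ∀ θ s, HasDerivAt (fun u => f u s) (f' θ s) θ)
    (hfK : ∀ θ s, |f θ s| ≤ K) (hfK' : ∀ θ s, |f' θ s| ≤ K)
    {I : Finset ι} (hI : ∀ θ, DependsOn (f θ) (I : Set ι)) {a b : ι} (ha : a ∉ I) (hb : b ∉ I)
    (hab : a ≠ b) (θ : ℝ) :
    HasDerivAt (fun u => wAvg N β q h (guerraW N u) (f u))
      (wAvg N β q h (guerraW N θ) (f' θ) +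
        (Real.sin θ * Real.cos θ * (β ^ 2 / 2)) * freshSum I a b
        (fun l l' => wAvg N β q h (guerraW N θ)
          (fun s => f θ s * overlapSq N q (s l) (s l')))) θ := by
  have hN' : (N : ℝ) ≠ 0 := by positivity
  refine hasDerivAt_wAvg (W' := fun θ α => if α.1 < α.2 then Real.cos θ else -Real.sin θ)
    (fun θ α => ?_) (fun θ α => ?_) hf hfK hfK' hI ha hb hab
    (v := -(Real.sin θ * Real.cos θ * (β ^ 2 / 2)) * (N * q ^ 2 + 1)) (d := N * (1 - q) ^ 2)
    (fun σ τ => ?_) (fun σ τ => ?_) (fun σ => ?_)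
  · unfold guerraW
    split_ifs
    exacts [Real.hasDerivAt_sin θ, Real.hasDerivAt_cos θ]
  · split_ifs
    · exact Real.abs_cos_le_one θ
    · rw [abs_neg]; exact Real.abs_sin_le_one θ
  · set o : Fin N → ℝ := fun i => spin (σ i) * spin (τ i) with ho
    have ho1 : ∀ i, o i * o i = 1 := fun i => by
      rw [ho]
      linear_combination spin (τ i) * spin (τ i) * spin_mul_self (σ i) + spin_mul_self (τ i)
    have h1 : ∀ i j : Fin N, (if i < j then Real.cos θ else -Real.sin θ) * guerraW N θ (i, j) *
        (skCoef N β q (i, j) σ * skCoef N β q (i, j) τ) =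
        Real.sin θ * Real.cos θ * β ^ 2 / N * (if i < j then o i * o j else 0) -
          Real.sin θ * Real.cos θ * β ^ 2 * q * (if i = j then o i else 0) := fun i j => by
      rw [skCoef_mul hq, guerraW]
      rcases lt_trichotomy i j with hij | hij | hij
      · simp only [hij, hij.ne, if_true, if_false, ho]; ring
      · subst hij; simp only [lt_irrefl, if_true, if_false, ho]; ring
      · simp [hij.not_gt, hij.ne']
    rw [Fintype.sum_prod_type]
    simp only [h1, Finset.sum_sub_distrib, ← Finset.mul_sum, Finset.sum_ite_eq, Finset.mem_univ,
      if_true]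
    rw [sum_pairs o ho1, overlapSq, Finset.sum_sub_distrib]
    simp only [Finset.sum_const, Finset.card_univ, Fintype.card_fin, nsmul_eq_mul]
    field_simp
    ring
  · simp only [overlapSq, mul_comm]
  · simp only [overlapSq, spin_mul_self, Finset.sum_const, Finset.card_univ, Fintype.card_fin,
      nsmul_eq_mul]
    field_simp

lemma hasDerivAt_cav (hN : 0 < N) (hq : 0 ≤ q) (k : Fin N) {f : (ι → Cfg N) → ℝ}
    {I : Finset ι} (hI : DependsOn f (I : Set ι)) {a b : ι} (ha : a ∉ I) (hb : b ∉ I)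
    (hab : a ≠ b) (θ : ℝ) :
    HasDerivAt (fun u => wAvg N β q h (cavW N k u) f)
      ((Real.sin θ * Real.cos θ * β ^ 2) * freshSum I a b
        (fun l l' => wAvg N β q h (cavW N k θ)
          (fun s => f s * (spin (s l k) * spin (s l' k) * cavOverlap N q k (s l) (s l'))))) θ := by
  have hN' : (N : ℝ) ≠ 0 := by positivity
  obtain ⟨K, hK⟩ := exists_bound f
  have := hasDerivAt_wAvg (β := β) (q := q) (h := h) (W := cavW N k) (K := max K 0)
    (f := fun _ => f) (f' := fun _ _ => 0)
    (W' := fun θ α => if α.1 < α.2 then (if α.1 = k ∨ α.2 = k then Real.cos θ else 0)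
      else (if α.1 = k then -Real.sin θ else 0))
    (T := fun σ τ => spin (σ k) * spin (τ k) * cavOverlap N q k σ τ)
    (w := Real.sin θ * Real.cos θ * β ^ 2) (v := 0) (d := (N - 1) / N - q) (θ := θ)
    (fun θ α => ?_) (fun θ α => ?_) (fun θ s => hasDerivAt_const _ _)
    (fun θ s => (hK s).trans (le_max_left _ _)) (fun θ s => by simp) (fun _ => hI) ha hb hab
    (fun σ τ => ?_) (fun σ τ => ?_) (fun σ => ?_)
  · rwa [wAvg, avg_const, zero_add] at this
  · unfold cavW
    split_ifs
    exacts [Real.hasDerivAt_sin θ, hasDerivAt_const _ _, Real.hasDerivAt_cos θ,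
      hasDerivAt_const _ _]
  · split_ifs
    · exact Real.abs_cos_le_one θ
    · simp
    · rw [abs_neg]; exact Real.abs_sin_le_one θ
    · simp
  · set o : Fin N → ℝ := fun i => spin (σ i) * spin (τ i) with ho
    have h1 : ∀ i j : Fin N, (if i < j then (if i = k ∨ j = k then Real.cos θ else 0)
        else (if i = k then -Real.sin θ else 0)) * cavW N k θ (i, j) *
        (skCoef N β q (i, j) σ * skCoef N β q (i, j) τ) =
        (Real.sin θ * Real.cos θ * β ^ 2 / N * ((if i = k then (if k < j then o k * o j else 0)
          else 0) + if j = k then (if i < k then o k * o i else 0) else 0)) -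
          (if j = i then (if i = k then Real.sin θ * Real.cos θ * β ^ 2 * q * o k else 0)
            else 0) := fun i j => by
      rw [skCoef_mul hq, cavW]
      by_cases hik : i = k <;> by_cases hjk : j = k
      · subst hik; subst hjk; simp [ho]; ring
      · subst hik
        rcases lt_or_ge i j with hij | hij
        · simp only [hij, hjk, if_true, if_false, ho, true_or]; ring
        · simp [hij.not_gt, hjk, Ne.symm hjk]
      · subst hjk
        rcases lt_or_ge i j with hij | hij
        · simp only [hij, hik, if_true, if_false, ho, or_true, Ne.symm hik]; ring
        · simp [hij.not_gt, hik, Ne.symm hik]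
      · simp [hik, hjk]
    rw [Fintype.sum_prod_type]
    simp only [h1, Finset.sum_sub_distrib, ← Finset.mul_sum, Finset.mem_univ,
      if_true, Finset.sum_add_distrib, Finset.sum_ite_eq', Finset.sum_ite_irrel,
      Finset.sum_const_zero]
    have h2 : ∑ j, (if k < j then o k * o j else 0) + ∑ j, (if j < k then o k * o j else 0) =
        o k * ∑ j ∈ Finset.univ.erase k, o j := by
      rw [← Finset.sum_add_distrib, Finset.mul_sum,
        ← Finset.sum_erase (Finset.univ : Finset (Fin N)) (a := k) (by simp)]
      refine Finset.sum_congr rfl fun j hj => ?_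
      rcases lt_or_gt_of_ne (Finset.ne_of_mem_erase hj) with h | h <;> simp [h, h.not_gt]
    rw [h2, cavOverlap]
    simp only [ho]
    ring
  · simp only [cavOverlap, mul_comm]
  · simp only [cavOverlap, spin_mul_self, Finset.sum_const, Finset.card_erase_of_mem,
      Finset.mem_univ, Finset.card_univ, Fintype.card_fin, nsmul_eq_mul]
    rw [Nat.cast_sub hN]
    ring

end WAvg

lemma exp_mul_le_cosh_add {t y : ℝ} (hy : |y| ≤ 1) :
    Real.exp (t * y) ≤ Real.cosh t + y * Real.sinh t := by
  obtain ⟨h1, h2⟩ := abs_le.1 hy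
  have := convexOn_exp.2 (Set.mem_univ t) (Set.mem_univ (-t))
    (show (0 : ℝ) ≤ (1 + y) / 2 by linarith) (show (0 : ℝ) ≤ (1 - y) / 2 by linarith) (by ring)
  simp only [smul_eq_mul] at this
  rw [Real.cosh_eq, Real.sinh_eq]
  calc Real.exp (t * y) = Real.exp ((1 + y) / 2 * t + (1 - y) / 2 * -t) := by congr 1; ring
    _ ≤ _ := this
    _ = _ := by ring

lemma avg_exp_le {A C ι : Type} [Fintype A] [DecidableEq A] [Fintype C] [Nonempty C] [Fintype ι]
    [DecidableEq ι] (c : A → C → ℝ) (h : C → ℝ) {Y : (ι → C) → ℝ} (hY : ∀ s, |Y s| ≤ 2)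
    (hY0 : avg c h Y = 0) (a : ℝ) :
    avg c h (fun s => Real.exp (a * Y s)) ≤ Real.exp (2 * a ^ 2) := by
  calc avg c h (fun s => Real.exp (a * Y s))
      ≤ avg c h (fun s => Real.cosh (2 * a) + Real.sinh (2 * a) / 2 * Y s) :=
        avg_mono c h fun s => by
          have := exp_mul_le_cosh_add (t := 2 * a) (y := Y s / 2)
            (by rw [abs_div, abs_two]; linarith [hY s])
          calc Real.exp (a * Y s) = Real.exp (2 * a * (Y s / 2)) := by congr 1; ring
            _ ≤ _ := this
            _ = _ := by ring
    _ = Real.cosh (2 * a) := by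
        rw [avg_add, avg_const, avg_const_mul, hY0, mul_zero, add_zero]
    _ ≤ Real.exp ((2 * a) ^ 2 / 2) := Real.cosh_le_exp_half_sq _
    _ = Real.exp (2 * a ^ 2) := by congr 1; ring

lemma avg_integral {A C ι X : Type} [Fintype A] [DecidableEq A] [Fintype C] [Nonempty C]
    [Fintype ι] [DecidableEq ι] [MeasurableSpace X] {μ : Measure X} (c : A → C → ℝ) (h : C → ℝ)
    {F : X → (ι → C) → ℝ} (hF : ∀ s, Integrable (fun y => F y s) μ) :
    avg c h (fun s => ∫ y, F y s ∂μ) = ∫ y, avg c h (F y) ∂μ := by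
  classical
  have key : ∀ f : (ι → C) → ℝ, avg c h f =
      ∑ s, f s * avg c h (fun s' => if s' = s then 1 else 0) := fun f => by
    simp only [← avg_const_mul, ← avg_sum]
    congr 1
    ext s
    simp
  rw [key]
  simp only [key (F _)]
  rw [integral_finsetSum _ fun s _ => (hF s).mul_const _]
  simp only [integral_mul_const]

lemma integrable_exp_quarter_sq :
    Integrable (fun y : ℝ => Real.exp (y ^ 2 / 4)) (gaussianReal 0 1) := by
  rw [integrable_gaussianReal_iff]
  refine ((integrable_exp_neg_mul_sq (b := 1 / 4) (by norm_num)).const_mul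
    ((√(2 * Real.pi * (1 : NNReal)))⁻¹)).congr (Filter.Eventually.of_forall fun y => ?_)
  simp only [gaussianPDFReal, mul_assoc, ← Real.exp_add]
  congr 2
  simp only [NNReal.coe_one]
  ring

/-- A universal bound for exponential moments of squares of subgaussian variables. -/
def gaussConst : ℝ := ∫ y, Real.exp (y ^ 2 / 4) ∂gaussianReal 0 1

section WAvgSite

variable {ι : Type} [Fintype ι] [DecidableEq ι] {N : ℕ} {β q h : ℝ}

lemma wAvg_site {k : Fin N} {w : Fin N × Fin N → ℝ} (hk : w (k, k) = 1)
    (hw : ∀ α, α.1 < α.2 → (α.1 = k ∨ α.2 = k) → w α = 0) (p : (ι → Bool) → ℝ)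
    {f : (ι → Cfg N) → ℝ} (hf : SiteFree k f) :
    wAvg N β q h w (fun s => p (fun l => s l k) * f s) =
      siteAvg (β * √q) h p * wAvg N β q h w f := by
  refine avg_site (α := (k, k)) (h₂ := fun σ => h * ∑ i ∈ Finset.univ.erase k, spin (σ i))
    (fun σ => ?_) (fun α hα σ b => ?_) (fun σ => ?_) (fun σ b => ?_) p hf
  · simp [hk, skCoef]
  · by_cases h1 : α.1 < α.2
    · by_cases h2 : α.1 = k ∨ α.2 = k
      · simp [hw α h1 h2]
      · push Not at h2
        simp only [skCoef, Function.update_of_ne h2.1, Function.update_of_ne h2.2]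
    · by_cases h2 : α.1 = α.2
      · have : α.1 ≠ k := fun h3 => hα (Prod.ext h3 (h2 ▸ h3))
        simp only [skCoef, Function.update_of_ne this, h1, if_false]
      · simp [skCoef, h1, h2]
  · rw [skField, ← Finset.add_sum_erase _ _ (Finset.mem_univ k), mul_add]
  · congr 1
    exact Finset.sum_congr rfl fun i hi => by
      rw [Function.update_of_ne (Finset.ne_of_mem_erase hi)]

lemma wAvg_guerra_zero_prod (p : Fin N → (ι → Bool) → ℝ) (S : Finset (Fin N)) :
    wAvg N β q h (guerraW N 0) (fun s => ∏ i ∈ S, p i (fun l => s l i)) =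
      ∏ i ∈ S, siteAvg (β * √q) h (p i) := by
  induction S using Finset.induction_on with
  | empty => simp [wAvg, avg_const]
  | insert k S hk ih =>
    simp only [Finset.prod_insert hk]
    rw [wAvg_site (k := k) (by simp [guerraW]) (fun α h1 _ => by simp [guerraW, h1]) (p k), ih]
    intro s s' hs
    refine Finset.prod_congr rfl fun i hi => ?_
    have : i ≠ k := fun h => hk (h ▸ hi)
    simp only [hs _ i this]

lemma wAvg_guerra_zero_exp_sq {Y : (ι → Bool) → ℝ} (hY : ∀ e, |Y e| ≤ 2)
    (hY0 : siteAvg (β * √q) h Y = 0) (t : Fin N → ℝ) (ht : ∑ i, t i ^ 2 ≤ 1) :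
    wAvg N β q h (guerraW N 0) (fun s => Real.exp ((∑ i, t i * Y (fun l => s l i)) ^ 2 / 16)) ≤
      gaussConst := by
  have hlin : ∀ a : ℝ, wAvg N β q h (guerraW N 0)
      (fun s => Real.exp (a * ∑ i, t i * Y (fun l => s l i))) ≤ Real.exp (2 * a ^ 2) := fun a => by
    have h1 : ∀ s : ι → Cfg N, Real.exp (a * ∑ i, t i * Y (fun l => s l i)) =
        ∏ i, (fun i e => Real.exp ((a * t i) * Y e)) i (fun l => s l i) := fun s => by
      rw [← Real.exp_sum, Finset.mul_sum]
      congr 1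
      exact Finset.sum_congr rfl fun i _ => by ring
    simp only [h1]
    rw [wAvg_guerra_zero_prod (fun i e => Real.exp ((a * t i) * Y e))]
    calc ∏ i, siteAvg (β * √q) h (fun e => Real.exp ((a * t i) * Y e))
        ≤ ∏ i, Real.exp (2 * (a * t i) ^ 2) :=
          Finset.prod_le_prod (fun i _ => avg_nonneg _ _ fun e => (Real.exp_pos _).le)
            fun i _ => avg_exp_le _ _ hY hY0 _
      _ = Real.exp (2 * a ^ 2 * ∑ i, t i ^ 2) := by
          rw [← Real.exp_sum, Finset.mul_sum]
          congr 1
          exact Finset.sum_congr rfl fun i _ => by ring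
      _ ≤ Real.exp (2 * a ^ 2) := Real.exp_le_exp.2 (by nlinarith [sq_nonneg a])
  have hsq : ∀ w : ℝ, Real.exp (w ^ 2 / 16) =
      ∫ y, Real.exp (y * (√(1 / 8) * w)) ∂gaussianReal 0 1 := fun w => by
    have := mgf_gaussianReal (p := gaussianReal 0 1) (X := fun y => y) (μ := 0) (v := 1)
      (by simp [Measure.map_id']) (√(1 / 8) * w)
    rw [mgf] at this
    simp only [mul_comm _ (√(1 / 8) * w)]
    rw [this]
    congr 1
    simp only [NNReal.coe_one, mul_pow]
    rw [Real.sq_sqrt (by norm_num)]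
    ring
  simp only [hsq]
  rw [wAvg, avg_integral]
  · refine integral_mono_of_nonneg (Filter.Eventually.of_forall fun y =>
      avg_nonneg _ _ fun s => (Real.exp_pos _).le) integrable_exp_quarter_sq
      (Filter.Eventually.of_forall fun y => ?_)
    have h2 : (√(1 / 8)) ^ 2 = 1 / 8 := Real.sq_sqrt (by norm_num)
    calc _ = wAvg N β q h (guerraW N 0)
          (fun s => Real.exp ((y * √(1 / 8)) * ∑ i, t i * Y (fun l => s l i))) := by
          simp only [mul_assoc, wAvg]
      _ ≤ _ := hlin _
      _ = Real.exp (y ^ 2 / 4) := by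
          rw [mul_pow, h2]; congr 1; ring
  · intro s
    simp only [mul_comm _ (√(1 / 8) * _)]
    exact integrable_exp_mul_gaussianReal _

end WAvgSite

/-- Mean square of the one-site magnetization in the Gaussian field `h + v z`. -/
def siteSq (v h : ℝ) : ℝ :=
  ∫ y, (∑ b, gibbsWeight (fun b => y * (v * spin b) + h * spin b) b * spin b) ^ 2
    ∂gaussianReal 0 1

lemma abs_magnetization_le (E : Bool → ℝ) : |∑ b, gibbsWeight E b * spin b| ≤ 1 := by
  rw [← sum_gibbsWeight E]
  refine (Finset.abs_sum_le_sum_abs _ _).trans (Finset.sum_le_sum fun b _ => ?_)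
  rw [abs_mul, abs_spin, mul_one, abs_of_nonneg (gibbsWeight_nonneg E b)]

lemma siteAvg_pair {ι : Type} [Fintype ι] [DecidableEq ι] (v h : ℝ) {l l' : ι} (hl : l ≠ l') :
    siteAvg v h (fun e : ι → Bool => spin (e l) * spin (e l')) = siteSq v h := by
  rw [siteAvg_eq, siteSq]
  congr 1
  ext y
  rw [replicaAvg_mul_fresh _ (fun e : ι → Bool => spin (e l)) spin l'
    (fun s x => by rw [Function.update_of_ne hl])]
  have := replicaAvg_mul_fresh (fun b => y * (v * spin b) + h * spin b) (fun _ : ι → Bool => 1)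
    spin l (fun _ _ => rfl)
  simp only [one_mul, replicaAvg_const] at this
  rw [this, sq]

/-- The parameters are in the high temperature region, and `q` solves the replica-symmetric
equation. -/
structure Admissible (β q h : ℝ) : Prop where
  pos : 0 < β
  lt : β < 1 / 16
  q_nonneg : 0 ≤ q
  q_le : q ≤ 1
  fixed : siteSq (β * √q) h = q

lemma exists_admissible {β : ℝ} (h : ℝ) (hβ : 0 < β) (hβ' : β < 1 / 16) :
    ∃ q, Admissible β q h := by
  have hb : ∀ v y : ℝ,
      |(∑ b, gibbsWeight (fun b => y * (v * spin b) + h * spin b) b * spin b) ^ 2| ≤ 1 :=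
    fun v y => by
      rw [abs_pow]
      exact pow_le_one₀ (abs_nonneg _) (abs_magnetization_le _)
  have hE : Continuous fun p : ℝ × ℝ =>
      (∑ b, gibbsWeight (fun b => p.2 * (p.1 * spin b) + h * spin b) b * spin b) ^ 2 := by
    refine (continuous_finsetSum _ fun b _ => Continuous.mul ?_ continuous_const).pow 2
    unfold gibbsWeight
    exact Continuous.div (by fun_prop) (by fun_prop) fun p =>
      (sum_exp_pos (fun b => p.2 * (p.1 * spin b) + h * spin b)).ne'
  obtain ⟨F, hF⟩ : ∃ F : ℝ → ℝ → ℝ, F = fun v y =>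
      (∑ b, gibbsWeight (fun b => y * (v * spin b) + h * spin b) b * spin b) ^ 2 := ⟨_, rfl⟩
  have hFb : ∀ v y, ‖F v y‖ ≤ 1 := fun v y => by rw [hF]; exact hb v y
  have hFc : Continuous fun p : ℝ × ℝ => F p.1 p.2 := by rw [hF]; exact hE
  have hcont : Continuous fun v => siteSq v h := by
    have h1 : (fun v => siteSq v h) = fun v => ∫ y, F v y ∂gaussianReal 0 1 := by rw [hF]; rfl
    rw [h1]
    refine continuous_of_dominated (bound := fun _ => 1) (fun v => ?_) (fun v => ?_)
      (integrable_const _) ?_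
    · exact (hFc.comp (by fun_prop : Continuous fun y : ℝ => (v, y))).aestronglyMeasurable
    · exact Filter.Eventually.of_forall fun y => hFb v y
    · exact Filter.Eventually.of_forall fun y =>
        hFc.comp (by fun_prop : Continuous fun v : ℝ => (v, y))
  have hmem : ∀ v, siteSq v h ∈ Set.Icc (0 : ℝ) 1 := fun v => by
    constructor
    · exact integral_nonneg fun y => sq_nonneg _
    · have := norm_integral_le_of_norm_le_const (μ := gaussianReal 0 1)
        (Filter.Eventually.of_forall fun y => hFb v y)
      simp only [probReal_univ, mul_one] at this
      rw [hF] at this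
      exact (le_abs_self _).trans this
  obtain ⟨q, hq, hfix⟩ := exists_mem_Icc_isFixedPt_of_mapsTo (f := fun q => siteSq (β * √q) h)
    (a := 0) (b := 1) (hcont.comp (by fun_prop)).continuousOn zero_le_one (fun q _ => hmem _)
  exact ⟨q, hβ, hβ', hq.1, hq.2, hfix⟩

section Nu

variable {ι : Type} [Fintype ι] [DecidableEq ι] {N : ℕ} {β h : ℝ}

lemma nu_eq_avg (f : (ι → Cfg N) → ℝ) : nu N β h f =
    avg (fun α σ => guerraW N (Real.pi / 2) α * skCoef N β 0 α σ) (skField N h) f :=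
  nu_eq_guerra f 0

lemma nu_add (f g : (ι → Cfg N) → ℝ) :
    nu N β h (fun s => f s + g s) = nu N β h f + nu N β h g := by
  simp only [nu_eq_avg, avg_add]

lemma nu_sub (f g : (ι → Cfg N) → ℝ) :
    nu N β h (fun s => f s - g s) = nu N β h f - nu N β h g := by
  simp only [nu_eq_avg, avg_sub]

lemma nu_const_mul (r : ℝ) (f : (ι → Cfg N) → ℝ) :
    nu N β h (fun s => r * f s) = r * nu N β h f := by
  simp only [nu_eq_avg, avg_const_mul]

lemma nu_sum {κ : Type} (t : Finset κ) (f : κ → (ι → Cfg N) → ℝ) :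
    nu N β h (fun s => ∑ k ∈ t, f k s) = ∑ k ∈ t, nu N β h (f k) := by
  simp only [nu_eq_avg, avg_sum]

lemma nu_const (r : ℝ) : nu N β h (fun _ : ι → Cfg N => r) = r := by
  simp only [nu_eq_avg, avg_const]

lemma nu_mono {f g : (ι → Cfg N) → ℝ} (hfg : ∀ s, f s ≤ g s) : nu N β h f ≤ nu N β h g := by
  simp only [nu_eq_avg]
  exact avg_mono _ _ hfg

lemma abs_nu_le {f g : (ι → Cfg N) → ℝ} (hfg : ∀ s, |f s| ≤ g s) :
    |nu N β h f| ≤ nu N β h g := by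
  simp only [nu_eq_avg]
  exact abs_avg_le_avg _ _ hfg

end Nu

section Guerra

variable {ι : Type} [Fintype ι] [DecidableEq ι] {N : ℕ} {β q h : ℝ}

lemma overlapSq_nonneg (σ τ : Cfg N) : 0 ≤ overlapSq N q σ τ := by
  unfold overlapSq; positivity

lemma abs_spin_sub_le (a b : Bool) : |spin a - spin b| ≤ 2 := by
  refine (abs_sub _ _).trans ?_
  rw [abs_spin, abs_spin]; norm_num

/-- The linear statistic `∑ t_i (σ_i - τ_i)`. -/
def linStat (t : Fin N → ℝ) (σ τ : Cfg N) : ℝ := ∑ i, t i * (spin (σ i) - spin (τ i))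

/-- The quantity whose exponential moments are controlled by interpolation. -/
def guerraU (q : ℝ) (t : Fin N → ℝ) (σ τ : Cfg N) : ℝ :=
  (overlapSq N q σ τ + linStat t σ τ ^ 2) / 32

lemma guerraU_nonneg (t : Fin N → ℝ) (σ τ : Cfg N) : 0 ≤ guerraU q t σ τ := by
  have := overlapSq_nonneg (q := q) σ τ
  unfold guerraU; positivity

lemma wAvg_guerra_zero_exp (H : Admissible β q h) (hN : 0 < N) {t : Fin N → ℝ}
    (ht : ∑ i, t i ^ 2 ≤ 1) {l l' : ι} (hl : l ≠ l') :
    wAvg N β q h (guerraW N 0) (fun s => Real.exp (guerraU q t (s l) (s l'))) ≤ gaussConst := by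
  have h1 := wAvg_guerra_zero_exp_sq (N := N) (β := β) (q := q) (h := h)
    (Y := fun e : ι → Bool => spin (e l) - spin (e l')) (fun e => abs_spin_sub_le _ _) (by
      rw [siteAvg, avg_sub, sub_eq_zero, ← avg_perm _ _ (Equiv.swap l l')]
      simp) t ht
  have h2 := wAvg_guerra_zero_exp_sq (N := N) (β := β) (q := q) (h := h)
    (Y := fun e : ι → Bool => spin (e l) * spin (e l') - q) (fun e => by
      refine (abs_sub _ _).trans ?_
      rw [abs_mul, abs_spin, abs_spin, abs_of_nonneg H.q_nonneg]
      linarith [H.q_le]) (by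
      have := siteAvg_pair (β * √q) h hl
      rw [H.fixed] at this
      rw [siteAvg] at this ⊢
      rw [avg_sub, avg_const, this, sub_self]) (fun _ => 1 / √(N : ℝ)) (by
      have : (N : ℝ) ≠ 0 := by positivity
      simp only [div_pow, Real.sq_sqrt (Nat.cast_nonneg N), one_pow, Finset.sum_const,
        Finset.card_univ, Fintype.card_fin, nsmul_eq_mul]
      rw [mul_one_div_cancel this])
  calc wAvg N β q h (guerraW N 0) (fun s => Real.exp (guerraU q t (s l) (s l')))
      ≤ wAvg N β q h (guerraW N 0) (fun s => (1 / 2) *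
        (Real.exp ((∑ i, t i * (spin (s l i) - spin (s l' i))) ^ 2 / 16) +
        Real.exp ((∑ i, 1 / √(N : ℝ) * (spin (s l i) * spin (s l' i) - q)) ^ 2 / 16))) := by
        refine avg_mono _ _ fun s => ?_
        have h3 : (∑ i, 1 / √(N : ℝ) * (spin (s l i) * spin (s l' i) - q)) ^ 2 =
            overlapSq N q (s l) (s l') := by
          rw [← Finset.mul_sum, mul_pow, div_pow, Real.sq_sqrt (Nat.cast_nonneg N), overlapSq]
          ring
        rw [h3, guerraU, linStat]
        set x := (∑ i, t i * (spin (s l i) - spin (s l' i))) ^ 2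
        set y := overlapSq N q (s l) (s l')
        have h4 : Real.exp ((y + x) / 32) = Real.exp (x / 32) * Real.exp (y / 32) := by
          rw [← Real.exp_add]; congr 1; ring
        have h5 : Real.exp (x / 16) = Real.exp (x / 32) ^ 2 := by
          rw [← Real.exp_nat_mul]; congr 1; push_cast; ring
        have h6 : Real.exp (y / 16) = Real.exp (y / 32) ^ 2 := by
          rw [← Real.exp_nat_mul]; congr 1; push_cast; ring
        rw [h4, h5, h6]
        nlinarith [sq_nonneg (Real.exp (x / 32) - Real.exp (y / 32))]
    _ ≤ gaussConst := by
        rw [wAvg, avg_const_mul, avg_add]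
        rw [wAvg] at h1 h2
        linarith

lemma nu_exp_guerraU_le (H : Admissible β q h) (hN : 0 < N) {t : Fin N → ℝ}
    (ht : ∑ i, t i ^ 2 ≤ 1) {l l' a b : ι} (hl : l ≠ l') (ha : a ∉ ({l, l'} : Finset ι))
    (hb : b ∉ ({l, l'} : Finset ι)) (hab : a ≠ b) :
    nu N β h (fun s => Real.exp (guerraU q t (s l) (s l') / 2)) ≤ gaussConst := by
  have hβ2 : β ^ 2 ≤ 1 / 256 := by nlinarith [H.pos, H.lt]
  have hκ : ∀ θ, 0 ≤ 1 - 128 * β ^ 2 * Real.sin θ := fun θ => by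
    nlinarith [Real.sin_le_one θ, sq_nonneg β]
  have hκ2 : ∀ θ, 1 - 128 * β ^ 2 * Real.sin θ ≤ 2 := fun θ => by
    nlinarith [Real.neg_one_le_sin θ, sq_nonneg β]
  obtain ⟨M, hM⟩ := exists_bound fun p : Cfg N × Cfg N => guerraU q t p.1 p.2
  have hM' : ∀ σ τ, guerraU q t σ τ ≤ M := fun σ τ => (le_abs_self _).trans (hM (σ, τ))
  set U : (ι → Cfg N) → ℝ := fun s => guerraU q t (s l) (s l') with hU
  have hU0 : ∀ s, 0 ≤ U s := fun s => guerraU_nonneg t _ _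
  set f : ℝ → (ι → Cfg N) → ℝ := fun θ s => Real.exp ((1 - 128 * β ^ 2 * Real.sin θ) * U s)
    with hf
  have hf0 : ∀ θ s, 0 ≤ f θ s := fun θ s => (Real.exp_pos _).le
  have hfb : ∀ θ s, f θ s ≤ Real.exp (2 * M) := fun θ s =>
    Real.exp_le_exp.2 (mul_le_mul (hκ2 θ) (hM' _ _) (hU0 s) (by norm_num))
  have hder := fun θ => hasDerivAt_guerra (ι := ι) (β := β) (q := q) (h := h) hN H.q_nonneg
    (f := f) (f' := fun θ s => (-(128 * β ^ 2 * Real.cos θ) * U s) * f θ s)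
    (K := max (Real.exp (2 * M)) (M * Real.exp (2 * M))) (I := {l, l'})
    (fun θ s => by
      have := (((Real.hasDerivAt_sin θ).const_mul (128 * β ^ 2)).const_sub 1).mul_const (U s)
      convert! this.exp using 1
      ring)
    (fun θ s => by
      rw [abs_of_nonneg (hf0 θ s)]
      exact (hfb θ s).trans (le_max_left _ _))
    (fun θ s => by
      rw [abs_mul, abs_mul, abs_of_nonneg (hf0 θ s), abs_of_nonneg (hU0 s), abs_neg, abs_mul,
        abs_of_nonneg (by positivity : 0 ≤ 128 * β ^ 2)]
      refine le_trans ?_ (le_max_right _ _)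
      have h1 : 128 * β ^ 2 * |Real.cos θ| ≤ 1 := by
        nlinarith [Real.abs_cos_le_one θ, abs_nonneg (Real.cos θ), sq_nonneg β]
      refine mul_le_mul ?_ (hfb θ s) (hf0 θ s) ((hU0 s).trans (hM' _ _))
      calc 128 * β ^ 2 * |Real.cos θ| * U s ≤ 1 * M :=
            mul_le_mul h1 (hM' _ _) (hU0 s) zero_le_one
        _ = M := one_mul M)
    (fun θ s s' hs => by simp only [hf, hU, hs l (by simp), hs l' (by simp)]) ha hb hab θ
  have hal : a ≠ l := fun h => ha (by simp [h])
  have hal' : a ≠ l' := fun h => ha (by simp [h])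
  have hbl : b ≠ l := fun h => hb (by simp [h])
  have hbl' : b ≠ l' := fun h => hb (by simp [h])
  have hle : ∀ σ τ : Cfg N, overlapSq N q σ τ ≤ 32 * guerraU q t σ τ := fun σ τ => by
    rw [guerraU]; nlinarith [sq_nonneg (linStat t σ τ)]
  have hcheb : ∀ θ, wAvg N β q h (guerraW N θ) (fun s => f θ s * guerraU q t (s a) (s b)) ≤
      wAvg N β q h (guerraW N θ) (fun s => f θ s * U s) := fun θ => by
    set γ := 1 - 128 * β ^ 2 * Real.sin θ with hγ
    set g : (ι → Cfg N) → ℝ := fun s => Real.exp (γ * guerraU q t (s a) (s b)) with hg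
    let π : Equiv.Perm ι := (Equiv.swap l a).trans (Equiv.swap l' b)
    have e1 : π l = a := by
      simp [π, Equiv.swap_apply_of_ne_of_ne hal' hab]
    have e2 : π l' = b := by
      simp [π, Equiv.swap_apply_of_ne_of_ne hl.symm hal'.symm]
    have e3 : π a = l := by
      simp [π, Equiv.swap_apply_of_ne_of_ne hl hbl.symm]
    have e4 : π b = l' := by
      simp [π, Equiv.swap_apply_of_ne_of_ne hbl hab.symm]
    have p1 : wAvg N β q h (guerraW N θ) (fun s => g s * guerraU q t (s a) (s b)) =
        wAvg N β q h (guerraW N θ) (fun s => f θ s * U s) := by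
      rw [wAvg, ← avg_perm _ _ π]
      simp only [hg, e3, e4, hf, hU]
      rfl
    have p2 : wAvg N β q h (guerraW N θ) (fun s => g s * U s) =
        wAvg N β q h (guerraW N θ) (fun s => f θ s * guerraU q t (s a) (s b)) := by
      rw [wAvg, ← avg_perm _ _ π]
      simp only [hg, hU, e1, e2, e3, e4, hf]
      rfl
    have p3 : 0 ≤ wAvg N β q h (guerraW N θ) (fun s => (f θ s * U s +
        g s * guerraU q t (s a) (s b)) - (f θ s * guerraU q t (s a) (s b) + g s * U s)) := by
      refine avg_nonneg _ _ fun s => ?_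
      have : (f θ s * U s + g s * guerraU q t (s a) (s b)) -
        (f θ s * guerraU q t (s a) (s b) + g s * U s) =
        (f θ s - g s) * (U s - guerraU q t (s a) (s b)) := by ring
      rw [this]
      rcases le_total (U s) (guerraU q t (s a) (s b)) with hle | hle
      · refine mul_nonneg_of_nonpos_of_nonpos (sub_nonpos.2 ?_) (sub_nonpos.2 hle)
        exact Real.exp_le_exp.2 (mul_le_mul_of_nonneg_left hle (hκ θ))
      · refine mul_nonneg (sub_nonneg.2 ?_) (sub_nonneg.2 hle)
        exact Real.exp_le_exp.2 (mul_le_mul_of_nonneg_left hle (hκ θ))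
    rw [wAvg, avg_sub, avg_add, avg_add] at p3
    rw [wAvg, wAvg] at p1 p2
    rw [wAvg, wAvg]
    linarith
  have hanti : AntitoneOn (fun θ => wAvg N β q h (guerraW N θ) (f θ))
      (Set.Icc 0 (Real.pi / 2)) := by
    refine antitoneOn_of_deriv_nonpos (convex_Icc _ _)
      (fun θ _ => (hder θ).continuousAt.continuousWithinAt)
      (fun θ _ => (hder θ).differentiableAt.differentiableWithinAt) fun θ hθ => ?_
    rw [interior_Icc] at hθ
    rw [(hder θ).deriv]
    have hs0 := Real.sin_nonneg_of_nonneg_of_le_pi hθ.1.le (by linarith [hθ.2, Real.pi_pos])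
    have hc0 := Real.cos_nonneg_of_mem_Icc (x := θ) ⟨by linarith [hθ.1, Real.pi_pos], hθ.2.le⟩
    set X := wAvg N β q h (guerraW N θ) (fun s => f θ s * U s) with hX
    have hX0 : 0 ≤ X := avg_nonneg _ _ fun s => mul_nonneg (hf0 θ s) (hU0 s)
    set T : ι → ι → ℝ := fun i j =>
      wAvg N β q h (guerraW N θ) (fun s => f θ s * overlapSq N q (s i) (s j)) with hT
    have hT0 : ∀ i j, 0 ≤ T i j := fun i j =>
      avg_nonneg _ _ fun s => mul_nonneg (hf0 θ s) (overlapSq_nonneg _ _)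
    have hT1 : T l l' ≤ 32 * X := by
      simp only [hX, hT]
      rw [wAvg, wAvg, ← avg_const_mul]
      exact avg_mono _ _ fun s => by
        have := mul_le_mul_of_nonneg_left (hle (s l) (s l')) (hf0 θ s)
        simp only [hU]; linarith
    have hT2 : T a b ≤ 32 * X := by
      refine le_trans ?_ (mul_le_mul_of_nonneg_left (hcheb θ) (by norm_num))
      simp only [hT]
      rw [wAvg, wAvg, ← avg_const_mul]
      exact avg_mono _ _ fun s => by
        have := mul_le_mul_of_nonneg_left (hle (s a) (s b)) (hf0 θ s)
        linarith
    have hTs : T l' l = T l l' := by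
      have : ∀ σ τ : Cfg N, overlapSq N q σ τ = overlapSq N q τ σ := fun σ τ => by
        unfold overlapSq
        rw [Finset.sum_congr rfl fun i _ => by rw [mul_comm (spin (σ i))]]
      simp only [hT]
      congr 1
      ext s
      rw [this]
    have hF : freshSum {l, l'} a b T ≤ 256 * X := by
      rw [freshSum, Finset.sum_pair hl, Finset.sum_pair hl, Finset.card_pair hl]
      have e1 : ({l, l'} : Finset ι).erase l = {l'} := by
        rw [Finset.erase_insert (by simpa using hl)]
      have e2 : ({l, l'} : Finset ι).erase l' = {l} := by
        rw [Finset.pair_comm, Finset.erase_insert (by simpa using hl.symm)]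
      rw [e1, e2, Finset.sum_singleton, Finset.sum_singleton, hTs]
      push_cast
      linarith [hT0 l a, hT0 l' a]
    have hfst : wAvg N β q h (guerraW N θ)
        (fun s => (-(128 * β ^ 2 * Real.cos θ) * U s) * f θ s) =
        -(128 * β ^ 2 * Real.cos θ) * X := by
      rw [hX, wAvg, wAvg, ← avg_const_mul]
      congr 1
      ext s
      ring
    rw [hfst]
    have h7 : Real.sin θ * Real.cos θ * (β ^ 2 / 2) * freshSum {l, l'} a b T ≤
        Real.sin θ * Real.cos θ * (β ^ 2 / 2) * (256 * X) :=
      mul_le_mul_of_nonneg_left hF (by positivity)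
    have h8 : 0 ≤ 128 * β ^ 2 * Real.cos θ * X * (1 - Real.sin θ) := by
      have := Real.sin_le_one θ
      have : 0 ≤ 1 - Real.sin θ := by linarith
      positivity
    linarith
  have hend := hanti (Set.left_mem_Icc.2 (by positivity)) (Set.right_mem_Icc.2 (by positivity))
    (by positivity : (0 : ℝ) ≤ Real.pi / 2)
  simp only at hend
  rw [← nu_eq_guerra] at hend
  refine le_trans (nu_mono fun s => ?_) (hend.trans ?_)
  · refine Real.exp_le_exp.2 ?_
    rw [Real.sin_pi_div_two]
    nlinarith [hU0 s]
  · have := wAvg_guerra_zero_exp (ι := ι) H hN ht hl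
    simpa [hf, hU] using this

end Guerra

section FreshSum

variable {ι : Type} [DecidableEq ι] {I : Finset ι} {a b : ι}

lemma freshSum_sub (T T' : ι → ι → ℝ) :
    freshSum I a b (fun l l' => T l l' - T' l l') = freshSum I a b T - freshSum I a b T' := by
  simp only [freshSum, Finset.sum_sub_distrib]
  ring

lemma abs_freshSum_le (ha : a ∉ I) (hab : a ≠ b) {T : ι → ι → ℝ} {M : ℝ}
    (hT : ∀ l ∈ insert a (insert b I), ∀ l' ∈ insert a (insert b I), l ≠ l' → |T l l'| ≤ M) :
    |freshSum I a b T| ≤ 5 * (#I : ℝ) ^ 2 * M := by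
  have h3 := hT a (by simp) b (by simp) hab
  have hM : 0 ≤ M := (abs_nonneg _).trans h3
  have h1 : |∑ l ∈ I, ∑ l' ∈ I.erase l, T l l'| ≤ (#I : ℝ) * ((#I : ℝ) * M) := by
    refine (Finset.abs_sum_le_sum_abs _ _).trans
      ((Finset.sum_le_card_nsmul _ _ _ fun l hl => ?_).trans (nsmul_eq_mul _ _).le)
    refine (Finset.abs_sum_le_sum_abs _ _).trans ((Finset.sum_le_card_nsmul _ _ M fun l' hl' =>
      hT l (by simp [hl]) l' (by simp [Finset.mem_of_mem_erase hl'])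
        (Finset.ne_of_mem_erase hl').symm).trans ?_)
    rw [nsmul_eq_mul]
    exact mul_le_mul_of_nonneg_right (by exact_mod_cast Finset.card_erase_le) hM
  have h2 : |∑ l ∈ I, T l a| ≤ (#I : ℝ) * M :=
    (Finset.abs_sum_le_sum_abs _ _).trans ((Finset.sum_le_card_nsmul _ _ M fun l hl =>
      hT l (by simp [hl]) a (by simp) fun h => ha (h ▸ hl)).trans (nsmul_eq_mul _ _).le)
  have hn : (0 : ℝ) ≤ #I := Nat.cast_nonneg _
  have hn2 : (#I : ℝ) ≤ (#I : ℝ) ^ 2 := by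
    rcases Nat.eq_zero_or_pos #I with h | h
    · simp [h]
    · have : (1 : ℝ) ≤ #I := by exact_mod_cast h
      nlinarith
  have h4 : |2 * (#I : ℝ) * ∑ l ∈ I, T l a| ≤ 2 * #I * (#I * M) := by
    rw [abs_mul, abs_of_nonneg (by positivity : (0 : ℝ) ≤ 2 * #I)]
    gcongr
  have h5 : |(#I : ℝ) * (#I + 1) * T a b| ≤ #I * (#I + 1) * M := by
    rw [abs_mul, abs_of_nonneg (by positivity : (0 : ℝ) ≤ #I * (#I + 1))]
    gcongr
  unfold freshSum
  refine (abs_add_le _ _).trans ((add_le_add_left (abs_sub _ _) _).trans ?_)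
  nlinarith [mul_le_mul_of_nonneg_right hn2 hM]

end FreshSum

/-- A system in the high temperature region together with the coefficients of a linear
statistic. -/
structure Setup (N : ℕ) (β q h : ℝ) (t : Fin N → ℝ) : Prop extends Admissible β q h where
  N_pos : 0 < N
  sum_sq : ∑ i, t i ^ 2 ≤ 1

section Moments

variable {ι : Type} [Fintype ι] [DecidableEq ι] {N : ℕ} {β q h : ℝ} {t : Fin N → ℝ}

lemma Admissible.sq_le (H : Admissible β q h) : β ^ 2 ≤ 1 / 256 := by
  nlinarith [H.pos, H.lt]

lemma abs_cavOverlap_le (H : Setup N β q h t) (k : Fin N) (σ τ : Cfg N) :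
    |cavOverlap N q k σ τ| ≤ 2 := by
  have hN : (0 : ℝ) < N := by exact_mod_cast H.N_pos
  have h1 : |∑ j ∈ Finset.univ.erase k, spin (σ j) * spin (τ j)| ≤ N := by
    refine (Finset.abs_sum_le_sum_abs _ _).trans ((Finset.sum_le_card_nsmul _ _ 1 fun j _ => by
      rw [abs_mul, abs_spin, abs_spin, one_mul]).trans ?_)
    rw [nsmul_eq_mul, mul_one]
    exact_mod_cast (Finset.card_erase_le).trans (by simp)
  refine (abs_sub _ _).trans ?_
  rw [abs_div, abs_of_pos hN, abs_of_nonneg H.q_nonneg]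
  have := (div_le_one hN).2 h1
  linarith [H.q_le]

lemma wAvg_cav_le (H : Setup N β q h t) (k : Fin N) {f : (ι → Cfg N) → ℝ} (hf : ∀ s, 0 ≤ f s)
    {l l' a b : ι} (hI : DependsOn f ({l, l'} : Finset ι)) (ha : a ∉ ({l, l'} : Finset ι))
    (hb : b ∉ ({l, l'} : Finset ι)) (hab : a ≠ b) {θ : ℝ} (hθ : θ ∈ Set.Icc 0 (Real.pi / 2)) :
    wAvg N β q h (cavW N k θ) f ≤ Real.exp 2 * nu N β h f := by
  set φ := fun u => wAvg N β q h (cavW N k u) f with hφ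
  have hder := hasDerivAt_cav (h := h) (β := β) H.N_pos H.q_nonneg k hI ha hb hab
  have hφ0 : ∀ u, 0 ≤ φ u := fun u => avg_nonneg _ _ hf
  have hT : ∀ u, |(Real.sin u * Real.cos u * β ^ 2) * freshSum {l, l'} a b
      (fun l l' => wAvg N β q h (cavW N k u)
        (fun s => f s * (spin (s l k) * spin (s l' k) * cavOverlap N q k (s l) (s l'))))| ≤
        φ u := fun u => by
    have h1 := abs_freshSum_le (I := {l, l'}) (b := b) ha hab (M := 2 * φ u)
      (T := (fun l l' => wAvg N β q h (cavW N k u)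
        (fun s => f s * (spin (s l k) * spin (s l' k) * cavOverlap N q k (s l) (s l')))))
      (fun i _ j _ _ => by
        simp only [hφ]
        rw [wAvg, wAvg, ← avg_const_mul]
        refine abs_avg_le_avg _ _ fun s => ?_
        rw [abs_mul, abs_of_nonneg (hf s), abs_mul, abs_mul, abs_spin, abs_spin, one_mul, one_mul,
          mul_comm]
        exact mul_le_mul_of_nonneg_right (abs_cavOverlap_le H k _ _) (hf s))
    have h2 : (#({l, l'} : Finset ι) : ℝ) ≤ 2 := by exact_mod_cast Finset.card_le_two
    have h3 : (#({l, l'} : Finset ι) : ℝ) ^ 2 ≤ 4 := by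
      nlinarith [(Nat.cast_nonneg _ : (0 : ℝ) ≤ #({l, l'} : Finset ι))]
    have h4 : |Real.sin u * Real.cos u * β ^ 2| ≤ 1 / 256 := by
      rw [abs_mul, abs_mul, abs_of_nonneg (sq_nonneg β)]
      have := mul_le_one₀ (Real.abs_sin_le_one u) (abs_nonneg _) (Real.abs_cos_le_one u)
      nlinarith [H.sq_le, sq_nonneg β]
    rw [abs_mul]
    have h5 := mul_le_mul h4 h1 (abs_nonneg _) (by norm_num)
    nlinarith [hφ0 u]
  have hmono : MonotoneOn (fun u => Real.exp u * φ u) (Set.Icc 0 (Real.pi / 2)) := by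
    have hd : ∀ u, HasDerivAt (fun u => Real.exp u * φ u) _ u :=
      fun u => (Real.hasDerivAt_exp u).mul (hder u)
    refine monotoneOn_of_deriv_nonneg (convex_Icc _ _)
      (fun u _ => (hd u).continuousAt.continuousWithinAt)
      (fun u _ => (hd u).differentiableAt.differentiableWithinAt) fun u _ => ?_
    rw [(hd u).deriv, ← mul_add]
    have := (abs_le.1 (hT u)).1
    exact mul_nonneg (Real.exp_pos _).le (by linarith)
  have h1 := hmono hθ (Set.right_mem_Icc.2 (by positivity)) hθ.2
  simp only [hφ] at h1
  rw [← nu_eq_cav] at h1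
  have hnu : 0 ≤ nu N β h f := by
    rw [← nu_const (ι := ι) (N := N) (β := β) (h := h) 0]
    exact nu_mono hf
  have h2 : 1 ≤ Real.exp θ := Real.one_le_exp hθ.1
  have h3 : Real.exp (Real.pi / 2) ≤ Real.exp 2 := Real.exp_le_exp.2 (by linarith [Real.pi_le_four])
  have h4 : 0 ≤ wAvg N β q h (cavW N k θ) f := hφ0 θ
  nlinarith

/-- A function of the replicas with bounded expectation, which dominates the powers of the linear
statistics and of the rescaled overlaps. -/
def domFun (q : ℝ) (t : Fin N → ℝ) (s : ι → Cfg N) : ℝ :=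
  1 + ∑ l, ∑ l' ∈ Finset.univ.erase l, Real.exp (guerraU q t (s l) (s l') / 2)

/-- Sum of the absolute values of all linear statistics. -/
def linSum (t : Fin N → ℝ) (s : ι → Cfg N) : ℝ := 3 + ∑ l, ∑ l', |linStat t (s l) (s l')|

lemma three_le_linSum (t : Fin N → ℝ) (s : ι → Cfg N) : 3 ≤ linSum t s := by
  have : 0 ≤ ∑ l, ∑ l', |linStat t (s l) (s l')| := by positivity
  unfold linSum; linarith

lemma abs_linStat_le (t : Fin N → ℝ) (s : ι → Cfg N) (l l' : ι) :
    |linStat t (s l) (s l')| + 3 ≤ linSum t s := by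
  have h1 : |linStat t (s l) (s l')| ≤ ∑ l', |linStat t (s l) (s l')| :=
    Finset.single_le_sum (f := fun l' => |linStat t (s l) (s l')|) (fun _ _ => abs_nonneg _)
      (Finset.mem_univ l')
  have h2 : ∑ l', |linStat t (s l) (s l')| ≤ ∑ l, ∑ l', |linStat t (s l) (s l')| :=
    Finset.single_le_sum (f := fun l => ∑ l', |linStat t (s l) (s l')|)
      (fun _ _ => Finset.sum_nonneg fun _ _ => abs_nonneg _) (Finset.mem_univ l)
  unfold linSum; linarith

lemma exp_le_domFun (q : ℝ) (t : Fin N → ℝ) (s : ι → Cfg N) {l l' : ι} (hl : l ≠ l') :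
    Real.exp (guerraU q t (s l) (s l') / 2) ≤ domFun q t s := by
  have h1 : Real.exp (guerraU q t (s l) (s l') / 2) ≤
      ∑ l' ∈ Finset.univ.erase l, Real.exp (guerraU q t (s l) (s l') / 2) :=
    Finset.single_le_sum (f := fun l' => Real.exp (guerraU q t (s l) (s l') / 2))
      (fun _ _ => (Real.exp_pos _).le) (by simp [hl.symm])
  have h2 : ∑ l' ∈ Finset.univ.erase l, Real.exp (guerraU q t (s l) (s l') / 2) ≤
      ∑ l, ∑ l' ∈ Finset.univ.erase l, Real.exp (guerraU q t (s l) (s l') / 2) :=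
    Finset.single_le_sum
      (f := fun l => ∑ l' ∈ Finset.univ.erase l, Real.exp (guerraU q t (s l) (s l') / 2))
      (fun _ _ => Finset.sum_nonneg fun _ _ => (Real.exp_pos _).le) (Finset.mem_univ l)
  unfold domFun; linarith

lemma one_le_domFun (q : ℝ) (t : Fin N → ℝ) (s : ι → Cfg N) : 1 ≤ domFun q t s := by
  unfold domFun
  have : 0 ≤ ∑ l, ∑ l' ∈ Finset.univ.erase l, Real.exp (guerraU q t (s l) (s l') / 2) := by
    positivity
  linarith

variable (ι) in
lemma exists_wAvg_domFun_le (hι : 4 ≤ Fintype.card ι) : ∃ C, 0 ≤ C ∧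
    ∀ {N : ℕ} {β q h : ℝ} {t : Fin N → ℝ}, Setup N β q h t → ∀ (k : Fin N),
    ∀ θ ∈ Set.Icc 0 (Real.pi / 2), wAvg N β q h (cavW N k θ) (domFun (ι := ι) q t) ≤ C := by
  have hc : 0 ≤ gaussConst := integral_nonneg fun y => (Real.exp_pos _).le
  refine ⟨1 + ∑ l : ι, ∑ _l' ∈ Finset.univ.erase l, Real.exp 2 * gaussConst, by positivity,
    fun {N β q h t} H k θ hθ => ?_⟩
  unfold domFun
  rw [wAvg, avg_add, avg_const, avg_sum]
  refine add_le_add_right (Finset.sum_le_sum fun l _ => ?_) _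
  rw [avg_sum]
  refine Finset.sum_le_sum fun l' hl' => ?_
  have hne := (Finset.ne_of_mem_erase hl').symm
  obtain ⟨a, ha⟩ : ∃ a, a ∉ ({l, l'} : Finset ι) := by
    by_contra! hcon
    have := Finset.card_le_two (a := l) (b := l')
    rw [Finset.eq_univ_iff_forall.2 hcon, Finset.card_univ] at this
    omega
  obtain ⟨b, hb⟩ : ∃ b, b ∉ ({a, l, l'} : Finset ι) := by
    by_contra! hcon
    have := Finset.card_le_three (a := a) (b := l) (c := l')
    rw [Finset.eq_univ_iff_forall.2 hcon, Finset.card_univ] at this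
    omega
  have hab : a ≠ b := fun h => hb (by simp [h])
  have hb' : b ∉ ({l, l'} : Finset ι) := fun h => hb (Finset.mem_insert_of_mem h)
  refine (wAvg_cav_le H k (fun s => (Real.exp_pos _).le) (fun s s' hs => ?_) ha hb' hab hθ).trans
    (mul_le_mul_of_nonneg_left
      (nu_exp_guerraU_le H.toAdmissible H.N_pos H.sum_sq hne ha hb' hab) (Real.exp_pos _).le)
  simp only [hs l (by simp), hs l' (by simp)]

variable (ι) in
lemma exists_linSum_pow_le (K : ℕ) : ∃ C, 0 ≤ C ∧ ∀ {N : ℕ} (q : ℝ) (t : Fin N → ℝ)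
    (s : ι → Cfg N), linSum t s ^ K ≤ C * domFun q t s := by
  rcases isEmpty_or_nonempty ι with hι | hι
  · refine ⟨3 ^ K, by positivity, fun q t s => ?_⟩
    simp [linSum, domFun]
  set c : ℝ := (Fintype.card ι : ℝ) ^ 2 + 3 with hc
  refine ⟨c ^ K * (K.factorial * Real.exp 17), by positivity, fun {N} q t s => ?_⟩
  obtain ⟨p, -, hp⟩ := Finset.exists_max_image (Finset.univ : Finset (ι × ι))
    (fun p => |linStat t (s p.1) (s p.2)|) Finset.univ_nonempty
  set m := |linStat t (s p.1) (s p.2)| with hm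
  have hm0 : 0 ≤ m := abs_nonneg _
  have h1 : linSum t s ≤ c * (1 + m) := by
    have : ∑ l, ∑ l', |linStat t (s l) (s l')| ≤ (Fintype.card ι : ℝ) ^ 2 * m := by
      calc _ ≤ ∑ _l : ι, ∑ _l' : ι, m := Finset.sum_le_sum fun l _ =>
            Finset.sum_le_sum fun l' _ => hp (l, l') (Finset.mem_univ _)
        _ = _ := by simp; ring
    rw [linSum, hc]
    nlinarith [sq_nonneg (Fintype.card ι : ℝ)]
  have h2 : Real.exp (1 + m) ≤ Real.exp 17 * domFun q t s := by
    by_cases hpe : p.1 = p.2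
    · have : m = 0 := by rw [hm, hpe]; simp [linStat]
      rw [this]
      have h3 : Real.exp (1 + 0) ≤ Real.exp 17 := Real.exp_le_exp.2 (by norm_num)
      nlinarith [one_le_domFun q t s, Real.exp_pos 17]
    · refine le_trans ?_ (mul_le_mul_of_nonneg_left (exp_le_domFun q t s hpe) (Real.exp_pos _).le)
      rw [← Real.exp_add]
      refine Real.exp_le_exp.2 ?_
      have h4 : m ^ 2 = linStat t (s p.1) (s p.2) ^ 2 := by rw [hm, sq_abs]
      have h5 := overlapSq_nonneg (q := q) (s p.1) (s p.2)
      rw [guerraU, ← h4]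
      nlinarith [sq_nonneg (m - 32)]
  calc linSum t s ^ K ≤ (c * (1 + m)) ^ K :=
        pow_le_pow_left₀ (by linarith [three_le_linSum t s]) h1 K
    _ = c ^ K * (1 + m) ^ K := mul_pow _ _ _
    _ ≤ c ^ K * (K.factorial * Real.exp (1 + m)) := by
        refine mul_le_mul_of_nonneg_left ?_ (by positivity)
        have := Real.pow_div_factorial_le_exp (1 + m) (by positivity) K
        rwa [div_le_iff₀ (by positivity), mul_comm] at this
    _ ≤ c ^ K * (K.factorial * (Real.exp 17 * domFun q t s)) := by gcongr
    _ = _ := by ring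

lemma cavOverlap_sq_le (H : Setup N β q h t) (k : Fin N) (s : ι → Cfg N) {l l' : ι} (hl : l ≠ l') :
    (N * cavOverlap N q k (s l) (s l') ^ 2) ^ 2 ≤ 100000 * domFun q t s := by
  have hN : (0 : ℝ) < N := by exact_mod_cast H.N_pos
  have hN1 : (1 : ℝ) ≤ N := by exact_mod_cast H.N_pos
  set o := overlapSq N q (s l) (s l') with ho
  have ho0 : 0 ≤ o := overlapSq_nonneg _ _
  have h1 : N * cavOverlap N q k (s l) (s l') ^ 2 ≤ 2 * o + 2 := by
    have e1 : ∑ j ∈ Finset.univ.erase k, spin (s l j) * spin (s l' j) =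
        ∑ j, (spin (s l j) * spin (s l' j) - q) + N * q - spin (s l k) * spin (s l' k) := by
      rw [Finset.sum_sub_distrib, ← Finset.add_sum_erase _ _ (Finset.mem_univ k)]
      simp
    set A := ∑ j, (spin (s l j) * spin (s l' j) - q) with hA
    set e := spin (s l k) * spin (s l' k) with he
    have he2 : e ^ 2 = 1 := by
      rw [he, mul_pow, sq, sq, spin_mul_self, spin_mul_self, one_mul]
    have e2 : N * cavOverlap N q k (s l) (s l') ^ 2 = (A - e) ^ 2 / N := by
      rw [cavOverlap, e1]; field_simp; ring
    have e3 : o = A ^ 2 / N := rfl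
    rw [e2, e3, div_le_iff₀ hN]
    have e4 : (2 * (A ^ 2 / N) + 2) * N = 2 * A ^ 2 + 2 * N := by field_simp
    rw [e4]
    nlinarith [sq_nonneg (A + e)]
  set U := guerraU q t (s l) (s l') with hU
  have h2 : o ≤ 32 * U := by
    rw [hU, guerraU]; nlinarith [sq_nonneg (linStat t (s l) (s l'))]
  have h3 : U ^ 2 ≤ 8 * Real.exp (U / 2) := by
    have := Real.pow_div_factorial_le_exp (U / 2) (by linarith) 2
    simp only [Nat.factorial] at this
    norm_num at this
    nlinarith
  have h4 := exp_le_domFun q t s hl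
  have h5 := one_le_domFun q t s
  have h6 : (N * cavOverlap N q k (s l) (s l') ^ 2) ^ 2 ≤ (2 * o + 2) ^ 2 :=
    pow_le_pow_left₀ (by positivity) h1 2
  nlinarith [sq_nonneg (o - 1)]

variable (ι) in
lemma exists_linSum_pow_mul_cavOverlap_le (K : ℕ) : ∃ C, 0 ≤ C ∧
    ∀ {N : ℕ} {β q h : ℝ} {t : Fin N → ℝ}, Setup N β q h t → ∀ (k : Fin N) (s : ι → Cfg N)
    (l l' : ι), l ≠ l' →
      linSum t s ^ K * |cavOverlap N q k (s l) (s l')| ≤ C / √N * domFun q t s ∧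
      ∀ m m', m ≠ m' →
        linSum t s ^ K * (|cavOverlap N q k (s l) (s l')| * |cavOverlap N q k (s m) (s m')|) ≤
          C / N * domFun q t s := by
  obtain ⟨C, hC, hD⟩ := exists_linSum_pow_le ι (2 * K)
  refine ⟨200000 + C, by positivity, fun {N β q h t} H k s l l' hl => ?_⟩
  have hN : (0 : ℝ) < N := by exact_mod_cast H.N_pos
  have hd := one_le_domFun q t s
  have h1 := cavOverlap_sq_le H k s hl
  set r := cavOverlap N q k (s l) (s l')
  set D := linSum t s ^ K with hDK
  have hD2 : D ^ 2 ≤ C * domFun q t s := by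
    rw [hDK, ← pow_mul, mul_comm]; exact hD q t s
  constructor
  · rw [div_mul_eq_mul_div, le_div_iff₀ (by positivity)]
    have h2 : √(N : ℝ) ^ 2 = N := Real.sq_sqrt hN.le
    have h3 : (√(N : ℝ) * |r|) ^ 2 = N * r ^ 2 := by rw [mul_pow, h2, sq_abs]
    have : D * |r| * √(N : ℝ) = D * (√(N : ℝ) * |r|) := by ring
    rw [this]
    nlinarith [sq_nonneg (D - √(N : ℝ) * |r|), sq_nonneg (N * r ^ 2 - 1)]
  · intro m m' hm
    have h1' := cavOverlap_sq_le H k s hm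
    set r' := cavOverlap N q k (s m) (s m')
    rw [div_mul_eq_mul_div, le_div_iff₀ hN]
    have h2 : N * (|r| * |r'|) ≤ (N * r ^ 2 + N * r' ^ 2) / 2 := by
      rw [← sq_abs r, ← sq_abs r']
      nlinarith [mul_nonneg hN.le (sq_nonneg (|r| - |r'|))]
    have hD0 : 0 ≤ D := pow_nonneg (by linarith [three_le_linSum t s]) K
    have : D * (|r| * |r'|) * N = D * (N * (|r| * |r'|)) := by ring
    rw [this]
    have h3 := mul_le_mul_of_nonneg_left h2 hD0
    nlinarith [sq_nonneg (D - N * r ^ 2), sq_nonneg (D - N * r' ^ 2)]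

end Moments

section Cavity

variable {ι : Type} [Fintype ι] [DecidableEq ι] {N : ℕ} {β q h : ℝ} {t : Fin N → ℝ}

lemma zero_mem_Icc_pi_div_two : (0 : ℝ) ∈ Set.Icc 0 (Real.pi / 2) :=
  Set.left_mem_Icc.2 (by positivity)

lemma pi_div_two_mem_Icc : Real.pi / 2 ∈ Set.Icc 0 (Real.pi / 2) :=
  Set.right_mem_Icc.2 (by positivity)

lemma abs_sub_le_of_deriv_Icc {φ φ' : ℝ → ℝ} {L : ℝ} (hφ : ∀ u, HasDerivAt φ (φ' u) u)
    (hL : ∀ u ∈ Set.Icc 0 (Real.pi / 2), |φ' u| ≤ L) {u v : ℝ}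
    (hu : u ∈ Set.Icc 0 (Real.pi / 2)) (hv : v ∈ Set.Icc 0 (Real.pi / 2)) :
    |φ v - φ u| ≤ 2 * L := by
  have h1 := (convex_Icc 0 (Real.pi / 2)).norm_image_sub_le_of_norm_hasDerivWithin_le
    (fun u _ => (hφ u).hasDerivWithinAt) hL hu hv
  refine h1.trans ?_
  have hL0 : 0 ≤ L := (abs_nonneg _).trans (hL u hu)
  have h2 : ‖v - u‖ ≤ 2 := by
    rw [Real.norm_eq_abs, abs_le]
    constructor <;> linarith [hu.1, hu.2, hv.1, hv.2, Real.pi_le_four]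
  nlinarith

lemma abs_sin_mul_cos_mul_le (H : Admissible β q h) (u : ℝ) :
    |Real.sin u * Real.cos u * β ^ 2| ≤ 1 / 256 := by
  rw [abs_mul, abs_mul, abs_of_nonneg (sq_nonneg β)]
  have := mul_le_one₀ (Real.abs_sin_le_one u) (abs_nonneg _) (Real.abs_cos_le_one u)
  nlinarith [H.sq_le, sq_nonneg β]

lemma abs_wAvg_cav_sub_nu_le (H : Setup N β q h t) (k : Fin N) {f : (ι → Cfg N) → ℝ}
    {I : Finset ι} (hI : DependsOn f (I : Set ι)) {a b : ι} (ha : a ∉ I) (hb : b ∉ I)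
    (hab : a ≠ b) {M : ℝ} (hM : ∀ θ ∈ Set.Icc 0 (Real.pi / 2), ∀ l l', l ≠ l' →
      wAvg N β q h (cavW N k θ) (fun s => |f s| * |cavOverlap N q k (s l) (s l')|) ≤ M)
    {θ : ℝ} (hθ : θ ∈ Set.Icc 0 (Real.pi / 2)) :
    |wAvg N β q h (cavW N k θ) f - nu N β h f| ≤ (Fintype.card ι : ℝ) ^ 2 * M := by
  have hM0 : 0 ≤ M := (avg_nonneg _ _ fun s => by positivity).trans (hM θ hθ a b hab)
  have hn : (#I : ℝ) ≤ Fintype.card ι := by exact_mod_cast Finset.card_le_univ I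
  have h2 := abs_sub_le_of_deriv_Icc
    (hasDerivAt_cav (β := β) (h := h) H.N_pos H.q_nonneg k hI ha hb hab)
    (L := (Fintype.card ι : ℝ) ^ 2 * M / 2) (fun u hu => by
      have h1 := abs_freshSum_le (I := I) (b := b) ha hab (M := M)
        (T := (fun l l' => wAvg N β q h (cavW N k u)
          (fun s => f s * (spin (s l k) * spin (s l' k) * cavOverlap N q k (s l) (s l')))))
        (fun i _ j _ hij => by
          refine le_trans (abs_avg_le_avg _ _ fun s => ?_) (hM u hu i j hij)
          rw [abs_mul, abs_mul, abs_mul, abs_spin, abs_spin, one_mul, one_mul])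
      rw [abs_mul]
      have h2 := mul_le_mul (abs_sin_mul_cos_mul_le H.toAdmissible u) h1 (abs_nonneg _)
        (by norm_num)
      have h3 : (#I : ℝ) ^ 2 ≤ (Fintype.card ι : ℝ) ^ 2 := by gcongr
      nlinarith [mul_le_mul_of_nonneg_right h3 hM0]) hθ pi_div_two_mem_Icc
  rw [← nu_eq_cav, abs_sub_comm] at h2
  linarith

lemma abs_siteAvg_le {v : ℝ} {p : (ι → Bool) → ℝ} {P : ℝ} (hp : ∀ e, |p e| ≤ P) :
    |siteAvg v h p| ≤ P := by
  rw [siteAvg, ← avg_const (A := Unit) (ι := ι) (fun _ b => v * spin b) (fun b => h * spin b) P]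
  exact abs_avg_le_avg _ _ hp

lemma eight_mul_linSum_pow_le (t : Fin N → ℝ) (s : ι → Cfg N) (K : ℕ) :
    8 * linSum t s ^ K ≤ linSum t s ^ (K + 2) := by
  have h1 := three_le_linSum t s
  have h2 : 0 ≤ linSum t s ^ K := by positivity
  rw [pow_add, mul_comm]
  exact mul_le_mul_of_nonneg_left (by nlinarith) h2

lemma wAvg_cav_zero_site (k : Fin N) (p : (ι → Bool) → ℝ) {f : (ι → Cfg N) → ℝ}
    (hf : SiteFree k f) : wAvg N β q h (cavW N k 0) (fun s => p (fun l => s l k) * f s) =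
      siteAvg (β * √q) h p * wAvg N β q h (cavW N k 0) f :=
  wAvg_site (by simp [cavW]) (fun α h1 h2 => by simp [cavW, h1, h2]) p hf

variable (ι) in
lemma exists_wAvg_linSum_le (hι : 4 ≤ Fintype.card ι) (K : ℕ) : ∃ C : ℝ, 0 ≤ C ∧
    ∀ {N : ℕ} {β q h : ℝ} {t : Fin N → ℝ}, Setup N β q h t → ∀ (k : Fin N),
    ∀ θ ∈ Set.Icc 0 (Real.pi / 2),
      wAvg N β q h (cavW N k θ) (fun s : ι → Cfg N => linSum t s ^ K) ≤ C ∧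
      ∀ l l' : ι, l ≠ l' →
        wAvg N β q h (cavW N k θ)
          (fun s => linSum t s ^ K * |cavOverlap N q k (s l) (s l')|) ≤ C / √N ∧
        ∀ m m', m ≠ m' → wAvg N β q h (cavW N k θ) (fun s => linSum t s ^ K *
          (|cavOverlap N q k (s l) (s l')| * |cavOverlap N q k (s m) (s m')|)) ≤ C / N := by
  obtain ⟨C₁, hC₁, h₁⟩ := exists_wAvg_domFun_le ι hι
  obtain ⟨C₂, hC₂, h₂⟩ := exists_linSum_pow_le ι K
  obtain ⟨C₃, hC₃, h₃⟩ := exists_linSum_pow_mul_cavOverlap_le ι K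
  have key : ∀ {N : ℕ} {β q h : ℝ} {t : Fin N → ℝ}, Setup N β q h t → ∀ (k : Fin N),
      ∀ θ ∈ Set.Icc 0 (Real.pi / 2), ∀ (f : (ι → Cfg N) → ℝ) (c : ℝ), 0 ≤ c →
      (∀ s, f s ≤ c * domFun q t s) → wAvg N β q h (cavW N k θ) f ≤ c * C₁ :=
    fun {N β q h t} H k θ hθ f c hc hf => by
      refine (avg_mono _ _ hf).trans ?_
      rw [avg_const_mul]
      exact mul_le_mul_of_nonneg_left (h₁ H k θ hθ) hc
  refine ⟨(C₂ + C₃) * C₁, by positivity, fun {N β q h t} H k θ hθ => ⟨?_, fun l l' hl => ⟨?_, ?_⟩⟩⟩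
  · refine (key H k θ hθ _ C₂ hC₂ fun s => h₂ q t s).trans ?_
    nlinarith [mul_nonneg hC₃ hC₁]
  · refine (key H k θ hθ _ (C₃ / √N) (by positivity) fun s => (h₃ H k s l l' hl).1).trans ?_
    rw [div_mul_eq_mul_div]
    gcongr
    linarith
  · intro m m' hm
    refine (key H k θ hθ _ (C₃ / N) (by positivity)
      fun s => (h₃ H k s l l' hl).2 m m' hm).trans ?_
    rw [div_mul_eq_mul_div]
    gcongr
    linarith

lemma dependsOn_site {p : (ι → Bool) → ℝ} {I : Finset ι} (hp : DependsOn p (I : Set ι))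
    (k : Fin N) : DependsOn (fun s : ι → Cfg N => p (fun l => s l k)) (I : Set ι) :=
  fun _ _ hs => hp fun l hl => by rw [hs l hl]

lemma DependsOn.mul_fun {C : Type} {f g : (ι → C) → ℝ} {I : Set ι} (hf : DependsOn f I)
    (hg : DependsOn g I) : DependsOn (fun s => f s * g s) I := fun s s' hs => by
  simp only [hf hs, hg hs]

lemma DependsOn.of_subset {C : Type} {f : (ι → C) → ℝ} {I J : Finset ι}
    (hf : DependsOn f (I : Set ι)) (hIJ : I ⊆ J) : DependsOn f (J : Set ι) :=
  fun _ _ hs => hf fun l hl => hs l (hIJ hl)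

variable (ι) in
lemma exists_cavity_first_order (hι : 4 ≤ Fintype.card ι) (K : ℕ) : ∃ C : ℝ, 0 ≤ C ∧
    ∀ {N : ℕ} {β q h : ℝ} {t : Fin N → ℝ}, Setup N β q h t → ∀ (k : Fin N)
    {I : Finset ι} {a b : ι}, a ∉ I → b ∉ I → a ≠ b → ∀ {p : (ι → Bool) → ℝ},
    (∀ e, |p e| ≤ 8) → DependsOn p (I : Set ι) → ∀ {f : (ι → Cfg N) → ℝ}, SiteFree k f →
    DependsOn f (I : Set ι) → (∀ s, |f s| ≤ linSum t s ^ K) →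
    |nu N β h (fun s => p (fun l => s l k) * f s) - siteAvg (β * √q) h p * nu N β h f| ≤
      C / √N := by
  obtain ⟨C, hC, hM⟩ := exists_wAvg_linSum_le ι hι (K + 2)
  refine ⟨9 * ((Fintype.card ι : ℝ) ^ 2 * C), by positivity,
    fun {N β q h t} H k I a b ha hb hab p hp hpI f hf hfI hfK => ?_⟩
  have hb1 : ∀ g : (ι → Cfg N) → ℝ, (∀ s, |g s| ≤ linSum t s ^ (K + 2)) →
      ∀ θ ∈ Set.Icc 0 (Real.pi / 2), ∀ l l', l ≠ l' → wAvg N β q h (cavW N k θ)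
        (fun s => |g s| * |cavOverlap N q k (s l) (s l')|) ≤ C / √N := fun g hg θ hθ l l' hl =>
    (avg_mono _ _ fun s => mul_le_mul_of_nonneg_right (hg s) (abs_nonneg _)).trans
      ((hM H k θ hθ).2 l l' hl).1
  have hfK' : ∀ s, |f s| ≤ linSum t s ^ (K + 2) := fun s =>
    (hfK s).trans (by
      have := eight_mul_linSum_pow_le t s K
      have := (abs_nonneg _).trans (hfK s)
      linarith)
  have hpf : ∀ s, |p (fun l => s l k) * f s| ≤ linSum t s ^ (K + 2) := fun s => by
    rw [abs_mul]
    exact (mul_le_mul (hp _) (hfK s) (abs_nonneg _) (by norm_num)).trans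
      (eight_mul_linSum_pow_le t s K)
  have h1 := abs_wAvg_cav_sub_nu_le H k hfI ha hb hab (hb1 _ hfK') zero_mem_Icc_pi_div_two
  have h2 := abs_wAvg_cav_sub_nu_le H k ((dependsOn_site hpI k).mul_fun hfI) ha hb hab
    (hb1 _ hpf) zero_mem_Icc_pi_div_two
  rw [wAvg_cav_zero_site k p hf] at h2
  have h3 := abs_siteAvg_le (h := h) (v := β * √q) hp
  set e := siteAvg (β * √q) h p
  have h4 : |e * wAvg N β q h (cavW N k 0) f - e * nu N β h f| ≤
      8 * ((Fintype.card ι : ℝ) ^ 2 * (C / √N)) := by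
    rw [← mul_sub, abs_mul]
    exact mul_le_mul h3 h1 (abs_nonneg _) (by norm_num)
  calc _ ≤ (Fintype.card ι : ℝ) ^ 2 * (C / √N) + 8 * ((Fintype.card ι : ℝ) ^ 2 * (C / √N)) := by
        rw [abs_le] at h2 h4 ⊢
        constructor <;> linarith [h2.1, h2.2, h4.1, h4.2]
    _ = _ := by ring

lemma siteFree_cavOverlap (k : Fin N) (l l' : ι) :
    SiteFree k (fun s : ι → Cfg N => cavOverlap N q k (s l) (s l')) := fun s s' hs => by
  simp only [cavOverlap]
  rw [Finset.sum_congr rfl fun j hj => by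
    rw [hs l j (Finset.ne_of_mem_erase hj), hs l' j (Finset.ne_of_mem_erase hj)]]

lemma SiteFree.mul {V : Type} {k : V} {f g : (ι → V → Bool) → ℝ} (hf : SiteFree k f)
    (hg : SiteFree k g) : SiteFree k (fun s => f s * g s) := fun s s' hs => by
  simp only [hf s s' hs, hg s s' hs]

variable (ι) in
lemma exists_cavity_second_order (hι : 4 ≤ Fintype.card ι) (K : ℕ) : ∃ C : ℝ, 0 ≤ C ∧
    ∀ {N : ℕ} {β q h : ℝ} {t : Fin N → ℝ}, Setup N β q h t → ∀ (k : Fin N)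
    {I : Finset ι} {a b c d : ι}, a ∉ I → b ∉ I → a ≠ b → c ∉ insert a (insert b I) →
    d ∉ insert a (insert b I) → c ≠ d → ∀ {p : (ι → Bool) → ℝ},
    (∀ e, |p e| ≤ 8) → DependsOn p (I : Set ι) → siteAvg (β * √q) h p = 0 →
    ∀ {f : (ι → Cfg N) → ℝ}, SiteFree k f →
    DependsOn f (I : Set ι) → (∀ s, |f s| ≤ linSum t s ^ K) →
    |nu N β h (fun s => p (fun l => s l k) * f s) - β ^ 2 / 2 * freshSum I a b (fun l l' =>
      siteAvg (β * √q) h (fun e => p e * (spin (e l) * spin (e l'))) *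
        nu N β h (fun s => f s * cavOverlap N q k (s l) (s l')))| ≤ C / N := by
  obtain ⟨C, hC, hM⟩ := exists_wAvg_linSum_le ι hι (K + 2)
  refine ⟨(Fintype.card ι : ℝ) ^ 2 * (10 * ((Fintype.card ι : ℝ) ^ 2 * C)), by positivity,
    fun {N β q h t} H k I a b c d ha hb hab hc hd hcd p hp hpI hp0 f hf hfI hfK => ?_⟩
  set I' := insert a (insert b I) with hI'
  have hII' : I ⊆ I' := fun x hx => by simp [hI', hx]
  set M := 10 * ((Fintype.card ι : ℝ) ^ 2 * (C / N)) with hMdef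
  have hM0 : 0 ≤ M := by positivity
  set E : ι → ι → ℝ := fun l l' =>
    siteAvg (β * √q) h (fun e => p e * (spin (e l) * spin (e l'))) with hE
  have hEp : ∀ l l' e, |p e * (spin (e l) * spin (e l'))| ≤ 8 := fun l l' e => by
    rw [abs_mul, abs_mul, abs_spin, abs_spin]; simpa using hp e
  have hmain : ∀ θ ∈ Set.Icc 0 (Real.pi / 2), ∀ l ∈ I', ∀ l' ∈ I', l ≠ l' →
      |wAvg N β q h (cavW N k θ) (fun s => p (fun l => s l k) * f s *
        (spin (s l k) * spin (s l' k) * cavOverlap N q k (s l) (s l'))) -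
        E l l' * nu N β h (fun s => f s * cavOverlap N q k (s l) (s l'))| ≤ M :=
    fun θ hθ l hl l' hl' hll' => by
    have hdep : DependsOn (fun s : ι → Cfg N => f s * cavOverlap N q k (s l) (s l'))
        (I' : Set ι) := (DependsOn.of_subset hfI hII').mul_fun fun s s' hs => by
      rw [hs l hl, hs l' hl']
    have hpdep : DependsOn (fun e : ι → Bool => p e * (spin (e l) * spin (e l'))) (I' : Set ι) :=
      (DependsOn.of_subset hpI hII').mul_fun fun s s' hs => by rw [hs l hl, hs l' hl']
    have hfr : SiteFree k (fun s : ι → Cfg N => f s * cavOverlap N q k (s l) (s l')) :=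
      hf.mul (siteFree_cavOverlap k l l')
    have hb1 : ∀ g : (ι → Cfg N) → ℝ,
        (∀ s, |g s| ≤ linSum t s ^ (K + 2) * |cavOverlap N q k (s l) (s l')|) →
        ∀ θ ∈ Set.Icc 0 (Real.pi / 2), ∀ m m', m ≠ m' → wAvg N β q h (cavW N k θ)
        (fun s => |g s| * |cavOverlap N q k (s m) (s m')|) ≤ C / N := fun g hg θ hθ m m' hm => by
      refine (avg_mono _ _ fun s => mul_le_mul_of_nonneg_right (hg s) (abs_nonneg _)).trans ?_
      simp only [mul_assoc]
      exact ((hM H k θ hθ).2 l l' hll').2 m m' hm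
    have hg1 : ∀ s, |f s * cavOverlap N q k (s l) (s l')| ≤
        linSum t s ^ (K + 2) * |cavOverlap N q k (s l) (s l')| := fun s => by
      rw [abs_mul]
      refine mul_le_mul_of_nonneg_right ?_ (abs_nonneg _)
      have := eight_mul_linSum_pow_le t s K
      have := (abs_nonneg _).trans (hfK s)
      linarith [hfK s]
    have hg2 : ∀ s, |(fun e => p e * (spin (e l) * spin (e l'))) (fun l => s l k) *
        (f s * cavOverlap N q k (s l) (s l'))| ≤
        linSum t s ^ (K + 2) * |cavOverlap N q k (s l) (s l')| := fun s => by
      rw [abs_mul, abs_mul (f s), ← mul_assoc]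
      refine mul_le_mul_of_nonneg_right ?_ (abs_nonneg _)
      exact (mul_le_mul (hEp l l' _) (hfK s) (abs_nonneg _) (by norm_num)).trans
        (eight_mul_linSum_pow_le t s K)
    have e1 := abs_wAvg_cav_sub_nu_le H k hdep hc hd hcd (hb1 _ hg1) zero_mem_Icc_pi_div_two
    have hdep2 := (dependsOn_site hpdep k).mul_fun hdep
    have e2 := abs_wAvg_cav_sub_nu_le H k hdep2 hc hd hcd (hb1 _ hg2) zero_mem_Icc_pi_div_two
    have e3 := abs_wAvg_cav_sub_nu_le H k hdep2 hc hd hcd (hb1 _ hg2) hθ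
    rw [wAvg_cav_zero_site k (fun e => p e * (spin (e l) * spin (e l'))) hfr] at e2
    have e4 : |E l l' * wAvg N β q h (cavW N k 0) (fun s => f s * cavOverlap N q k (s l) (s l')) -
        E l l' * nu N β h (fun s => f s * cavOverlap N q k (s l) (s l'))| ≤
        8 * ((Fintype.card ι : ℝ) ^ 2 * (C / N)) := by
      rw [← mul_sub, abs_mul]
      exact mul_le_mul (abs_siteAvg_le (hEp l l')) e1 (abs_nonneg _) (by norm_num)
    have e5 : (fun s : ι → Cfg N => p (fun l => s l k) * f s *
        (spin (s l k) * spin (s l' k) * cavOverlap N q k (s l) (s l'))) =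
        fun s => (p (fun l => s l k) * (spin (s l k) * spin (s l' k))) *
          (f s * cavOverlap N q k (s l) (s l')) := by ext s; ring
    rw [e5]
    rw [abs_le] at e2 e3 e4 ⊢
    constructor <;> linarith [e2.1, e2.2, e3.1, e3.2, e4.1, e4.2]
  set F := freshSum I a b (fun l l' => E l l' *
    nu N β h (fun s => f s * cavOverlap N q k (s l) (s l'))) with hF
  have hder : ∀ u, HasDerivAt (fun u => wAvg N β q h (cavW N k u)
      (fun s => p (fun l => s l k) * f s) - β ^ 2 / 2 * Real.sin u ^ 2 * F) _ u := fun u =>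
    (hasDerivAt_cav H.N_pos H.q_nonneg k ((dependsOn_site hpI k).mul_fun hfI) ha hb hab u).sub
      ((((Real.hasDerivAt_sin u).pow 2).const_mul (β ^ 2 / 2)).mul_const F)
  have hfin := abs_sub_le_of_deriv_Icc hder (L := (Fintype.card ι : ℝ) ^ 2 * M / 2)
    (fun u hu => by
      have h1 := abs_freshSum_le (I := I) (b := b) ha hab (hmain u hu)
      rw [freshSum_sub, ← hF] at h1
      have h2 := mul_le_mul (abs_sin_mul_cos_mul_le H.toAdmissible u) h1 (abs_nonneg _)
        (by norm_num)
      rw [← abs_mul] at h2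
      have hn : (#I : ℝ) ≤ Fintype.card ι := by exact_mod_cast Finset.card_le_univ I
      have h3 : (#I : ℝ) ^ 2 ≤ (Fintype.card ι : ℝ) ^ 2 := by gcongr
      refine le_trans (le_of_eq ?_) (h2.trans ?_)
      · congr 1
        push_cast
        ring
      · nlinarith [mul_le_mul_of_nonneg_right h3 hM0]) zero_mem_Icc_pi_div_two pi_div_two_mem_Icc
  rw [wAvg_cav_zero_site k p hf, hp0, ← nu_eq_cav, Real.sin_pi_div_two, Real.sin_zero] at hfin
  refine le_trans (le_of_eq ?_) (hfin.trans (le_of_eq ?_))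
  · congr 1; ring
  · rw [hMdef]; ring

end Cavity

section Pair

variable {ι : Type} [Fintype ι] [DecidableEq ι] {N : ℕ} {β q h v : ℝ} {t : Fin N → ℝ}

lemma freshSum_of_pair {I : Finset ι} {a b x y : ι} (hx : x ∈ I) (hy : y ∈ I) (hxy : x ≠ y)
    (ha : a ∉ I) (hb : b ∉ I) {T : ι → ι → ℝ} (hsym : ∀ l l', T l l' = T l' l) (hT : T x y = 0)
    (hT0 : ∀ l l', l ≠ x → l ≠ y → l' ≠ x → l' ≠ y → T l l' = 0) :
    freshSum I a b T =
      2 * (∑ l ∈ (I.erase x).erase y, (T x l + T y l) - #I * (T x a + T y a)) := by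
  set J := (I.erase x).erase y with hJ
  have hxJ : x ∉ J := by simp [hJ]
  have hyJ : y ∉ J := by simp [hJ]
  have hxyJ : x ∉ insert y J := by simp [hxJ, hxy]
  have hI : I = insert x (insert y J) := by
    rw [hJ, Finset.insert_erase (Finset.mem_erase.2 ⟨hxy.symm, hy⟩), Finset.insert_erase hx]
  have hJm : ∀ l ∈ J, l ≠ x ∧ l ≠ y := fun l hl =>
    ⟨fun h => hxJ (h ▸ hl), fun h => hyJ (h ▸ hl)⟩
  have hax : a ≠ x := fun h => ha (h ▸ hx)
  have hay : a ≠ y := fun h => ha (h ▸ hy)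
  have hbx : b ≠ x := fun h => hb (h ▸ hx)
  have hby : b ≠ y := fun h => hb (h ▸ hy)
  have h1 : I.erase x = insert y J := by
    rw [hJ, Finset.insert_erase (Finset.mem_erase.2 ⟨hxy.symm, hy⟩)]
  have h2 : I.erase y = insert x J := by
    rw [hJ, Finset.erase_right_comm, Finset.insert_erase (Finset.mem_erase.2 ⟨hxy, hx⟩)]
  have h3 : ∀ l ∈ J, ∑ l' ∈ I.erase l, T l l' = T x l + T y l := fun l hl => by
    obtain ⟨hlx, hly⟩ := hJm l hl
    rw [← Finset.add_sum_erase _ _ (Finset.mem_erase.2 ⟨hlx.symm, hx⟩),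
      ← Finset.add_sum_erase _ _ (Finset.mem_erase.2 ⟨hxy.symm, Finset.mem_erase.2 ⟨hly.symm, hy⟩⟩),
      Finset.sum_eq_zero fun l' hl' => ?_, hsym l x, hsym l y, add_zero]
    simp only [Finset.mem_erase] at hl'
    exact hT0 _ _ hlx hly hl'.2.1 hl'.1
  have h4 : ∑ l ∈ I, ∑ l' ∈ I.erase l, T l l' =
      ∑ l' ∈ I.erase x, T x l' +
        (∑ l' ∈ I.erase y, T y l' + ∑ l ∈ J, ∑ l' ∈ I.erase l, T l l') := by
    conv_lhs => rw [hI, Finset.sum_insert hxyJ, Finset.sum_insert hyJ, ← hI]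
  have h5 : ∑ l ∈ I, T l a = T x a + T y a := by
    rw [hI, Finset.sum_insert hxyJ, Finset.sum_insert hyJ, Finset.sum_eq_zero fun l hl => ?_,
      add_zero]
    exact hT0 _ _ (hJm l hl).1 (hJm l hl).2 hax hay
  rw [freshSum, h4, h5, h1, h2, Finset.sum_insert hyJ, Finset.sum_insert hxJ,
    Finset.sum_congr rfl h3, hsym y x, hT, hT0 a b hax hay hbx hby, Finset.sum_add_distrib]
  ring

lemma siteAvg_perm (π : Equiv.Perm ι) (p : (ι → Bool) → ℝ) :
    siteAvg v h (fun e => p (fun l => e (π l))) = siteAvg v h p :=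
  avg_perm _ _ π p

lemma siteAvg_eq_zero {p : (ι → Bool) → ℝ} (x y : ι)
    (hp : ∀ e, p (fun l => e (Equiv.swap x y l)) = -p e) : siteAvg v h p = 0 := by
  have h1 := siteAvg_perm (v := v) (h := h) (Equiv.swap x y) p
  simp only [hp] at h1
  have h2 : siteAvg v h (fun e => -p e) = -siteAvg v h p := by
    have := avg_const_mul (A := Unit) (fun _ b => v * spin b) (fun b => h * spin b) (-1) p
    simp only [neg_mul, one_mul] at this
    exact this
  linarith

/-- Difference of the spins of two replicas. -/
def spinDiff (x y : ι) (e : ι → Bool) : ℝ := spin (e x) - spin (e y)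

/-- Overlap of the difference of two replicas with a third one. -/
def diffOverlap (x y l : ι) (s : ι → Cfg N) : ℝ :=
  (∑ j, (spin (s x j) - spin (s y j)) * spin (s l j)) / N

/-- Coefficients of the second order cavity expansion. -/
def cavCoef (v h : ℝ) (x y : ι) (u : (ι → Bool) → ℝ) (l : ι) : ℝ :=
  siteAvg v h (fun e => spinDiff x y e * u e * (spin (e x) * spin (e l)))

lemma abs_spinDiff_le (x y : ι) (e : ι → Bool) : |spinDiff x y e| ≤ 2 := abs_spin_sub_le _ _

lemma abs_cavCoef_le {x y l : ι} {u : (ι → Bool) → ℝ} (hu : ∀ e, |u e| ≤ 2) :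
    |cavCoef v h x y u l| ≤ 4 := by
  refine abs_siteAvg_le fun e => ?_
  rw [abs_mul, abs_mul, abs_mul, abs_spin, abs_spin]
  nlinarith [abs_spinDiff_le x y e, hu e, abs_nonneg (spinDiff x y e), abs_nonneg (u e)]

lemma diffOverlap_eq (hN : 0 < N) (k : Fin N) (x y l : ι) (s : ι → Cfg N) :
    diffOverlap x y l s = cavOverlap N q k (s x) (s l) - cavOverlap N q k (s y) (s l) +
      (spin (s x k) - spin (s y k)) * spin (s l k) / N := by
  have : (N : ℝ) ≠ 0 := by positivity
  rw [diffOverlap, ← Finset.add_sum_erase _ _ (Finset.mem_univ k), cavOverlap, cavOverlap]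
  simp only [sub_mul, Finset.sum_sub_distrib]
  field_simp
  ring

variable (ι) in
lemma exists_cavity_pair (hι : 4 ≤ Fintype.card ι) (K : ℕ) : ∃ C : ℝ, 0 ≤ C ∧
    ∀ {N : ℕ} {β q h : ℝ} {t : Fin N → ℝ}, Setup N β q h t → ∀ (k : Fin N)
    {I : Finset ι} {a b c d x y : ι}, a ∉ I → b ∉ I → a ≠ b → c ∉ insert a (insert b I) →
    d ∉ insert a (insert b I) → c ≠ d → x ∈ I → y ∈ I → x ≠ y → ∀ {u : (ι → Bool) → ℝ},
    (∀ e, |u e| ≤ 2) → DependsOn u (I : Set ι) → (∀ e, u (fun l => e (Equiv.swap x y l)) = u e) →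
    ∀ {f : (ι → Cfg N) → ℝ}, SiteFree k f →
    DependsOn f (I : Set ι) → (∀ s, |f s| ≤ linSum t s ^ K) →
    |nu N β h (fun s => spinDiff x y (fun l => s l k) * u (fun l => s l k) * f s) - β ^ 2 *
      (∑ l ∈ (I.erase x).erase y, cavCoef (β * √q) h x y u l *
        nu N β h (fun s => f s * diffOverlap x y l s) -
      #I * (cavCoef (β * √q) h x y u a * nu N β h (fun s => f s * diffOverlap x y a s)))| ≤
      C / N := by
  obtain ⟨C, hC, hM⟩ := exists_cavity_second_order ι hι K
  obtain ⟨C', hC', hM'⟩ := exists_wAvg_linSum_le ι hι K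
  refine ⟨C + 2 * Fintype.card ι * (8 * C'), by positivity,
    fun {N β q h t} H k I a b c d x y ha hb hab hc hd hcd hx hy hxy u hu hud hus f hf hfI hfK => ?_⟩
  have hN : (0 : ℝ) < N := by exact_mod_cast H.N_pos
  have hdiff : ∀ e, spinDiff x y (fun l => e (Equiv.swap x y l)) = -spinDiff x y e := fun e => by
    simp [spinDiff]
  have hp : ∀ e, |spinDiff x y e * u e| ≤ 8 := fun e => by
    rw [abs_mul]
    nlinarith [abs_spinDiff_le x y e, hu e, abs_nonneg (spinDiff x y e), abs_nonneg (u e)]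
  have hdep : DependsOn (fun e : ι → Bool => spinDiff x y e * u e) (I : Set ι) :=
    DependsOn.mul_fun (fun e e' he => by simp only [spinDiff, he x hx, he y hy]) hud
  have h0 : siteAvg (β * √q) h (fun e : ι → Bool => spinDiff x y e * u e) = 0 :=
    siteAvg_eq_zero x y fun e => by simp only [hdiff, hus]; ring
  have hmain := hM H k ha hb hab hc hd hcd hp hdep h0 hf hfI hfK
  set V : ι → ι → ℝ := fun l l' => nu N β h (fun s => f s * cavOverlap N q k (s l) (s l')) with hV
  set E : ι → ι → ℝ := fun l l' => siteAvg (β * √q) h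
    (fun e => spinDiff x y e * u e * (spin (e l) * spin (e l'))) with hE
  have hVs : ∀ l l', V l l' = V l' l := fun l l' => by
    simp only [hV]
    congr 1
    ext s
    rw [cavOverlap, cavOverlap, Finset.sum_congr rfl fun j _ => by rw [mul_comm (spin (s l j))]]
  have hEs : ∀ l l', E l l' = E l' l := fun l l' => by
    simp only [hE]
    congr 1
    ext e
    rw [mul_comm (spin (e l))]
  have hExy : E x y = 0 := siteAvg_eq_zero x y fun e => by
    simp only [hdiff, hus, Equiv.swap_apply_left, Equiv.swap_apply_right]; ring
  have hE0 : ∀ l l', l ≠ x → l ≠ y → l' ≠ x → l' ≠ y → E l l' = 0 := fun l l' h1 h2 h3 h4 =>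
    siteAvg_eq_zero x y fun e => by
      simp only [hdiff, hus, Equiv.swap_apply_of_ne_of_ne h1 h2,
        Equiv.swap_apply_of_ne_of_ne h3 h4]
      ring
  have hEy : ∀ l, l ≠ x → l ≠ y → E y l = -E x l := fun l h1 h2 => by
    have h3 : E y l + E x l = 0 := by
      simp only [hE]
      rw [siteAvg, siteAvg, ← avg_add]
      refine siteAvg_eq_zero x y fun e => ?_
      simp only [hdiff, hus, Equiv.swap_apply_of_ne_of_ne h1 h2, Equiv.swap_apply_left,
        Equiv.swap_apply_right]
      ring
    linarith
  have hW : ∀ l, |V x l - V y l - nu N β h (fun s => f s * diffOverlap x y l s)| ≤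
      2 * C' / N := fun l => by
    simp only [hV]
    rw [← nu_sub, ← nu_sub]
    have h1 := (hM' H k _ pi_div_two_mem_Icc).1
    rw [← nu_eq_cav] at h1
    refine le_trans (abs_nu_le (g := fun s => 2 / N * linSum t s ^ K) fun s => ?_) ?_
    · rw [diffOverlap_eq (q := q) H.N_pos k]
      have h2 := abs_spin_sub_le (s x k) (s y k)
      have : f s * cavOverlap N q k (s x) (s l) - f s * cavOverlap N q k (s y) (s l) -
          f s * (cavOverlap N q k (s x) (s l) - cavOverlap N q k (s y) (s l) +
          (spin (s x k) - spin (s y k)) * spin (s l k) / N) =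
          -((spin (s x k) - spin (s y k)) * spin (s l k) / N * f s) := by ring
      rw [this, abs_neg, abs_mul, abs_div, abs_mul, abs_spin, mul_one, abs_of_pos hN]
      gcongr
      exact hfK s
    · rw [nu_const_mul, mul_div_right_comm]
      gcongr
  have hfs := freshSum_of_pair hx hy hxy ha hb (T := fun l l' => E l l' * V l l')
    (fun l l' => by simp only [hEs l l', hVs l l']) (by simp only [hExy, zero_mul])
    (fun l l' h1 h2 h3 h4 => by simp only [hE0 l l' h1 h2 h3 h4, zero_mul])
  have hax : a ≠ x := fun h => ha (h ▸ hx)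
  have hay : a ≠ y := fun h => ha (h ▸ hy)
  have hterm : ∀ l, l ≠ x → l ≠ y → |E x l * V x l + E y l * V y l -
      cavCoef (β * √q) h x y u l * nu N β h (fun s => f s * diffOverlap x y l s)| ≤
      8 * C' / N := fun l h1 h2 => by
    have h3 : |E x l| ≤ 4 := abs_cavCoef_le hu
    have h4 : E x l * V x l + E y l * V y l -
        cavCoef (β * √q) h x y u l * nu N β h (fun s => f s * diffOverlap x y l s) =
        E x l * (V x l - V y l - nu N β h (fun s => f s * diffOverlap x y l s)) := by
      rw [hEy l h1 h2]
      simp only [cavCoef, hE]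
      ring
    rw [h4, abs_mul]
    calc _ ≤ 4 * (2 * C' / N) := mul_le_mul h3 (hW l) (abs_nonneg _) (by norm_num)
      _ = _ := by ring
  have hs1 : |∑ l ∈ (I.erase x).erase y, (E x l * V x l + E y l * V y l) -
      ∑ l ∈ (I.erase x).erase y, cavCoef (β * √q) h x y u l *
        nu N β h (fun s => f s * diffOverlap x y l s)| ≤ Fintype.card ι * (8 * C' / N) := by
    rw [← Finset.sum_sub_distrib]
    refine (Finset.abs_sum_le_sum_abs _ _).trans ((Finset.sum_le_card_nsmul _ _ (8 * C' / N)
      fun l hl => ?_).trans ?_)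
    · simp only [Finset.mem_erase] at hl
      exact hterm l hl.2.1 hl.1
    · rw [nsmul_eq_mul]
      gcongr
      exact_mod_cast Finset.card_le_univ _
  have hs2 : |(#I : ℝ) * (E x a * V x a + E y a * V y a) - #I * (cavCoef (β * √q) h x y u a *
      nu N β h (fun s => f s * diffOverlap x y a s))| ≤ Fintype.card ι * (8 * C' / N) := by
    rw [← mul_sub, abs_mul, Nat.abs_cast]
    exact mul_le_mul (by exact_mod_cast Finset.card_le_univ _) (hterm a hax hay) (abs_nonneg _)
      (Nat.cast_nonneg _)
  have hC2 : 0 ≤ Fintype.card ι * (8 * C' / N) := (abs_nonneg _).trans hs2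
  have hb2 := H.sq_le
  rw [hfs] at hmain
  set A₁ := ∑ l ∈ (I.erase x).erase y, (E x l * V x l + E y l * V y l)
  set A₂ := ∑ l ∈ (I.erase x).erase y, cavCoef (β * √q) h x y u l *
        nu N β h (fun s => f s * diffOverlap x y l s)
  set B₁ := (#I : ℝ) * (E x a * V x a + E y a * V y a)
  set B₂ := (#I : ℝ) * (cavCoef (β * √q) h x y u a *
      nu N β h (fun s => f s * diffOverlap x y a s))
  have hfin : |β ^ 2 * ((A₁ - A₂) - (B₁ - B₂))| ≤ 2 * Fintype.card ι * (8 * C' / N) := by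
    rw [abs_mul, abs_of_nonneg (sq_nonneg β)]
    have := (abs_sub (A₁ - A₂) (B₁ - B₂)).trans (add_le_add hs1 hs2)
    nlinarith [abs_nonneg (A₁ - A₂ - (B₁ - B₂))]
  calc _ ≤ C / N + 2 * Fintype.card ι * (8 * C' / N) := by
        rw [abs_le] at hmain hfin ⊢
        constructor <;> nlinarith [hmain.1, hmain.2, hfin.1, hfin.2]
    _ = _ := by ring

end Pair

section Expansion

variable {ρ : Type} [DecidableEq ρ]

lemma abs_prod_le_pow_card (T : Finset ρ) {f : ρ → ℝ} {D : ℝ} (hf : ∀ r, |f r| ≤ D) :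
    |∏ r ∈ T, f r| ≤ D ^ #T := by
  rw [Finset.abs_prod, ← Finset.prod_const]
  exact Finset.prod_le_prod (fun _ _ => abs_nonneg _) fun r _ => hf r

lemma abs_prod_sub_prod_le (T : Finset ρ) {f g x : ρ → ℝ} {δ D : ℝ} (hD : 1 ≤ D)
    (hf : ∀ r, |f r| ≤ D) (hg : ∀ r, |g r| ≤ D) (hx : ∀ r, |x r| ≤ D)
    (hfg : ∀ r, f r = g r + δ * x r) :
    |∏ r ∈ T, f r - ∏ r ∈ T, g r| ≤ |δ| * (#T * D ^ #T) := by
  induction T using Finset.induction_on with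
  | empty => simp
  | insert r T hr ih =>
    rw [Finset.prod_insert hr, Finset.prod_insert hr, Finset.card_insert_of_notMem hr]
    have h1 : f r * ∏ r ∈ T, f r - g r * ∏ r ∈ T, g r =
        f r * (∏ r ∈ T, f r - ∏ r ∈ T, g r) + δ * x r * ∏ r ∈ T, g r := by
      rw [hfg r]; ring
    have h2 : |∏ r ∈ T, g r| ≤ D ^ #T := abs_prod_le_pow_card T hg
    have h3 := abs_nonneg δ
    rw [h1]
    refine (abs_add_le _ _).trans ?_
    rw [abs_mul, abs_mul, abs_mul]
    calc _ ≤ D * (|δ| * (#T * D ^ #T)) + |δ| * D * D ^ #T := by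
          gcongr
          exacts [hf r, hx r]
      _ = _ := by push_cast; ring

lemma abs_prod_sub_prod_sub_le (T : Finset ρ) {f g x : ρ → ℝ} {δ D : ℝ} (hD : 1 ≤ D)
    (hf : ∀ r, |f r| ≤ D) (hg : ∀ r, |g r| ≤ D) (hx : ∀ r, |x r| ≤ D)
    (hfg : ∀ r, f r = g r + δ * x r) :
    |∏ r ∈ T, f r - ∏ r ∈ T, g r - δ * ∑ r ∈ T, x r * ∏ r' ∈ T.erase r, g r'| ≤
      δ ^ 2 * (#T ^ 2 * D ^ #T) := by
  induction T using Finset.induction_on with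
  | empty => simp
  | insert r T hr ih =>
    rw [Finset.prod_insert hr, Finset.prod_insert hr, Finset.card_insert_of_notMem hr,
      Finset.sum_insert hr, Finset.erase_insert hr]
    have h0 : ∑ r' ∈ T, x r' * ∏ i ∈ (insert r T).erase r', g i =
        g r * ∑ r' ∈ T, x r' * ∏ i ∈ T.erase r', g i := by
      rw [Finset.mul_sum]
      refine Finset.sum_congr rfl fun r' hr' => ?_
      have hne : r ≠ r' := fun h => hr (h ▸ hr')
      rw [Finset.erase_insert_of_ne hne, Finset.prod_insert fun h => hr (Finset.mem_of_mem_erase h)]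
      ring
    rw [h0]
    have h1 : f r * ∏ r ∈ T, f r - g r * ∏ r ∈ T, g r - δ * (x r * ∏ r ∈ T, g r +
          g r * ∑ r' ∈ T, x r' * ∏ i ∈ T.erase r', g i) =
        g r * (∏ r ∈ T, f r - ∏ r ∈ T, g r - δ * ∑ r' ∈ T, x r' * ∏ i ∈ T.erase r', g i) +
          δ * x r * (∏ r ∈ T, f r - ∏ r ∈ T, g r) := by
      rw [hfg r]; ring
    have h3 := abs_nonneg δ
    rw [h1]
    refine (abs_add_le _ _).trans ?_
    rw [abs_mul, abs_mul, abs_mul]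
    calc _ ≤ D * (δ ^ 2 * (#T ^ 2 * D ^ #T)) + |δ| * D * (|δ| * (#T * D ^ #T)) := by
          gcongr
          exacts [hg r, hx r, abs_prod_sub_prod_le T hD hf hg hx hfg]
      _ = (#T ^ 2 + #T) * (δ ^ 2 * D ^ (#T + 1)) := by rw [← sq_abs δ]; ring
      _ ≤ ((#T + 1 : ℕ) : ℝ) ^ 2 * (δ ^ 2 * D ^ (#T + 1)) := by
          gcongr
          push_cast
          nlinarith [Nat.cast_nonneg (α := ℝ) #T]
      _ = _ := by ring

end Expansion

section Monomial

variable {ι : Type} [Fintype ι] [DecidableEq ι] {ρ : Type} [Fintype ρ] [DecidableEq ρ]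
  {N : ℕ} {β q h : ℝ} {t : Fin N → ℝ}

/-- A local function times a product of linear statistics of pairs of replicas. -/
def statProd (t : Fin N → ℝ) (c d : ρ → ι) (A : (ι → Cfg N) → ℝ) (T : Finset ρ)
    (s : ι → Cfg N) : ℝ :=
  A s * ∏ r ∈ T, linStat t (s (c r)) (s (d r))

/-- The conditions on the data of `statProd`. -/
structure IsStatProd (I : Finset ι) (m : Fin N) (c d : ρ → ι) (A : (ι → Cfg N) → ℝ) : Prop where
  bound : ∀ s, |A s| ≤ 4
  free : ∀ k, k ≠ m → SiteFree k A
  dep : DependsOn A (I : Set ι)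
  left_mem : ∀ r, c r ∈ I
  right_mem : ∀ r, d r ∈ I

/-- The conditions on the factor `u` tested against the difference of replicas `x`, `y`. -/
structure IsTest (I : Finset ι) (x y : ι) (u : (ι → Bool) → ℝ) : Prop where
  left_mem : x ∈ I
  right_mem : y ∈ I
  ne : x ≠ y
  bound : ∀ e, |u e| ≤ 2
  dep : DependsOn u (I : Set ι)
  swap : ∀ e, u (fun l => e (Equiv.swap x y l)) = u e

/-- The overlap terms of the second order cavity expansion. -/
def overlapTerms (N : ℕ) (β q h : ℝ) (I : Finset ι) (a x y : ι) (u : (ι → Bool) → ℝ)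
    (f : (ι → Cfg N) → ℝ) : ℝ :=
  β ^ 2 * (∑ l ∈ (I.erase x).erase y, cavCoef (β * √q) h x y u l *
      nu N β h (fun s => f s * diffOverlap x y l s) -
    #I * (cavCoef (β * √q) h x y u a * nu N β h (fun s => f s * diffOverlap x y a s)))

/-- Coefficients of the terms coming from the linear statistics. -/
def linCoef (v h : ℝ) (x y : ι) (u : (ι → Bool) → ℝ) (z w : ι) : ℝ :=
  siteAvg v h (fun e => spinDiff x y e * u e * spinDiff z w e)

lemma linStat_update (t : Fin N → ℝ) (k : Fin N) (σ τ : Cfg N) :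
    linStat t σ τ = linStat (Function.update t k 0) σ τ + t k * (spin (σ k) - spin (τ k)) := by
  have h1 : ∀ i, t i * (spin (σ i) - spin (τ i)) =
      Function.update t k 0 i * (spin (σ i) - spin (τ i)) +
        if i = k then t k * (spin (σ k) - spin (τ k)) else 0 := fun i => by
    by_cases hi : i = k
    · subst hi; simp
    · simp [hi]
  rw [linStat, linStat, Finset.sum_congr rfl fun i _ => h1 i, Finset.sum_add_distrib,
    Finset.sum_ite_eq', if_pos (Finset.mem_univ k)]

lemma siteFree_statProd {k : Fin N} {A : (ι → Cfg N) → ℝ} (hA : SiteFree k A) (ht : t k = 0)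
    (c d : ρ → ι) (T : Finset ρ) : SiteFree k (statProd t c d A T) := fun s s' hs => by
  rw [statProd, statProd, hA s s' hs]
  congr 1
  refine Finset.prod_congr rfl fun r _ => ?_
  rw [linStat, linStat]
  refine Finset.sum_congr rfl fun j _ => ?_
  by_cases hj : j = k
  · rw [hj, ht, zero_mul, zero_mul]
  · rw [hs _ j hj, hs _ j hj]

lemma IsStatProd.dependsOn {I : Finset ι} {m : Fin N} {c d : ρ → ι} {A : (ι → Cfg N) → ℝ}
    (hA : IsStatProd I m c d A) (t : Fin N → ℝ) (T : Finset ρ) :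
    DependsOn (statProd t c d A T) (I : Set ι) := fun s s' hs => by
  rw [statProd, statProd, hA.dep hs]
  congr 1
  exact Finset.prod_congr rfl fun r _ => by rw [hs _ (hA.left_mem r), hs _ (hA.right_mem r)]

lemma Setup.abs_le_one (H : Setup N β q h t) (k : Fin N) : |t k| ≤ 1 := by
  have h1 : t k ^ 2 ≤ ∑ i, t i ^ 2 :=
    Finset.single_le_sum (f := fun i => t i ^ 2) (fun _ _ => sq_nonneg _) (Finset.mem_univ k)
  exact abs_le_one_iff_mul_self_le_one.2 (by nlinarith [H.sum_sq])

lemma Setup.abs_linStat_update_le (H : Setup N β q h t) (k : Fin N) (s : ι → Cfg N) (l l' : ι) :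
    |linStat (Function.update t k 0) (s l) (s l')| ≤ linSum t s := by
  have h1 := abs_linStat_le t s l l'
  have h2 : |t k * (spin (s l k) - spin (s l' k))| ≤ 1 * 2 := by
    rw [abs_mul]
    exact mul_le_mul (H.abs_le_one k) (abs_spin_sub_le _ _) (abs_nonneg _) zero_le_one
  have h3 := linStat_update t k (s l) (s l')
  rw [abs_le] at h2 ⊢
  have := abs_le.1 (le_refl |linStat t (s l) (s l')|)
  constructor <;> linarith [h2.1, h2.2, this.1, this.2]

lemma one_le_linSum (t : Fin N → ℝ) (s : ι → Cfg N) : 1 ≤ linSum t s := by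
  linarith [three_le_linSum t s]

lemma abs_mul_prod_le {A D : ℝ} (hA : |A| ≤ 4) (hD : 3 ≤ D) (T : Finset ρ) {f : ρ → ℝ}
    (hf : ∀ r, |f r| ≤ D) : |A * ∏ r ∈ T, f r| ≤ D ^ (Fintype.card ρ + 2) := by
  have h1 : |∏ r ∈ T, f r| ≤ D ^ #T := abs_prod_le_pow_card T hf
  rw [abs_mul, pow_add, mul_comm]
  have h2 : D ^ #T ≤ D ^ Fintype.card ρ := pow_le_pow_right₀ (by linarith) (Finset.card_le_univ _)
  exact mul_le_mul (h1.trans h2) (hA.trans (by nlinarith)) (abs_nonneg _) (by positivity)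

lemma abs_statProd_le {A : (ι → Cfg N) → ℝ} (hA : ∀ s, |A s| ≤ 4) (t : Fin N → ℝ) (c d : ρ → ι)
    (T : Finset ρ) (s : ι → Cfg N) : |statProd t c d A T s| ≤ linSum t s ^ (Fintype.card ρ + 2) :=
  abs_mul_prod_le (hA s) (three_le_linSum t s) T fun r => by
    linarith [abs_linStat_le t s (c r) (d r)]

lemma Setup.abs_statProd_update_le (H : Setup N β q h t) {A : (ι → Cfg N) → ℝ}
    (hA : ∀ s, |A s| ≤ 4) (k : Fin N) (c d : ρ → ι) (T : Finset ρ) (s : ι → Cfg N) :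
    |statProd (Function.update t k 0) c d A T s| ≤ linSum t s ^ (Fintype.card ρ + 2) :=
  abs_mul_prod_le (hA s) (three_le_linSum t s) T fun _ => H.abs_linStat_update_le k s _ _

lemma Setup.abs_statProd_sub_le (H : Setup N β q h t) {A : (ι → Cfg N) → ℝ}
    (hA : ∀ s, |A s| ≤ 4) (k : Fin N) (c d : ρ → ι) (T : Finset ρ) (s : ι → Cfg N) :
    |statProd t c d A T s - statProd (Function.update t k 0) c d A T s| ≤
      |t k| * (Fintype.card ρ * linSum t s ^ (Fintype.card ρ + 2)) := by
  have hD := three_le_linSum t s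
  have h1 := abs_prod_sub_prod_le T (one_le_linSum t s)
    (f := fun r => linStat t (s (c r)) (s (d r)))
    (g := fun r => linStat (Function.update t k 0) (s (c r)) (s (d r)))
    (x := fun r => spin (s (c r) k) - spin (s (d r) k)) (δ := t k)
    (fun r => by linarith [abs_linStat_le t s (c r) (d r)])
    (fun _ => H.abs_linStat_update_le k s _ _)
    (fun r => by linarith [abs_spin_sub_le (s (c r) k) (s (d r) k)])
    (fun r => linStat_update t k _ _)
  have h2 : linSum t s ^ #T ≤ linSum t s ^ Fintype.card ρ :=
    pow_le_pow_right₀ (by linarith) (Finset.card_le_univ _)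
  have h3 : (#T : ℝ) ≤ Fintype.card ρ := by exact_mod_cast Finset.card_le_univ _
  rw [statProd, statProd, ← mul_sub, abs_mul]
  calc _ ≤ linSum t s ^ 2 * (|t k| * (Fintype.card ρ * linSum t s ^ Fintype.card ρ)) := by
        refine mul_le_mul ((hA s).trans (by nlinarith)) (h1.trans ?_) (abs_nonneg _) (by positivity)
        gcongr
    _ = _ := by ring

lemma Setup.abs_statProd_expand_le (H : Setup N β q h t) {A : (ι → Cfg N) → ℝ}
    (hA : ∀ s, |A s| ≤ 4) (k : Fin N) (c d : ρ → ι) (s : ι → Cfg N) :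
    |statProd t c d A univ s - statProd (Function.update t k 0) c d A univ s -
      t k * ∑ r, spinDiff (c r) (d r) (fun l => s l k) *
        statProd (Function.update t k 0) c d A (univ.erase r) s| ≤
      t k ^ 2 * (Fintype.card ρ ^ 2 * linSum t s ^ (Fintype.card ρ + 2)) := by
  have hD := three_le_linSum t s
  have h1 := abs_prod_sub_prod_sub_le univ (one_le_linSum t s)
    (f := fun r => linStat t (s (c r)) (s (d r)))
    (g := fun r => linStat (Function.update t k 0) (s (c r)) (s (d r)))
    (x := fun r => spin (s (c r) k) - spin (s (d r) k)) (δ := t k)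
    (fun r => by linarith [abs_linStat_le t s (c r) (d r)])
    (fun _ => H.abs_linStat_update_le k s _ _)
    (fun r => by linarith [abs_spin_sub_le (s (c r) k) (s (d r) k)])
    (fun r => linStat_update t k _ _)
  rw [Finset.card_univ] at h1
  have h2 : ∑ r, spinDiff (c r) (d r) (fun l => s l k) *
        statProd (Function.update t k 0) c d A (univ.erase r) s =
      A s * ∑ r, (spin (s (c r) k) - spin (s (d r) k)) *
        ∏ r' ∈ univ.erase r, linStat (Function.update t k 0) (s (c r')) (s (d r')) := by
    rw [Finset.mul_sum]
    refine Finset.sum_congr rfl fun r _ => ?_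
    rw [statProd, spinDiff]
    ring
  rw [h2, statProd, statProd, mul_left_comm, ← mul_sub, ← mul_sub, abs_mul]
  calc _ ≤ linSum t s ^ 2 * (t k ^ 2 * (Fintype.card ρ ^ 2 * linSum t s ^ Fintype.card ρ)) := by
        exact mul_le_mul ((hA s).trans (by nlinarith)) h1 (abs_nonneg _) (by positivity)
    _ = _ := by ring

end Monomial

section Site

variable {ι : Type} [Fintype ι] [DecidableEq ι] {ρ : Type} [Fintype ρ] [DecidableEq ρ]
  {N : ℕ} {β q h : ℝ} {t : Fin N → ℝ}

lemma Setup.one_le_N (H : Setup N β q h t) : (1 : ℝ) ≤ N := by exact_mod_cast H.N_pos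

lemma Setup.one_div_le (H : Setup N β q h t) : 1 / (N : ℝ) ≤ 1 / √N := by
  have h1 := H.one_le_N
  refine one_div_le_one_div_of_le (by positivity) ?_
  rw [Real.sqrt_le_left (by positivity)]
  nlinarith

lemma abs_mul_one_div_sqrt_le (N : ℕ) (x : ℝ) :
    |x| * (1 / √N) ≤ 1 / N + x ^ 2 := by
  have h1 : (1 / √N) ^ 2 = 1 / N := by
    rw [div_pow, one_pow, Real.sq_sqrt (Nat.cast_nonneg N)]
  rw [← h1, ← sq_abs x]
  nlinarith [sq_nonneg (|x| - 1 / √N), sq_nonneg (|x| + 1 / √N)]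

variable (ι) in
lemma exists_nu_linSum_le (hι : 4 ≤ Fintype.card ι) (K : ℕ) : ∃ C : ℝ, 0 ≤ C ∧
    ∀ {N : ℕ} {β q h : ℝ} {t : Fin N → ℝ}, Setup N β q h t →
    nu N β h (fun s : ι → Cfg N => linSum t s ^ K) ≤ C ∧
    ∀ x y l : ι, l ≠ x → l ≠ y →
      nu N β h (fun s => linSum t s ^ K * |diffOverlap x y l s|) ≤ C * (1 / √N) := by
  obtain ⟨C, hC, hM⟩ := exists_wAvg_linSum_le ι hι K
  refine ⟨4 * C, by positivity, fun {N β q h t} H => ?_⟩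
  set k : Fin N := ⟨0, H.N_pos⟩
  have hM' := hM H k _ pi_div_two_mem_Icc
  rw [← nu_eq_cav] at hM'
  refine ⟨by linarith [hM'.1], fun x y l hx hy => ?_⟩
  have hN : (0 : ℝ) < N := by linarith [H.one_le_N]
  have h1 := (hM'.2 x l hx.symm).1
  have h2 := (hM'.2 y l hy.symm).1
  rw [← nu_eq_cav] at h1 h2
  have h3 : nu N β h (fun s : ι → Cfg N => linSum t s ^ K * |diffOverlap x y l s|) ≤
      nu N β h (fun s : ι → Cfg N => linSum t s ^ K * |cavOverlap N q k (s x) (s l)| +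
        linSum t s ^ K * |cavOverlap N q k (s y) (s l)| + 2 / N * linSum t s ^ K) := by
    refine nu_mono fun s => ?_
    have h4 : 0 ≤ linSum t s ^ K := by
      have := three_le_linSum t s
      positivity
    have h5 : |diffOverlap x y l s| ≤ |cavOverlap N q k (s x) (s l)| +
        |cavOverlap N q k (s y) (s l)| + 2 / N := by
      rw [diffOverlap_eq (q := q) H.N_pos k]
      refine (abs_add_le _ _).trans (add_le_add (abs_sub _ _) ?_)
      rw [abs_div, abs_mul, abs_spin, mul_one, abs_of_pos hN]
      gcongr
      exact abs_spin_sub_le _ _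
    calc _ ≤ linSum t s ^ K * (|cavOverlap N q k (s x) (s l)| +
          |cavOverlap N q k (s y) (s l)| + 2 / N) := mul_le_mul_of_nonneg_left h5 h4
      _ = _ := by ring
  rw [nu_add, nu_add, nu_const_mul] at h3
  have h6 : 2 / (N : ℝ) * nu N β h (fun s : ι → Cfg N => linSum t s ^ K) ≤ 2 * (1 / √N) * C :=
    calc _ ≤ 2 / (N : ℝ) * C := mul_le_mul_of_nonneg_left hM'.1 (by positivity)
      _ = 2 * (1 / N) * C := by ring
      _ ≤ _ := by gcongr 2 * ?_ * C; exact H.one_div_le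
  rw [div_eq_mul_one_div] at h1 h2
  linarith

variable (ι) in
lemma exists_abs_overlapTerms_sub_le (hι : 4 ≤ Fintype.card ι) (K : ℕ) : ∃ C : ℝ, 0 ≤ C ∧
    ∀ {N : ℕ} {β q h : ℝ} {t : Fin N → ℝ}, Setup N β q h t →
    ∀ {I : Finset ι} {a x y : ι}, a ∉ I → ∀ {u : (ι → Bool) → ℝ}, IsTest I x y u →
    ∀ {f g : (ι → Cfg N) → ℝ} {δ : ℝ}, 0 ≤ δ → (∀ s, |f s - g s| ≤ δ * linSum t s ^ K) →
    |overlapTerms N β q h I a x y u f - overlapTerms N β q h I a x y u g| ≤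
      C * (δ * (1 / √N)) := by
  obtain ⟨C, hC, hM⟩ := exists_nu_linSum_le ι hι K
  refine ⟨2 * Fintype.card ι * (4 * C), by positivity,
    fun {N β q h t} H I a x y ha u hu f g δ hδ hfg => ?_⟩
  set B := C * (δ * (1 / √N)) with hB
  have hB0 : 0 ≤ B := by positivity
  have hone : ∀ l, l ≠ x → l ≠ y → |cavCoef (β * √q) h x y u l *
      nu N β h (fun s => f s * diffOverlap x y l s) - cavCoef (β * √q) h x y u l *
      nu N β h (fun s => g s * diffOverlap x y l s)| ≤ 4 * B := fun l h1 h2 => by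
    rw [← mul_sub, abs_mul, ← nu_sub]
    refine mul_le_mul (abs_cavCoef_le hu.bound) ?_ (abs_nonneg _) (by norm_num)
    refine (abs_nu_le (g := fun s => δ * (linSum t s ^ K * |diffOverlap x y l s|))
      fun s => ?_).trans ?_
    · rw [← sub_mul, abs_mul, ← mul_assoc]
      exact mul_le_mul_of_nonneg_right (hfg s) (abs_nonneg _)
    · rw [nu_const_mul, hB, mul_left_comm]
      exact mul_le_mul_of_nonneg_left ((hM H).2 x y l h1 h2) hδ
  have hs1 : |∑ l ∈ (I.erase x).erase y, cavCoef (β * √q) h x y u l *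
        nu N β h (fun s => f s * diffOverlap x y l s) -
      ∑ l ∈ (I.erase x).erase y, cavCoef (β * √q) h x y u l *
        nu N β h (fun s => g s * diffOverlap x y l s)| ≤ Fintype.card ι * (4 * B) := by
    rw [← Finset.sum_sub_distrib]
    refine (Finset.abs_sum_le_sum_abs _ _).trans ((Finset.sum_le_card_nsmul _ _ (4 * B)
      fun l hl => ?_).trans ?_)
    · simp only [Finset.mem_erase] at hl
      exact hone l hl.2.1 hl.1
    · rw [nsmul_eq_mul]
      gcongr
      exact_mod_cast Finset.card_le_univ _
  have hs2 : |(#I : ℝ) * (cavCoef (β * √q) h x y u a *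
      nu N β h (fun s => f s * diffOverlap x y a s)) - #I * (cavCoef (β * √q) h x y u a *
      nu N β h (fun s => g s * diffOverlap x y a s))| ≤ Fintype.card ι * (4 * B) := by
    rw [← mul_sub, abs_mul, Nat.abs_cast]
    exact mul_le_mul (by exact_mod_cast Finset.card_le_univ _)
      (hone a (fun h => ha (h ▸ hu.left_mem)) (fun h => ha (h ▸ hu.right_mem))) (abs_nonneg _)
      (Nat.cast_nonneg _)
  rw [overlapTerms, overlapTerms, ← mul_sub, abs_mul, abs_of_nonneg (sq_nonneg β)]
  have hb2 := H.sq_le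
  set A₁ := ∑ l ∈ (I.erase x).erase y, cavCoef (β * √q) h x y u l *
        nu N β h (fun s => f s * diffOverlap x y l s)
  set A₂ := ∑ l ∈ (I.erase x).erase y, cavCoef (β * √q) h x y u l *
        nu N β h (fun s => g s * diffOverlap x y l s)
  set B₁ := (#I : ℝ) * (cavCoef (β * √q) h x y u a *
      nu N β h (fun s => f s * diffOverlap x y a s))
  set B₂ := (#I : ℝ) * (cavCoef (β * √q) h x y u a *
      nu N β h (fun s => g s * diffOverlap x y a s))
  have h1 : |A₁ - B₁ - (A₂ - B₂)| ≤ 2 * (Fintype.card ι * (4 * B)) := by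
    rw [show A₁ - B₁ - (A₂ - B₂) = (A₁ - A₂) - (B₁ - B₂) by ring]
    exact (abs_sub _ _).trans (by linarith)
  calc _ ≤ 1 * |A₁ - B₁ - (A₂ - B₂)| := by gcongr; linarith
    _ ≤ 2 * (Fintype.card ι * (4 * B)) := by linarith
    _ = _ := by rw [hB]; ring

lemma exists_fresh {I : Finset ι} {a : ι} (hI : #I + 4 ≤ Fintype.card ι) :
    ∃ b c d : ι, b ∉ I ∧ a ≠ b ∧ c ∉ insert a (insert b I) ∧ d ∉ insert a (insert b I) ∧
      c ≠ d := by
  have key : ∀ J : Finset ι, #J < Fintype.card ι → ∃ b, b ∉ J := fun J hJ => by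
    by_contra! h
    exact hJ.ne (by rw [← Finset.card_univ]; congr 1; exact Finset.eq_univ_iff_forall.2 h)
  have h1 : #(insert a I) ≤ #I + 1 := Finset.card_insert_le _ _
  obtain ⟨b, hb⟩ := key (insert a I) (by omega)
  have h2 : #(insert b (insert a I)) ≤ #(insert a I) + 1 := Finset.card_insert_le _ _
  obtain ⟨c, hc⟩ := key (insert b (insert a I)) (by omega)
  have h3 : #(insert c (insert b (insert a I))) ≤ #(insert b (insert a I)) + 1 :=
    Finset.card_insert_le _ _
  obtain ⟨d, hd⟩ := key (insert c (insert b (insert a I))) (by omega)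
  simp only [Finset.mem_insert, not_or] at hb hc hd
  refine ⟨b, c, d, hb.2, Ne.symm hb.1, ?_, ?_, Ne.symm hd.1⟩ <;>
    simp only [Finset.mem_insert, not_or] <;> tauto

lemma abs_test_le {I : Finset ι} {x y : ι} {u : (ι → Bool) → ℝ} (hu : IsTest I x y u)
    (e : ι → Bool) : |spinDiff x y e * u e| ≤ 4 := by
  rw [abs_mul]
  nlinarith [abs_spinDiff_le x y e, hu.bound e, abs_nonneg (spinDiff x y e), abs_nonneg (u e)]

variable (ι ρ) in
lemma exists_site_expansion (hι : 4 ≤ Fintype.card ι) : ∃ C : ℝ, 0 ≤ C ∧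
    ∀ {N : ℕ} {β q h : ℝ} {t : Fin N → ℝ}, Setup N β q h t → ∀ {m : Fin N} {I : Finset ι}
    {a x y : ι}, a ∉ I → #I + 4 ≤ Fintype.card ι → ∀ {u : (ι → Bool) → ℝ}, IsTest I x y u →
    ∀ {c d : ρ → ι} {A : (ι → Cfg N) → ℝ}, IsStatProd I m c d A → ∀ k, k ≠ m →
    |nu N β h (fun s => spinDiff x y (fun l => s l k) * u (fun l => s l k) *
        statProd t c d A univ s) - overlapTerms N β q h I a x y u (statProd t c d A univ) -
      t k * ∑ r, linCoef (β * √q) h x y u (c r) (d r) *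
        nu N β h (statProd t c d A (univ.erase r))| ≤ C * (1 / N + t k ^ 2) := by
  set R := Fintype.card ρ with hR
  obtain ⟨C₀, hC₀, h₀⟩ := exists_nu_linSum_le ι hι (R + 2)
  obtain ⟨C₁, hC₁, h₁⟩ := exists_cavity_pair ι hι (R + 2)
  obtain ⟨C₂, hC₂, h₂⟩ := exists_abs_overlapTerms_sub_le ι hι (R + 2)
  obtain ⟨C₃, hC₃, h₃⟩ := exists_cavity_first_order ι hι (R + 2)
  refine ⟨4 * (R ^ 2 * C₀) + C₁ + C₂ * R + R * (C₃ + 8 * (R * C₀)), by positivity,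
    fun {N β q h t} H m I a x y ha hI u hu c d A hA k hk => ?_⟩
  obtain ⟨b, c', d', hb, hab, hc', hd', hcd'⟩ := exists_fresh hI
  set t' := Function.update t k 0 with ht'
  have ht0 : t' k = 0 := by simp [ht']
  have hN := H.one_le_N
  set w : (ι → Bool) → ℝ := fun e => spinDiff x y e * u e with hw
  have e1 : |nu N β h (fun s => w (fun l => s l k) * statProd t c d A univ s) -
      nu N β h (fun s => w (fun l => s l k) * statProd t' c d A univ s) -
      t k * ∑ r, nu N β h (fun s => (w (fun l => s l k) * spinDiff (c r) (d r) (fun l => s l k)) *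
        statProd t' c d A (univ.erase r) s)| ≤ 4 * (R ^ 2 * C₀) * t k ^ 2 := by
    rw [← nu_sub, ← nu_sum, ← nu_const_mul, ← nu_sub]
    refine (abs_nu_le (g := fun s => 4 * (t k ^ 2 * R ^ 2) * linSum t s ^ (R + 2))
      fun s => ?_).trans ?_
    · have h4 := H.abs_statProd_expand_le hA.bound k c d s
      have h5 : ∑ r, w (fun l => s l k) * spinDiff (c r) (d r) (fun l => s l k) *
          statProd t' c d A (univ.erase r) s = w (fun l => s l k) * ∑ r,
          spinDiff (c r) (d r) (fun l => s l k) * statProd t' c d A (univ.erase r) s := by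
        rw [Finset.mul_sum]
        exact Finset.sum_congr rfl fun _ _ => by ring
      rw [h5, mul_left_comm, ← mul_sub, ← mul_sub, abs_mul]
      refine (mul_le_mul (abs_test_le hu _) h4 (abs_nonneg _) (by norm_num)).trans (le_of_eq ?_)
      ring
    · rw [nu_const_mul]
      calc _ ≤ 4 * (t k ^ 2 * R ^ 2) * C₀ := by
            gcongr
            exact (h₀ H).1
        _ = _ := by ring
  have e2 := h₁ H k ha hb hab hc' hd' hcd' hu.left_mem hu.right_mem hu.ne hu.bound hu.dep hu.swap
    (siteFree_statProd (hA.free k hk) ht0 c d univ) (hA.dependsOn t' univ)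
    (H.abs_statProd_update_le hA.bound k c d univ)
  have e3 : |overlapTerms N β q h I a x y u (statProd t c d A univ) -
      overlapTerms N β q h I a x y u (statProd t' c d A univ)| ≤ C₂ * R * (1 / N + t k ^ 2) := by
    refine (h₂ H ha hu (δ := |t k| * R) (by positivity) fun s => ?_).trans ?_
    · rw [mul_assoc]
      exact H.abs_statProd_sub_le hA.bound k c d univ s
    · calc _ = C₂ * R * (|t k| * (1 / √N)) := by ring
        _ ≤ _ := by
          gcongr
          exact abs_mul_one_div_sqrt_le _ _
  have e4 : ∀ r, |nu N β h (fun s => (w (fun l => s l k) * spinDiff (c r) (d r) (fun l => s l k)) *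
        statProd t' c d A (univ.erase r) s) - linCoef (β * √q) h x y u (c r) (d r) *
        nu N β h (statProd t c d A (univ.erase r))| ≤ C₃ * (1 / √N) + 8 * (R * C₀) * |t k| :=
    fun r => by
      have hp : ∀ e, |w e * spinDiff (c r) (d r) e| ≤ 8 := fun e => by
        rw [abs_mul]
        have h4 := abs_test_le hu e
        have h5 := abs_spinDiff_le (c r) (d r) e
        nlinarith [abs_nonneg (w e), abs_nonneg (spinDiff (c r) (d r) e)]
      have hdep : DependsOn (fun e => w e * spinDiff (c r) (d r) e) (I : Set ι) :=
        (DependsOn.mul_fun (fun e e' he => by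
          simp only [spinDiff, he _ hu.left_mem, he _ hu.right_mem]) hu.dep).mul_fun
          fun e e' he => by simp only [spinDiff, he _ (hA.left_mem r), he _ (hA.right_mem r)]
      have h4 := h₃ H k ha hb hab hp hdep
        (siteFree_statProd (hA.free k hk) ht0 c d (univ.erase r)) (hA.dependsOn t' (univ.erase r))
        (H.abs_statProd_update_le hA.bound k c d (univ.erase r))
      have h5 : |nu N β h (statProd t c d A (univ.erase r)) -
          nu N β h (statProd t' c d A (univ.erase r))| ≤ R * C₀ * |t k| := by
        rw [← nu_sub]
        refine (abs_nu_le (g := fun s => |t k| * R * linSum t s ^ (R + 2)) fun s => ?_).trans ?_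
        · rw [mul_assoc]
          exact H.abs_statProd_sub_le hA.bound k c d _ s
        · rw [nu_const_mul]
          calc _ ≤ |t k| * R * C₀ := by
                gcongr
                exact (h₀ H).1
            _ = _ := by ring
      have h6 : |linCoef (β * √q) h x y u (c r) (d r)| ≤ 8 := abs_siteAvg_le hp
      change |_ - linCoef (β * √q) h x y u (c r) (d r) * _| ≤ _ at h4
      rw [div_eq_mul_one_div] at h4
      set g := linCoef (β * √q) h x y u (c r) (d r)
      have h7 : |g * nu N β h (statProd t c d A (univ.erase r)) -
          g * nu N β h (statProd t' c d A (univ.erase r))| ≤ 8 * (R * C₀ * |t k|) := by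
        rw [← mul_sub, abs_mul]
        exact mul_le_mul h6 h5 (abs_nonneg _) (by norm_num)
      rw [abs_le] at h4 h7 ⊢
      constructor <;> linarith [h4.1, h4.2, h7.1, h7.2]
  have e5 : |t k * ∑ r, nu N β h (fun s => (w (fun l => s l k) * spinDiff (c r) (d r)
        (fun l => s l k)) * statProd t' c d A (univ.erase r) s) -
      t k * ∑ r, linCoef (β * √q) h x y u (c r) (d r) *
        nu N β h (statProd t c d A (univ.erase r))| ≤
      R * (C₃ + 8 * (R * C₀)) * (1 / N + t k ^ 2) := by
    rw [← mul_sub, ← Finset.sum_sub_distrib, abs_mul]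
    have h4 := abs_mul_one_div_sqrt_le N (t k)
    have h5 : 0 ≤ 1 / (N : ℝ) := by positivity
    have h6 : |t k| * |t k| = t k ^ 2 := by rw [← sq, sq_abs]
    calc _ ≤ |t k| * (R * (C₃ * (1 / √N) + 8 * (R * C₀) * |t k|)) := by
          gcongr
          refine (Finset.abs_sum_le_sum_abs _ _).trans ((Finset.sum_le_card_nsmul _ _ _
            fun r _ => e4 r).trans (le_of_eq ?_))
          rw [nsmul_eq_mul, Finset.card_univ]
      _ = R * (C₃ * (|t k| * (1 / √N)) + 8 * (R * C₀) * (|t k| * |t k|)) := by ring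
      _ ≤ R * (C₃ * (1 / N + t k ^ 2) + 8 * (R * C₀) * (1 / N + t k ^ 2)) := by
          rw [h6]
          gcongr
          linarith
      _ = _ := by ring
  have h7 : 4 * (R ^ 2 * C₀) * t k ^ 2 ≤ 4 * (R ^ 2 * C₀) * (1 / N + t k ^ 2) := by
    gcongr
    have : 0 ≤ 1 / (N : ℝ) := by positivity
    linarith
  have h8 : C₁ / N ≤ C₁ * (1 / N + t k ^ 2) := by
    rw [div_eq_mul_one_div]
    gcongr
    nlinarith
  change |nu N β h (fun s => w (fun l => s l k) * statProd t' c d A univ s) -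
    overlapTerms N β q h I a x y u (statProd t' c d A univ)| ≤ _ at e2
  change |nu N β h (fun s => w (fun l => s l k) * statProd t c d A univ s) - _ - _| ≤ _
  rw [abs_le] at e1 e2 e3 e5 ⊢
  constructor <;> linarith [e1.1, e1.2, e2.1, e2.2, e3.1, e3.2, e5.1, e5.2]

end Site

section Mean

variable {ι : Type} [Fintype ι] [DecidableEq ι] {ρ : Type} [Fintype ρ] [DecidableEq ρ]
  {N : ℕ} {β q h : ℝ} {t : Fin N → ℝ}

lemma overlapTerms_zero (I : Finset ι) (a x y : ι) (u : (ι → Bool) → ℝ) :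
    overlapTerms N β q h I a x y u (fun _ => 0) = 0 := by
  simp [overlapTerms, nu_const]

variable (ι ρ) in
lemma exists_mean_expansion (hι : 4 ≤ Fintype.card ι) : ∃ C : ℝ, 0 ≤ C ∧
    ∀ {N : ℕ} {β q h : ℝ} {t : Fin N → ℝ}, Setup N β q h t → ∀ {m : Fin N}, t m = 0 →
    ∀ {I : Finset ι} {a x y : ι}, a ∉ I → #I + 4 ≤ Fintype.card ι →
    ∀ {u : (ι → Bool) → ℝ}, IsTest I x y u →
    ∀ {c d : ρ → ι} {A : (ι → Cfg N) → ℝ}, IsStatProd I m c d A →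
    |nu N β h (fun s => statProd t c d A univ s *
        ((∑ k, spinDiff x y (fun l => s l k) * u (fun l => s l k)) / N)) -
      overlapTerms N β q h I a x y u (statProd t c d A univ) -
      (∑ k, t k) / N * ∑ r, linCoef (β * √q) h x y u (c r) (d r) *
        nu N β h (statProd t c d A (univ.erase r))| ≤ C * (1 / N) := by
  obtain ⟨C, hC, hM⟩ := exists_site_expansion ι ρ hι
  obtain ⟨C₀, hC₀, h₀⟩ := exists_nu_linSum_le ι hι (Fintype.card ρ + 2)
  obtain ⟨C₁, hC₁, h₁⟩ := exists_abs_overlapTerms_sub_le ι hι (Fintype.card ρ + 2)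
  refine ⟨2 * C + (4 * C₀ + C₁), by positivity,
    fun {N β q h t} H m hm I a x y ha hI u hu c d A hA => ?_⟩
  have hN := H.one_le_N
  set F := statProd t c d A univ with hF
  set O := overlapTerms N β q h I a x y u F with hO
  set L := ∑ r, linCoef (β * √q) h x y u (c r) (d r) * nu N β h (statProd t c d A (univ.erase r))
  set Y : Fin N → ℝ := fun k =>
    nu N β h (fun s => spinDiff x y (fun l => s l k) * u (fun l => s l k) * F s) - O - t k * L
    with hY
  have hFb : ∀ s, |F s| ≤ linSum t s ^ (Fintype.card ρ + 2) := abs_statProd_le hA.bound t c d univ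
  have hm' : |Y m| ≤ 4 * C₀ + C₁ := by
    have h2 : |nu N β h (fun s => spinDiff x y (fun l => s l m) * u (fun l => s l m) * F s)| ≤
        4 * C₀ := by
      refine (abs_nu_le (g := fun s => 4 * linSum t s ^ (Fintype.card ρ + 2)) fun s => ?_).trans ?_
      · rw [abs_mul]
        exact mul_le_mul (abs_test_le hu _) (hFb s) (abs_nonneg _) (by norm_num)
      · rw [nu_const_mul]
        exact mul_le_mul_of_nonneg_left (h₀ H).1 (by norm_num)
    have h3 : |O| ≤ C₁ := by
      have h4 := h₁ H ha hu (f := F) (g := fun _ => 0) zero_le_one (fun s => by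
        rw [sub_zero, one_mul]; exact hFb s)
      rw [overlapTerms_zero, sub_zero, one_mul] at h4
      refine h4.trans (mul_le_of_le_one_right hC₁ ?_)
      rw [div_le_one (by positivity), Real.one_le_sqrt]
      exact hN
    simp only [hY, hm, zero_mul, sub_zero]
    exact (abs_sub _ _).trans (add_le_add h2 h3)
  have hk : ∀ k ∈ univ.erase m, |Y k| ≤ C * (1 / N + t k ^ 2) := fun k hk =>
    hM H ha hI hu hA k (Finset.ne_of_mem_erase hk)
  have hsum : |∑ k, Y k| ≤ 2 * C + (4 * C₀ + C₁) := by
    refine (Finset.abs_sum_le_sum_abs _ _).trans ?_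
    rw [← Finset.sum_erase_add _ _ (Finset.mem_univ m)]
    refine add_le_add ((Finset.sum_le_sum hk).trans ?_) hm'
    refine (Finset.sum_le_sum_of_subset_of_nonneg (Finset.subset_univ _)
      fun k _ _ => by positivity).trans ?_
    rw [← Finset.mul_sum, Finset.sum_add_distrib, Finset.sum_const, Finset.card_univ,
      Fintype.card_fin, nsmul_eq_mul, mul_one_div_cancel (by positivity), mul_comm]
    nlinarith [H.sum_sq]
  have heq : nu N β h (fun s => F s *
      ((∑ k, spinDiff x y (fun l => s l k) * u (fun l => s l k)) / N)) - O -
      (∑ k, t k) / N * L = (∑ k, Y k) * (1 / N) := by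
    simp only [hY]
    rw [Finset.sum_sub_distrib, Finset.sum_sub_distrib, ← nu_sum, ← Finset.sum_mul,
      Finset.sum_const, Finset.card_univ, Fintype.card_fin, nsmul_eq_mul]
    have h5 : nu N β h (fun s => F s *
        ((∑ k, spinDiff x y (fun l => s l k) * u (fun l => s l k)) / N)) =
        1 / N * nu N β h
          (fun s => ∑ k, spinDiff x y (fun l => s l k) * u (fun l => s l k) * F s) := by
      rw [← nu_const_mul]
      congr 1
      ext s
      rw [← Finset.sum_mul]
      ring
    rw [h5]
    field_simp
  rw [heq, abs_mul, abs_of_nonneg (by positivity : (0 : ℝ) ≤ 1 / N)]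
  exact mul_le_mul_of_nonneg_right hsum (by positivity)

/-- Each pair of replicas of the product is either `(x, y)` or disjoint from it. -/
def Separates (x y : ι) (c d : ρ → ι) : Prop :=
  ∀ r, (c r = x ∧ d r = y) ∨ (c r ≠ x ∧ c r ≠ y ∧ d r ≠ x ∧ d r ≠ y)

lemma linCoef_eq_zero {v : ℝ} {x y z w : ι} {u : (ι → Bool) → ℝ}
    (hu : ∀ e, u (fun l => e (Equiv.swap x y l)) = u e) (h1 : z ≠ x) (h2 : z ≠ y) (h3 : w ≠ x)
    (h4 : w ≠ y) : linCoef v h x y u z w = 0 :=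
  siteAvg_eq_zero x y fun e => by
    simp only [spinDiff, hu, Equiv.swap_apply_of_ne_of_ne h1 h2, Equiv.swap_apply_of_ne_of_ne h3 h4,
      Equiv.swap_apply_left, Equiv.swap_apply_right]
    ring

variable (ι ρ) in
lemma exists_diffOverlap_sub_le (hι : 4 ≤ Fintype.card ι) : ∃ C : ℝ, 0 ≤ C ∧
    ∀ {N : ℕ} {β q h : ℝ} {t : Fin N → ℝ}, Setup N β q h t → ∀ {m : Fin N}, t m = 0 →
    ∀ {I : Finset ι} {x y : ι}, x ∈ I → y ∈ I → x ≠ y → #I + 4 ≤ Fintype.card ι →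
    ∀ {c d : ρ → ι} {A : (ι → Cfg N) → ℝ}, IsStatProd I m c d A → Separates x y c d →
    ∀ z ∈ (I.erase x).erase y, ∀ w ∈ (I.erase x).erase y,
    |nu N β h (fun s => statProd t c d A univ s * diffOverlap x y z s) -
      nu N β h (fun s => statProd t c d A univ s * diffOverlap x y w s)| ≤ C * (1 / N) := by
  obtain ⟨C, hC, hM⟩ := exists_mean_expansion ι ρ hι
  refine ⟨2 * C, by positivity,
    fun {N β q h t} H m hm I x y hx hy hxy hI c d A hA hsep z hz w hw => ?_⟩
  have hN := H.one_le_N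
  by_cases hzw : z = w
  · subst hzw
    rw [sub_self, abs_zero]
    positivity
  obtain ⟨a, ha⟩ : ∃ a, a ∉ I := by
    by_contra! h
    have : #I = Fintype.card ι := by
      rw [← Finset.card_univ]; congr 1; exact Finset.eq_univ_iff_forall.2 h
    omega
  have hz' := Finset.mem_erase.1 hz
  have hw' := Finset.mem_erase.1 hw
  have hzx := Finset.ne_of_mem_erase hz'.2
  have hwx := Finset.ne_of_mem_erase hw'.2
  have hzI := Finset.mem_of_mem_erase hz'.2
  have hwI := Finset.mem_of_mem_erase hw'.2
  set u : (ι → Bool) → ℝ := fun e => spinDiff z w e with hu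
  have htest : IsTest I x y u := ⟨hx, hy, hxy, abs_spinDiff_le z w,
    fun e e' he => by simp only [hu, spinDiff, he z hzI, he w hwI], fun e => by
      simp only [hu, spinDiff, Equiv.swap_apply_of_ne_of_ne hzx hz'.1,
        Equiv.swap_apply_of_ne_of_ne hwx hw'.1]⟩
  have hmain := hM H hm ha hI htest hA
  have hcoef : ∀ l, l ≠ z → l ≠ w → cavCoef (β * √q) h x y u l = 0 := fun l h1 h2 =>
    siteAvg_eq_zero z w fun e => by
      simp only [hu, spinDiff, Equiv.swap_apply_of_ne_of_ne h1 h2, Equiv.swap_apply_left,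
        Equiv.swap_apply_right, Equiv.swap_apply_of_ne_of_ne hzx.symm hwx.symm,
        Equiv.swap_apply_of_ne_of_ne hz'.1.symm hw'.1.symm]
      ring
  have hcw : cavCoef (β * √q) h x y u w = -cavCoef (β * √q) h x y u z := by
    rw [← neg_one_mul, cavCoef, cavCoef, siteAvg, siteAvg, ← avg_const_mul]
    congr 1
    ext e
    simp only [hu]
    have h1 := spin_mul_self (e z)
    have h2 := spin_mul_self (e w)
    simp only [spinDiff]
    linear_combination (spin (e x) - spin (e y)) * spin (e x) * (h1 - h2)
  have hlin : ∀ r, linCoef (β * √q) h x y u (c r) (d r) = 0 := fun r => by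
    rcases hsep r with ⟨h1, h2⟩ | ⟨h1, h2, h3, h4⟩
    · rw [h1, h2]
      refine siteAvg_eq_zero z w fun e => ?_
      simp only [hu, spinDiff, Equiv.swap_apply_left, Equiv.swap_apply_right,
        Equiv.swap_apply_of_ne_of_ne hzx.symm hwx.symm,
        Equiv.swap_apply_of_ne_of_ne hz'.1.symm hw'.1.symm]
      ring
    · exact linCoef_eq_zero htest.swap h1 h2 h3 h4
  set F := statProd t c d A univ with hF
  set κ := cavCoef (β * √q) h x y u z with hκ
  have hκ4 : |κ| ≤ 4 := abs_cavCoef_le htest.bound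
  have ho : overlapTerms N β q h I a x y u F = β ^ 2 * (κ *
      (nu N β h (fun s => F s * diffOverlap x y z s) -
        nu N β h (fun s => F s * diffOverlap x y w s))) := by
    rw [overlapTerms, hcoef a (fun h => ha (h ▸ hzI)) (fun h => ha (h ▸ hwI)),
      ← Finset.add_sum_erase _ _ hz,
      ← Finset.add_sum_erase _ _ (Finset.mem_erase.2 ⟨Ne.symm hzw, hw⟩),
      Finset.sum_eq_zero fun l hl => ?_, hcw]
    · ring
    · simp only [Finset.mem_erase] at hl
      rw [hcoef l hl.2.1 hl.1, zero_mul]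
  have hmean : nu N β h (fun s => F s *
      ((∑ k, spinDiff x y (fun l => s l k) * u (fun l => s l k)) / N)) =
      nu N β h (fun s => F s * diffOverlap x y z s) -
        nu N β h (fun s => F s * diffOverlap x y w s) := by
    rw [← nu_sub]
    congr 1
    ext s
    rw [← mul_sub, diffOverlap, diffOverlap, ← sub_div, ← Finset.sum_sub_distrib]
    congr 2
    refine Finset.sum_congr rfl fun k _ => ?_
    simp only [hu, spinDiff]
    ring
  rw [hmean, ho, Finset.sum_eq_zero (s := (univ : Finset ρ)) fun r _ => by rw [hlin r, zero_mul],
    mul_zero, sub_zero] at hmain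
  set D := nu N β h (fun s => F s * diffOverlap x y z s) -
        nu N β h (fun s => F s * diffOverlap x y w s)
  have hb2 := H.sq_le
  have h9 : |β ^ 2 * (κ * D)| ≤ 1 / 256 * (4 * |D|) := by
    rw [abs_mul, abs_mul, abs_of_nonneg (sq_nonneg β)]
    gcongr
  have h10 := abs_sub_abs_le_abs_sub D (β ^ 2 * (κ * D))
  have := abs_nonneg D
  linarith

end Mean

section Ratio

variable {ι : Type} [Fintype ι] [DecidableEq ι] {ρ : Type} [Fintype ρ] [DecidableEq ρ]
  {N : ℕ} {β q h v : ℝ} {t : Fin N → ℝ}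

lemma Setup.abs_overlapTerms_sub_le (H : Setup N β q h t) {I : Finset ι} {a x y : ι}
    {u : (ι → Bool) → ℝ} (hu : ∀ e, |u e| ≤ 2) {f : (ι → Cfg N) → ℝ} {Z E : ℝ}
    (hl : ∀ l ∈ (I.erase x).erase y, |nu N β h (fun s => f s * diffOverlap x y l s) - Z| ≤ E)
    (ha : |nu N β h (fun s => f s * diffOverlap x y a s) - Z| ≤ E) :
    |overlapTerms N β q h I a x y u f - β ^ 2 *
      ((∑ l ∈ (I.erase x).erase y, cavCoef (β * √q) h x y u l -
        #I * cavCoef (β * √q) h x y u a) * Z)| ≤ 8 * Fintype.card ι * E := by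
  have hE : 0 ≤ E := (abs_nonneg _).trans ha
  have hs1 : |∑ l ∈ (I.erase x).erase y, cavCoef (β * √q) h x y u l *
        nu N β h (fun s => f s * diffOverlap x y l s) -
      (∑ l ∈ (I.erase x).erase y, cavCoef (β * √q) h x y u l) * Z| ≤ Fintype.card ι * (4 * E) := by
    rw [Finset.sum_mul, ← Finset.sum_sub_distrib]
    refine (Finset.abs_sum_le_sum_abs _ _).trans ((Finset.sum_le_card_nsmul _ _ (4 * E)
      fun l h1 => ?_).trans ?_)
    · rw [← mul_sub, abs_mul]
      exact mul_le_mul (abs_cavCoef_le hu) (hl l h1) (abs_nonneg _) (by norm_num)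
    · rw [nsmul_eq_mul]
      gcongr
      exact_mod_cast Finset.card_le_univ _
  have hs2 : |(#I : ℝ) * (cavCoef (β * √q) h x y u a *
      nu N β h (fun s => f s * diffOverlap x y a s)) - #I * cavCoef (β * √q) h x y u a * Z| ≤
      Fintype.card ι * (4 * E) := by
    rw [mul_assoc, ← mul_sub, ← mul_sub, abs_mul, abs_mul, Nat.abs_cast]
    exact mul_le_mul (by exact_mod_cast Finset.card_le_univ _)
      (mul_le_mul (abs_cavCoef_le hu) ha (abs_nonneg _) (by norm_num)) (by positivity)
      (Nat.cast_nonneg _)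
  rw [overlapTerms, ← mul_sub, abs_mul, abs_of_nonneg (sq_nonneg β), sub_mul]
  have hb2 := H.sq_le
  set A₁ := ∑ l ∈ (I.erase x).erase y, cavCoef (β * √q) h x y u l *
        nu N β h (fun s => f s * diffOverlap x y l s)
  set A₂ := (∑ l ∈ (I.erase x).erase y, cavCoef (β * √q) h x y u l) * Z
  set B₁ := (#I : ℝ) * (cavCoef (β * √q) h x y u a *
      nu N β h (fun s => f s * diffOverlap x y a s))
  set B₂ := #I * cavCoef (β * √q) h x y u a * Z
  have h1 : |A₁ - B₁ - (A₂ - B₂)| ≤ 2 * (Fintype.card ι * (4 * E)) := by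
    rw [show A₁ - B₁ - (A₂ - B₂) = (A₁ - A₂) - (B₁ - B₂) by ring]
    exact (abs_sub _ _).trans (by linarith)
  calc _ ≤ 1 * |A₁ - B₁ - (A₂ - B₂)| := by gcongr; linarith
    _ ≤ 2 * (Fintype.card ι * (4 * E)) := by linarith
    _ = _ := by ring

/-- The coefficient obtained by solving the linear system given by the cavity expansions. -/
def cavRatio (β v h : ℝ) (x y z a : ι) : ℝ :=
  -2 * β ^ 2 * cavCoef v h x y (fun _ => 1) a * (linCoef v h x y (fun e => spin (e z)) x y /
    (1 - β ^ 2 * (cavCoef v h x y (fun e => spin (e z)) z -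
      3 * cavCoef v h x y (fun e => spin (e z)) a)))

lemma card_erase_erase {I : Finset ι} {x y : ι} (hx : x ∈ I) (hy : y ∈ I) (hxy : x ≠ y) :
    (#((I.erase x).erase y) : ℝ) = #I - 2 := by
  have h1 := Finset.card_erase_add_one hx
  have h2 := Finset.card_erase_add_one (Finset.mem_erase.2 ⟨hxy.symm, hy⟩)
  rw [← h1, ← h2]
  push_cast
  ring

lemma cavCoef_eq_of_swap {x y l l' : ι} {u : (ι → Bool) → ℝ} (hx : x ≠ l) (hy : y ≠ l)
    (hx' : x ≠ l') (hy' : y ≠ l') (hu : ∀ e, u (fun i => e (Equiv.swap l l' i)) = u e) :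
    cavCoef v h x y u l = cavCoef v h x y u l' := by
  rw [cavCoef, cavCoef, ← siteAvg_perm (Equiv.swap l l')]
  congr 1
  ext e
  simp only [spinDiff, hu, Equiv.swap_apply_of_ne_of_ne hx hx', Equiv.swap_apply_of_ne_of_ne hy hy',
    Equiv.swap_apply_left]

variable (ι ρ) in
lemma exists_nu_spinDiff_mul (hι : 4 ≤ Fintype.card ι) : ∃ C : ℝ, 0 ≤ C ∧
    ∀ {N : ℕ} {β q h : ℝ} {t : Fin N → ℝ}, Setup N β q h t → ∀ {m k : Fin N}, t m = 0 → t k = 0 →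
    k ≠ m → ∀ {I : Finset ι} {x y z a : ι}, x ∈ I → y ∈ I → z ∈ I → a ∉ I → x ≠ y → z ≠ x →
    z ≠ y → #I + 5 ≤ Fintype.card ι →
    ∀ {c d : ρ → ι} {A : (ι → Cfg N) → ℝ}, IsStatProd I m c d A → Separates x y c d →
    |nu N β h (fun s => spinDiff x y (fun l => s l k) * statProd t c d A univ s) -
      cavRatio β (β * √q) h x y z a * ((∑ j, t j) / N *
        ∑ r, if c r = x then nu N β h (statProd t c d A (univ.erase r)) else 0)| ≤
      C * (1 / N) := by
  obtain ⟨C₁, hC₁, h₁⟩ := exists_diffOverlap_sub_le ι ρ hι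
  obtain ⟨C₂, hC₂, h₂⟩ := exists_mean_expansion ι ρ hι
  obtain ⟨C₃, hC₃, h₃⟩ := exists_site_expansion ι ρ hι
  refine ⟨C₃ + 8 * Fintype.card ι * C₁ + 2 * (C₂ + 8 * Fintype.card ι * C₁), by positivity,
    fun {N β q h t} H m k hm hk hkm I x y z a hx hy hz ha hxy hzx hzy hI c d A hA hsep => ?_⟩
  have hN := H.one_le_N
  have hax : a ≠ x := fun h => ha (h ▸ hx)
  have hay : a ≠ y := fun h => ha (h ▸ hy)
  have haz : a ≠ z := fun h => ha (h ▸ hz)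
  set F := statProd t c d A univ with hF
  set Z := nu N β h (fun s => F s * diffOverlap x y z s) with hZ
  set P := ∑ r, if c r = x then nu N β h (statProd t c d A (univ.erase r)) else 0 with hP
  have hII : I ⊆ insert a I := Finset.subset_insert _ _
  have hI4 : #(insert a I) + 4 ≤ Fintype.card ι := by
    rw [Finset.card_insert_of_notMem ha]; omega
  have hA' : IsStatProd (insert a I) m c d A := ⟨hA.bound, hA.free, DependsOn.of_subset hA.dep hII,
    fun r => hII (hA.left_mem r), fun r => hII (hA.right_mem r)⟩
  have hclose : ∀ l ∈ ((insert a I).erase x).erase y,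
      |nu N β h (fun s => F s * diffOverlap x y l s) - Z| ≤ C₁ * (1 / N) := fun l hl =>
    h₁ H hm (hII hx) (hII hy) hxy hI4 hA' hsep l hl z (by simp [hzx, hzy, hz])
  have hcl1 : ∀ l ∈ (I.erase x).erase y,
      |nu N β h (fun s => F s * diffOverlap x y l s) - Z| ≤ C₁ * (1 / N) := fun l hl =>
    hclose l (Finset.erase_subset_erase _ (Finset.erase_subset_erase _ hII) hl)
  have hcl2 := hclose a (by simp [hax, hay])
  have htest1 : IsTest I x y (fun _ => 1) := ⟨hx, hy, hxy, fun e => by norm_num,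
    fun _ _ _ => rfl, fun _ => rfl⟩
  have htest2 : IsTest I x y (fun e => spin (e z)) := ⟨hx, hy, hxy, fun e => by
    rw [abs_spin]; norm_num, fun e e' he => by simp only [he z hz], fun e => by
    simp only [Equiv.swap_apply_of_ne_of_ne hzx hzy]⟩
  have hJ := card_erase_erase hx hy hxy
  -- the mean over sites of the overlap with `z`
  have e1 := h₂ H hm ha (by omega) htest2 hA
  have o1 := H.abs_overlapTerms_sub_le htest2.bound hcl1 hcl2
  set κ' := cavCoef (β * √q) h x y (fun e => spin (e z)) z with hκ'
  set κ := cavCoef (β * √q) h x y (fun e => spin (e z)) a with hκ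
  set μ := linCoef (β * √q) h x y (fun e => spin (e z)) x y with hμ
  have hs1 : ∑ l ∈ (I.erase x).erase y, cavCoef (β * √q) h x y (fun e => spin (e z)) l - #I * κ =
      κ' - 3 * κ := by
    have hzJ : z ∈ (I.erase x).erase y := by simp [hzx, hzy, hz]
    rw [← Finset.add_sum_erase _ _ hzJ, Finset.sum_congr rfl fun l hl =>
      show _ = κ from ?_, Finset.sum_const, nsmul_eq_mul]
    · have h4 : (#(((I.erase x).erase y).erase z) : ℝ) = #I - 2 - 1 := by
        rw [← hJ, ← Finset.card_erase_add_one hzJ]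
        push_cast
        ring
      rw [h4]
      ring
    · simp only [Finset.mem_erase] at hl
      exact cavCoef_eq_of_swap (Ne.symm hl.2.2.1) (Ne.symm hl.2.1) hax.symm hay.symm fun e => by
        simp only [Equiv.swap_apply_of_ne_of_ne (Ne.symm hl.1) haz.symm]
  have hs2 : ∑ r, linCoef (β * √q) h x y (fun e => spin (e z)) (c r) (d r) *
      nu N β h (statProd t c d A (univ.erase r)) = μ * P := by
    rw [hP, Finset.mul_sum]
    refine Finset.sum_congr rfl fun r _ => ?_
    rcases hsep r with ⟨h4, h5⟩ | ⟨h4, h5, h6, h7⟩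
    · rw [if_pos h4, h4, h5]
    · rw [if_neg h4, linCoef_eq_zero htest2.swap h4 h5 h6 h7, zero_mul, mul_zero]
  rw [hs2] at e1
  rw [hs1] at o1
  change |Z - _ - _| ≤ _ at e1
  -- the cavity expansion at the site `k`
  have e2 := h₃ H ha (by omega) htest1 hA k hkm
  have o2 := H.abs_overlapTerms_sub_le htest1.bound hcl1 hcl2
  set κ'' := cavCoef (β * √q) h x y (fun _ => 1) a with hκ''
  have hs3 : ∑ l ∈ (I.erase x).erase y, cavCoef (β * √q) h x y (fun _ => 1) l - #I * κ'' =
      -2 * κ'' := by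
    rw [Finset.sum_congr rfl fun l hl => show _ = κ'' from ?_, Finset.sum_const, nsmul_eq_mul, hJ]
    · ring
    · simp only [Finset.mem_erase] at hl
      exact cavCoef_eq_of_swap (Ne.symm hl.2.1) (Ne.symm hl.1) hax.symm hay.symm fun e => rfl
  rw [hk, zero_mul, sub_zero, zero_pow two_ne_zero, add_zero] at e2
  simp only [mul_one] at e2
  rw [hs3] at o2
  have k1 : |κ''| ≤ 4 := abs_cavCoef_le htest1.bound
  have k2 : |κ| ≤ 4 := abs_cavCoef_le htest2.bound
  have k3 : |κ'| ≤ 4 := abs_cavCoef_le htest2.bound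
  have hb2 := H.sq_le
  have hb0 := sq_nonneg β
  set D := 1 - β ^ 2 * (κ' - 3 * κ) with hD
  have hD2 : 1 / 2 ≤ D := by
    rw [abs_le] at k2 k3
    nlinarith
  set τ := (∑ j, t j) / N
  set B := C₂ + 8 * Fintype.card ι * C₁
  have e3 : |Z - τ * (μ * P) / D| ≤ 2 * B * (1 / N) := by
    have h5 : |D * Z - τ * (μ * P)| ≤ B * (1 / N) := by
      rw [abs_le] at e1 o1 ⊢
      constructor <;> linarith [e1.1, e1.2, o1.1, o1.2]
    have h6 : Z - τ * (μ * P) / D = (D * Z - τ * (μ * P)) / D := by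
      have : D ≠ 0 := by linarith
      field_simp
    rw [h6, abs_div, abs_of_pos (by linarith : 0 < D), div_le_iff₀ (by linarith)]
    have := (abs_nonneg _).trans h5
    nlinarith
  have e4 : |β ^ 2 * (-2 * κ'' * Z) - β ^ 2 * (-2 * κ'' * (τ * (μ * P) / D))| ≤
      2 * B * (1 / N) := by
    rw [show β ^ 2 * (-2 * κ'' * Z) - β ^ 2 * (-2 * κ'' * (τ * (μ * P) / D)) =
      β ^ 2 * (-2 * κ'') * (Z - τ * (μ * P) / D) by ring, abs_mul]
    have h5 : |β ^ 2 * (-2 * κ'')| ≤ 1 := by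
      rw [abs_mul, abs_mul, abs_of_nonneg hb0]
      norm_num
      nlinarith [abs_nonneg κ'']
    refine (mul_le_mul_of_nonneg_right h5 (abs_nonneg _)).trans ?_
    rwa [one_mul]
  have e5 : cavRatio β (β * √q) h x y z a * (τ * P) =
      β ^ 2 * (-2 * κ'' * (τ * (μ * P) / D)) := by
    simp only [cavRatio, ← hκ, ← hκ', ← hμ, ← hκ'', ← hD]
    ring
  rw [e5]
  rw [abs_le] at e2 o2 e4 ⊢
  constructor <;> linarith [e2.1, e2.2, o2.1, o2.2, e4.1, e4.2]

lemma cavRatio_eq {x y x' y' z a : ι} (hxy : x ≠ y')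
    (hxy' : x' ≠ y') (hxy'' : x ≠ y)
    (hzx : z ≠ x) (hzx' : z ≠ x') (hzy : z ≠ y) (hzy' : z ≠ y') (hax : a ≠ x) (hax' : a ≠ x')
    (hay : a ≠ y) (hay' : a ≠ y') : cavRatio β v h x y z a = cavRatio β v h x' y' z a := by
  set π : Equiv.Perm ι := Equiv.swap x x' * Equiv.swap y y' with hπ
  have p1 : π x = x' := by
    rw [hπ, Equiv.Perm.mul_apply, Equiv.swap_apply_of_ne_of_ne hxy'' hxy, Equiv.swap_apply_left]
  have p2 : π y = y' := by
    rw [hπ, Equiv.Perm.mul_apply, Equiv.swap_apply_left, Equiv.swap_apply_of_ne_of_ne hxy.symm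
      hxy'.symm]
  have p3 : π z = z := by
    rw [hπ, Equiv.Perm.mul_apply, Equiv.swap_apply_of_ne_of_ne hzy hzy',
      Equiv.swap_apply_of_ne_of_ne hzx hzx']
  have p4 : π a = a := by
    rw [hπ, Equiv.Perm.mul_apply, Equiv.swap_apply_of_ne_of_ne hay hay',
      Equiv.swap_apply_of_ne_of_ne hax hax']
  have hc : ∀ (u : (ι → Bool) → ℝ) (l : ι), (∀ e, u (fun i => e (π i)) = u e) → π l = l →
      cavCoef v h x y u l = cavCoef v h x' y' u l := fun u l hu hl => by
    rw [cavCoef, cavCoef, ← siteAvg_perm π]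
    simp only [spinDiff, hu, p1, p2, hl]
  have hl : linCoef v h x y (fun e => spin (e z)) x y =
      linCoef v h x' y' (fun e => spin (e z)) x' y' := by
    rw [linCoef, linCoef, ← siteAvg_perm π]
    simp only [spinDiff, p1, p2, p3]
  rw [cavRatio, cavRatio, hc _ a (fun _ => rfl) p4, hl, hc _ z (fun e => by simp only [p3]) p3,
    hc _ a (fun e => by simp only [p3]) p4]

end Ratio

section Pairs

lemma nu_comp_inl {ι κ : Type} [Fintype ι] [DecidableEq ι] [Fintype κ] [DecidableEq κ] {N : ℕ}
    {β h : ℝ} (f : (ι → Cfg N) → ℝ) :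
    nu N β h (fun s : ι ⊕ κ → Cfg N => f (fun l => s (Sum.inl l))) = nu N β h f := by
  simp only [nu, gibbs_eq_replicaAvg, replicaAvg_comp_inl]

variable {L : Type} [Fintype L] [DecidableEq L]

lemma prod_sigma_eq_prod_pow (e : L → ℕ) (T : Finset (Σ l, Fin (e l))) (g : L → ℝ) :
    ∏ r ∈ T, g r.1 = ∏ l, g l ^ #{r ∈ T | r.1 = l} := by
  rw [← Finset.prod_fiberwise' T (fun r => r.1) g]
  simp only [Finset.prod_const]

lemma card_filter_sigma (e : L → ℕ) (l : L) :
    #{r ∈ (univ : Finset (Σ l, Fin (e l))) | r.1 = l} = e l := by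
  rw [← Fintype.card_subtype, Fintype.card_congr (Equiv.sigmaSubtype l)]
  exact Fintype.card_fin _

lemma card_filter_erase_sigma (e : L → ℕ) (r : Σ l, Fin (e l)) (l : L) :
    #{r' ∈ univ.erase r | r'.1 = l} = Function.update e r.1 (e r.1 - 1) l := by
  rw [Finset.filter_erase]
  by_cases hl : l = r.1
  · subst hl
    rw [Function.update_self, Finset.card_erase_of_mem (by simp), card_filter_sigma]
  · rw [Function.update_of_ne hl, Finset.erase_eq_of_notMem (by simp [Ne.symm hl]),
      card_filter_sigma]

/-- The product of powers of the linear statistics of pairs of replicas. -/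
def pairProd {N : ℕ} (t : Fin N → ℝ) (e : L → ℕ) (s : L × Fin 2 → Cfg N) : ℝ :=
  ∏ l, linStat t (s (l, 0)) (s (l, 1)) ^ e l

/-- The ratio attached to the pair `l`. -/
def pairRatio (β v h : ℝ) (l : L) : ℝ :=
  cavRatio β v h (ι := (L × Fin 2) ⊕ Fin 8) (Sum.inl (l, 0)) (Sum.inl (l, 1)) (Sum.inr 0)
    (Sum.inr 1)

lemma pairRatio_eq (β v h : ℝ) (l l' : L) : pairRatio β v h l = pairRatio β v h l' := by
  by_cases hl : l = l'
  · rw [hl]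
  · apply cavRatio_eq <;> simp [hl]

lemma exists_nu_pairProd (e : L → ℕ) : ∃ C : ℝ, 0 ≤ C ∧
    ∀ {N : ℕ} {β q h : ℝ} {t : Fin N → ℝ}, Setup N β q h t → ∀ {m k : Fin N}, t m = 0 → t k = 0 →
    k ≠ m → ∀ {A : (L × Fin 2 → Cfg N) → ℝ}, (∀ s, |A s| ≤ 4) → (∀ j, j ≠ m → SiteFree j A) →
    ∀ l : L, |nu N β h (fun s => (spin (s (l, 0) k) - spin (s (l, 1) k)) *
        (A s * pairProd t e s)) - pairRatio β (β * √q) h l * ((∑ j, t j) / N * (e l *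
          nu N β h (fun s => A s * pairProd t (Function.update e l (e l - 1)) s)))| ≤
      C * (1 / N) := by
  obtain ⟨C, hC, hM⟩ := exists_nu_spinDiff_mul ((L × Fin 2) ⊕ Fin 8) (Σ l, Fin (e l)) (by simp)
  refine ⟨C, hC, fun {N β q h t} H m k hm hk hkm A hA hAf l => ?_⟩
  set I : Finset ((L × Fin 2) ⊕ Fin 8) := insert (Sum.inr 0) (univ.image Sum.inl) with hI
  have hmem : ∀ p, Sum.inl p ∈ I := fun p => by simp [hI]
  set c : (Σ l, Fin (e l)) → (L × Fin 2) ⊕ Fin 8 := fun r => Sum.inl (r.1, 0) with hc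
  set d : (Σ l, Fin (e l)) → (L × Fin 2) ⊕ Fin 8 := fun r => Sum.inl (r.1, 1) with hd
  set A' : ((L × Fin 2) ⊕ Fin 8 → Cfg N) → ℝ := fun s => A (fun p => s (Sum.inl p)) with hA'
  have hstat : IsStatProd I m c d A' := ⟨fun s => hA _, fun j hj s s' hs =>
    hAf j hj _ _ fun p => hs (Sum.inl p), fun s s' hs =>
      congrArg A (funext fun p => hs _ (hmem p)), fun r => hmem _, fun r => hmem _⟩
  have hsep : Separates (Sum.inl (l, 0)) (Sum.inl (l, 1)) c d := fun r => by
    by_cases hr : r.1 = l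
    · exact Or.inl (by simp [hc, hd, hr])
    · exact Or.inr (by simp [hc, hd, hr])
  have hcard : #I + 5 ≤ Fintype.card ((L × Fin 2) ⊕ Fin 8) := by
    have h1 : #I ≤ #(univ.image (Sum.inl : L × Fin 2 → (L × Fin 2) ⊕ Fin 8)) + 1 :=
      Finset.card_insert_le _ _
    have h2 := Finset.card_image_le (s := (univ : Finset (L × Fin 2)))
      (f := (Sum.inl : L × Fin 2 → (L × Fin 2) ⊕ Fin 8))
    rw [Fintype.card_sum, Fintype.card_fin]
    rw [Finset.card_univ] at h2
    omega
  have hmain := hM H hm hk hkm (z := Sum.inr 0) (a := Sum.inr 1) (hmem (l, 0)) (hmem (l, 1))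
    (by simp [hI]) (by simp [hI]) (by simp) (by simp) (by simp) hcard hstat hsep
  have hF : ∀ T s, statProd t c d A' T s = A (fun p => s (Sum.inl p)) *
      pairProd t (fun l => #{r ∈ T | r.1 = l}) (fun p => s (Sum.inl p)) := fun T s => by
    rw [statProd, pairProd, ← prod_sigma_eq_prod_pow e T
      (fun l => linStat t (s (Sum.inl (l, 0))) (s (Sum.inl (l, 1))))]
  have hnu1 : nu N β h (fun s => spinDiff (Sum.inl (l, 0)) (Sum.inl (l, 1)) (fun i => s i k) *
      statProd t c d A' univ s) =
      nu N β h (fun s => (spin (s (l, 0) k) - spin (s (l, 1) k)) * (A s * pairProd t e s)) := by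
    simp only [hF, card_filter_sigma, spinDiff]
    exact nu_comp_inl (κ := Fin 8)
      (fun s => (spin (s (l, 0) k) - spin (s (l, 1) k)) * (A s * pairProd t e s))
  have hnu2 : ∀ r : Σ l, Fin (e l), nu N β h (statProd t c d A' (univ.erase r)) =
      nu N β h (fun s => A s * pairProd t (Function.update e r.1 (e r.1 - 1)) s) := fun r => by
    rw [← nu_comp_inl (κ := Fin 8)
      (fun s => A s * pairProd t (Function.update e r.1 (e r.1 - 1)) s)]
    refine congrArg (nu N β h) (funext fun s => ?_)
    rw [hF]
    simp only [card_filter_erase_sigma]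
  have hsum : (∑ r, if c r = Sum.inl (l, 0) then
      nu N β h (statProd t c d A' (univ.erase r)) else 0) =
      e l * nu N β h (fun s => A s * pairProd t (Function.update e l (e l - 1)) s) := by
    rw [← Finset.sum_filter, Finset.sum_congr rfl fun r hr => ?_, Finset.sum_const, nsmul_eq_mul]
    rotate_left
    · exact nu N β h (fun s => A s * pairProd t (Function.update e l (e l - 1)) s)
    · have : r.1 = l := by simpa [hc] using hr
      rw [hnu2, this]
    · congr 2
      rw [← card_filter_sigma e l]
      congr 1
      ext r
      simp [hc]
  rw [hnu1, hsum] at hmain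
  exact hmain

end Pairs

section Final

variable {M : ℕ}

/-- The weights with the last two coordinates set to zero. -/
def dropTwo (t : Fin (M + 2) → ℝ) (i : Fin (M + 2)) : ℝ :=
  if i = Fin.last (M + 1) ∨ i = (Fin.last M).castSucc then 0 else t i

lemma SbarEq_eq (n : ℕ) (t : Fin (M + 2) → ℝ) (s : Fin n × Fin 2 → Cfg (M + 2)) (l : Fin n) :
    SbarEq M n t s l = linStat (dropTwo t) (s (l, 0)) (s (l, 1)) := by
  rw [SbarEq, linStat, Fin.sum_univ_castSucc, Fin.sum_univ_castSucc]
  have h1 : dropTwo t (Fin.last (M + 1)) = 0 := by simp [dropTwo]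
  have h2 : dropTwo t (Fin.last M).castSucc = 0 := by simp [dropTwo]
  rw [h1, h2, zero_mul, zero_mul, add_zero, add_zero]
  refine Finset.sum_congr rfl fun i _ => ?_
  have h3 : i.castSucc.castSucc ≠ Fin.last (M + 1) := (Fin.castSucc_lt_last _).ne
  have h4 : i.castSucc.castSucc ≠ (Fin.last M).castSucc := fun h =>
    (Fin.castSucc_lt_last i).ne (Fin.castSucc_injective _ h)
  rw [dropTwo, if_neg (by simp [h3, h4])]

lemma sum_dropTwo_sq_le {t : Fin (M + 2) → ℝ} : ∑ i, dropTwo t i ^ 2 ≤ ∑ i, t i ^ 2 :=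
  Finset.sum_le_sum fun i _ => by
    rw [dropTwo]
    split_ifs
    · rw [zero_pow two_ne_zero]
      exact sq_nonneg _
    · exact le_rfl

lemma pairProd_cons {n : ℕ} (t : Fin (M + 2) → ℝ) (b r : ℕ) (kvec : Fin (n + 1) → ℕ)
    (s : Fin (n + 2) × Fin 2 → Cfg (M + 2)) :
    pairProd (dropTwo t) (Fin.cons b (Function.update kvec 0 r) : Fin (n + 2) → ℕ) s =
      SbarEq M (n + 2) t s 0 ^ b * (SbarEq M (n + 2) t s 1 ^ r *
        ∏ j ∈ univ.erase 0, SbarEq M (n + 2) t s j.succ ^ kvec j) := by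
  simp only [pairProd, ← SbarEq_eq]
  rw [Fin.prod_univ_succ, ← Finset.mul_prod_erase _ _ (Finset.mem_univ (0 : Fin (n + 1)))]
  simp only [Fin.cons_zero, Fin.cons_succ, Function.update_self]
  congr 2
  refine Finset.prod_congr rfl fun j hj => ?_
  rw [Function.update_of_ne (Finset.ne_of_mem_erase hj)]

lemma choose_two_mul_sub {k : ℕ} (hk : 4 ≤ k) :
    (Nat.choose (k - 1) 2 : ℝ) * (k - 3 : ℕ) = ((k : ℝ) - 1) * Nat.choose (k - 2) 2 := by
  obtain ⟨i, rfl⟩ := Nat.exists_eq_add_of_le' hk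
  have h1 : i + 4 - 1 = i + 3 := by omega
  have h2 : i + 4 - 2 = i + 2 := by omega
  have h3 : i + 4 - 3 = i + 1 := by omega
  rw [h1, h2, h3, Nat.cast_choose_two, Nat.cast_choose_two]
  push_cast
  ring

end Final

lemma exists_nu_sbar_sub {n : ℕ} {kvec : Fin (n + 1) → ℕ} (hk : 4 ≤ kvec 0) :
    ∃ K : ℝ, ∀ β : ℝ, 0 < β → β < 1 / 16 → ∀ (M : ℕ) (h : ℝ) (t : Fin (M + 2) → ℝ),
      (∑ i, t i ^ 2) = 1 →
      |(Nat.choose (kvec 0 - 1) 2 : ℝ) * nu (M + 2) β h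
          (fun s : Fin (n + 2) × Fin 2 → Cfg (M + 2) => sbarAt M (n + 2) s 1 (Fin.last (M + 1)) *
            (sbarAt M (n + 2) s 1 (Fin.last M).castSucc ^ 2 * pairProd (dropTwo t)
              (Fin.cons 0 (Function.update kvec 0 (kvec 0 - 3)) : Fin (n + 2) → ℕ) s)) -
        ((kvec 0 : ℝ) - 1) * ((Nat.choose (kvec 0 - 2) 2 : ℝ) * nu (M + 2) β h
          (fun s : Fin (n + 2) × Fin 2 → Cfg (M + 2) => sbarAt M (n + 2) s 0 (Fin.last (M + 1)) *
            (sbarAt M (n + 2) s 1 (Fin.last M).castSucc ^ 2 * pairProd (dropTwo t)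
              (Fin.cons 1 (Function.update kvec 0 (kvec 0 - 4)) : Fin (n + 2) → ℕ) s)))| ≤
        K / (M + 2) := by
  set e₁ : Fin (n + 2) → ℕ := Fin.cons 0 (Function.update kvec 0 (kvec 0 - 3)) with he₁
  set e₀ : Fin (n + 2) → ℕ := Fin.cons 1 (Function.update kvec 0 (kvec 0 - 4)) with he₀
  obtain ⟨C₁, -, hC₁⟩ := exists_nu_pairProd e₁
  obtain ⟨C₀, -, hC₀⟩ := exists_nu_pairProd e₀
  refine ⟨(Nat.choose (kvec 0 - 1) 2 : ℝ) * C₁ +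
    ((kvec 0 : ℝ) - 1) * (Nat.choose (kvec 0 - 2) 2 * C₀), fun β hβ hβ' M h t ht => ?_⟩
  obtain ⟨q, hq⟩ := exists_admissible h hβ hβ'
  have H : Setup (M + 2) β q h (dropTwo t) :=
    { hq with
      N_pos := by omega
      sum_sq := sum_dropTwo_sq_le.trans ht.le }
  have hm : dropTwo t (Fin.last M).castSucc = 0 := by simp [dropTwo]
  have hl : dropTwo t (Fin.last (M + 1)) = 0 := by simp [dropTwo]
  have hlm : Fin.last (M + 1) ≠ (Fin.last M).castSucc := (Fin.castSucc_lt_last _).ne'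
  set A : (Fin (n + 2) × Fin 2 → Cfg (M + 2)) → ℝ :=
    fun s => sbarAt M (n + 2) s 1 (Fin.last M).castSucc ^ 2 with hA
  have hA4 : ∀ s, |A s| ≤ 4 := fun s => by
    rw [hA, abs_pow]
    exact (pow_le_pow_left₀ (abs_nonneg _) (abs_spin_sub_le _ _) 2).trans (by norm_num)
  have hAf : ∀ j, j ≠ (Fin.last M).castSucc → SiteFree j A := fun j hj s s' hs => by
    simp only [hA, sbarAt, hs _ _ hj.symm]
  have h₁ := hC₁ H hm hl hlm hA4 hAf 1
  have h₀ := hC₀ H hm hl hlm hA4 hAf 0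
  have hone : (1 : Fin (n + 2)) = Fin.succ 0 := by simp
  have hu₁ : Function.update e₁ 1 (e₁ 1 - 1) =
      Fin.cons 0 (Function.update kvec 0 (kvec 0 - 4)) := by
    rw [he₁, hone, ← Fin.cons_update, Fin.cons_succ, Function.update_self,
      Function.update_idem]
    rfl
  have hu₀ : Function.update e₀ 0 (e₀ 0 - 1) =
      Fin.cons 0 (Function.update kvec 0 (kvec 0 - 4)) := by
    rw [he₀, Fin.update_cons_zero]
    rfl
  have hv₁ : e₁ 1 = kvec 0 - 3 := by
    rw [he₁, hone, Fin.cons_succ, Function.update_self]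
  have hv₀ : e₀ 0 = 1 := rfl
  rw [hu₁, hv₁, pairRatio_eq _ _ _ 1 0] at h₁
  rw [hu₀, hv₀, Nat.cast_one, one_mul] at h₀
  have hch := choose_two_mul_sub hk
  have hk1 : (0 : ℝ) ≤ (kvec 0 : ℝ) - 1 := by
    have : (4 : ℝ) ≤ kvec 0 := by exact_mod_cast hk
    linarith
  set ρ := pairRatio β (β * √q) h (0 : Fin (n + 2))
  set W := nu (M + 2) β h (fun s => A s * pairProd (dropTwo t)
    (Fin.cons 0 (Function.update kvec 0 (kvec 0 - 4)) : Fin (n + 2) → ℕ) s)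
  set T := (∑ j, dropTwo t j) / ((M + 2 : ℕ) : ℝ)
  set c₁ : ℝ := (Nat.choose (kvec 0 - 1) 2 : ℝ)
  set c₀ : ℝ := (Nat.choose (kvec 0 - 2) 2 : ℝ)
  have hc₁ : 0 ≤ c₁ := Nat.cast_nonneg _
  have hc₀ : 0 ≤ c₀ := Nat.cast_nonneg _
  have hN : (1 : ℝ) / ((M + 2 : ℕ) : ℝ) = 1 / (M + 2) := by push_cast; rfl
  rw [hN] at h₁ h₀
  have e1 := abs_le.1 h₁
  have e0 := abs_le.1 h₀
  simp only [sbarAt]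
  set X := nu (M + 2) β h (fun s => (spin (s ((1 : Fin (n + 2)), 0) (Fin.last (M + 1))) -
    spin (s (1, 1) (Fin.last (M + 1)))) * (A s * pairProd (dropTwo t) e₁ s)) with hX
  set Y := nu (M + 2) β h (fun s => (spin (s ((0 : Fin (n + 2)), 0) (Fin.last (M + 1))) -
    spin (s (0, 1) (Fin.last (M + 1)))) * (A s * pairProd (dropTwo t) e₀ s)) with hY
  calc |c₁ * X - ((kvec 0 : ℝ) - 1) * (c₀ * Y)|
      = |c₁ * (X - ρ * (T * ((kvec 0 - 3 : ℕ) * W))) -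
          ((kvec 0 : ℝ) - 1) * (c₀ * (Y - ρ * (T * W)))| := by
        congr 1
        linear_combination (ρ * T * W) * hch
    _ ≤ c₁ * |X - ρ * (T * ((kvec 0 - 3 : ℕ) * W))| +
          ((kvec 0 : ℝ) - 1) * (c₀ * |Y - ρ * (T * W)|) := by
        refine (abs_sub _ _).trans (le_of_eq ?_)
        rw [abs_mul, abs_mul, abs_mul, abs_of_nonneg hc₁, abs_of_nonneg hc₀, abs_of_nonneg hk1]
    _ ≤ c₁ * (C₁ * (1 / (M + 2))) + ((kvec 0 : ℝ) - 1) * (c₀ * (C₀ * (1 / (M + 2)))) := by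
        gcongr
    _ = _ := by ring

/-- Step 3, (29): for `k₁ ≥ 4` and even `k₂,…,k_n`,
`|ν(R₂₁) − (k₁−1)·ν(R̄₂₁)| ≤ K/N`, where
`R₂₁ = C(k₁−1,2)·σ̄_N¹ (σ̄_{N−1}¹)² (S₁⁼)^{k₁−3} ∏_{l≥2}(S_l⁼)^{k_l}` and
`R̄₂₁ = C(k₁−2,2)·σ̄_N⁰ (σ̄_{N−1}¹)² S₀⁼ (S₁⁼)^{k₁−4} ∏_{l≥2}(S_l⁼)^{k_l}`
(with `N = M+2`; the pair `j+1` carries exponent `kvec j`, so `k₁ = kvec 0`). -/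
theorem stmt18 :
    ∃ β₀ : ℝ, 0 < β₀ ∧
      ∀ n : ℕ, ∀ kvec : Fin (n + 1) → ℕ, 4 ≤ kvec 0 →
        (∀ j : Fin (n + 1), j ≠ 0 → Even (kvec j)) →
        ∃ K : ℝ, ∀ β : ℝ, 0 < β → β < β₀ → ∀ M : ℕ, ∀ h : ℝ, 0 ≤ h →
          ∀ t : Fin (M + 2) → ℝ, (∑ i, t i ^ 2) = 1 →
            |nu (M + 2) β h
                (fun σs : Fin (n + 2) × Fin 2 → Cfg (M + 2) =>
                  (Nat.choose (kvec 0 - 1) 2 : ℝ) *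
                    (sbarAt M (n + 2) σs 1 (Fin.last (M + 1)) *
                      sbarAt M (n + 2) σs 1 (Fin.last M).castSucc ^ 2 *
                      SbarEq M (n + 2) t σs 1 ^ (kvec 0 - 3) *
                      ∏ j ∈ Finset.univ.erase (0 : Fin (n + 1)),
                        SbarEq M (n + 2) t σs j.succ ^ kvec j)) -
              ((kvec 0 : ℝ) - 1) *
                nu (M + 2) β h
                  (fun σs : Fin (n + 2) × Fin 2 → Cfg (M + 2) =>
                    (Nat.choose (kvec 0 - 2) 2 : ℝ) *
                      (sbarAt M (n + 2) σs 0 (Fin.last (M + 1)) *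
                        sbarAt M (n + 2) σs 1 (Fin.last M).castSucc ^ 2 *
                        SbarEq M (n + 2) t σs 0 *
                        SbarEq M (n + 2) t σs 1 ^ (kvec 0 - 4) *
                        ∏ j ∈ Finset.univ.erase (0 : Fin (n + 1)),
                          SbarEq M (n + 2) t σs j.succ ^ kvec j))| ≤
              K / (M + 2) := by
  refine ⟨1 / 16, by norm_num, fun n kvec hk _ => ?_⟩
  obtain ⟨K, hK⟩ := exists_nu_sbar_sub hk
  refine ⟨K, fun β hβ hβ' M h _ t ht => ?_⟩
  refine le_of_eq_of_le ?_ (hK β hβ hβ' M h t ht)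
  simp only [nu_const_mul, pairProd_cons, pow_zero, one_mul, pow_one]
  congr! 5 <;> ring_nf

end
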